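/- Let (X, μ) be a probability space and T₁, T₂ two commuting invertible measure-preserving transformations such that the system (X, μ, T₁, T₂) is ergodic (every measurable set invariant under both T₁ and T₂ has measure 0 or 1). Let A be a measurable set with μ(A) > 0. Then for every ε > 0, the set {n ∈ ℤ : μ(A ∩ T₁ⁿA ∩ T₂ⁿA) > μ(A)⁴ − ε} is syndetic. -/

import Mathlib

open MeasureTheory

/-- A set `E ⊆ ℤ` is syndetic if there is `N > 0` such that every interval
`[M, M+N)` meets `E`. -/
def Syndetic (E : Set ℤ) : Prop :=
  ∃ N : ℤ, 0 < N ∧ ∀ M : ℤ, ∃ n ∈ E, M ≤ n ∧ n < M + N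

open Filter Topology ComplexConjugate

/-- A finitely additive mean on bounded sequences indexed by `ℤ`, extended linearly to all
sequences. -/
structure ZMean where
  /-- the underlying functional -/
  toLin : (ℤ → ℝ) →ₗ[ℝ] ℝ
  one : toLin (fun _ => 1) = 1
  nonneg : ∀ (c : ℤ → ℝ) (C : ℝ), (∀ n, 0 ≤ c n) → (∀ n, c n ≤ C) → 0 ≤ toLin c

namespace ZMean

instance : CoeFun ZMean (fun _ => (ℤ → ℝ) → ℝ) := ⟨fun L => L.toLin⟩

variable (L : ZMean)

theorem const (C : ℝ) : L (fun _ => C) = C := by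
  have := L.toLin.map_smul C (fun _ => 1)
  rw [L.one] at this
  simpa [Pi.smul_def] using this

theorem mono {c d : ℤ → ℝ} (h : ∀ n, c n ≤ d n) (B : ℝ) (hB : ∀ n, d n - c n ≤ B) :
    L c ≤ L d := by
  have := L.nonneg (d - c) B (fun n => sub_nonneg.2 (h n)) hB
  rw [map_sub] at this
  linarith

theorem abs_le {c : ℤ → ℝ} {C : ℝ} (h : ∀ n, |c n| ≤ C) : |L c| ≤ C := by
  have h' := fun n => _root_.abs_le.1 (h n)
  rw [_root_.abs_le]
  constructor
  · rw [← L.const (-C)]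
    exact L.mono (fun n => (h' n).1) (2 * C) (fun n => by linarith [(h' n).2])
  · rw [← L.const C]
    exact L.mono (fun n => (h' n).2) (2 * C) (fun n => by linarith [(h' n).1])

/-- Complexification of a mean. -/
def cx : (ℤ → ℂ) →ₗ[ℂ] ℂ where
  toFun c := ⟨L (fun n => (c n).re), L (fun n => (c n).im)⟩
  map_add' c d := by
    apply Complex.ext
    · exact map_add L.toLin (fun n => (c n).re) (fun n => (d n).re)
    · exact map_add L.toLin (fun n => (c n).im) (fun n => (d n).im)
  map_smul' a c := by
    have h1 : (fun n => ((a • c) n).re) = a.re • (fun n => (c n).re) - a.im • fun n => (c n).im := by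
      ext n; simp
    have h2 : (fun n => ((a • c) n).im) = a.re • (fun n => (c n).im) + a.im • fun n => (c n).re := by
      ext n; simp
    rw [h1, h2, map_sub, map_add, map_smul, map_smul, map_smul, map_smul]
    apply Complex.ext <;> simp

theorem cx_re (c : ℤ → ℂ) : (L.cx c).re = L (fun n => (c n).re) := rfl

theorem cx_ofReal (r : ℤ → ℝ) : L.cx (fun n => (r n : ℂ)) = (L r : ℂ) := by
  apply Complex.ext
  · rfl
  · exact map_zero L.toLin

theorem cx_const (z : ℂ) : L.cx (fun _ => z) = z := by
  apply Complex.ext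
  · exact L.const z.re
  · exact L.const z.im

theorem cx_conj (c : ℤ → ℂ) : L.cx (fun n => conj (c n)) = conj (L.cx c) := by
  apply Complex.ext
  · rfl
  · exact map_neg L.toLin (fun n => (c n).im)

theorem cx_smul (a : ℂ) (c : ℤ → ℂ) : L.cx (fun n => a * c n) = a * L.cx c :=
  L.cx.map_smul a c

theorem norm_cx_le {c : ℤ → ℂ} {d : ℤ → ℝ} (D : ℝ) (h : ∀ n, ‖c n‖ ≤ d n) (hd : ∀ n, d n ≤ D) :
    ‖L.cx c‖ ≤ L d := by
  have hb : ∀ z : ℂ, ‖z‖ = 1 → (z * L.cx c).re ≤ L d := by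
    intro z hz
    rw [← cx_smul, cx_re]
    have h0 : ∀ n, |(z * c n).re| ≤ d n := fun n => by
      refine (Complex.abs_re_le_norm _).trans ?_
      rw [norm_mul, hz, one_mul]; exact h n
    exact L.mono (fun n => (le_abs_self _).trans (h0 n)) (2 * D)
      (fun n => by linarith [neg_abs_le (z * c n).re, h0 n, hd n])
  by_cases h0 : L.cx c = 0
  · rw [h0, norm_zero]
    have := hb 1 norm_one
    rw [h0] at this
    simpa using this
  · have hn : ‖L.cx c‖ ≠ 0 := by simpa using h0
    have := hb (conj (L.cx c) / ‖L.cx c‖) (by simp [hn])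
    rw [div_mul_eq_mul_div, ← Complex.normSq_eq_conj_mul_self, ← Complex.ofReal_div,
      Complex.ofReal_re, Complex.normSq_eq_norm_sq, sq, mul_div_assoc, div_self hn, mul_one] at this
    exact this

theorem norm_cx_le_const {c : ℤ → ℂ} {C : ℝ} (h : ∀ n, ‖c n‖ ≤ C) : ‖L.cx c‖ ≤ C := by
  have := L.norm_cx_le C h (fun _ => le_rfl)
  rwa [L.const] at this

/-- Cauchy-Schwarz in the form needed: a mean of absolute values vanishes with the mean of
squares. -/
theorem eq_zero_of_sq {c : ℤ → ℝ} {C : ℝ} (h0 : ∀ n, 0 ≤ c n) (hC : ∀ n, c n ≤ C)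
    (h : L (fun n => c n ^ 2) ≤ 0) : L c = 0 := by
  refine le_antisymm ?_ (L.nonneg c C h0 hC)
  refine le_of_forall_pos_le_add fun δ hδ => ?_
  have h1 : L c ≤ L ((fun _ => δ) + δ⁻¹ • fun n => c n ^ 2) := by
    refine L.mono (fun n => ?_) (δ + δ⁻¹ * C ^ 2) fun n => ?_
    · simp only [Pi.add_apply, Pi.smul_apply, smul_eq_mul]
      have : δ * (δ + δ⁻¹ * c n ^ 2 - c n) = (δ - c n / 2) ^ 2 + 3 / 4 * c n ^ 2 := by
        field_simp; ring
      nlinarith [sq_nonneg (δ - c n / 2), sq_nonneg (c n)]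
    · simp only [Pi.add_apply, Pi.smul_apply, smul_eq_mul]
      have : c n ^ 2 ≤ C ^ 2 := pow_le_pow_left₀ (h0 n) (hC n) 2
      have := mul_le_mul_of_nonneg_left this (inv_nonneg.2 hδ.le)
      linarith [h0 n]
  rw [map_add, map_smul, L.const, smul_eq_mul] at h1
  have := mul_nonpos_of_nonneg_of_nonpos (inv_nonneg.2 hδ.le) h
  linarith

theorem exists_ultralimit {ι : Type*} (𝒰 : Ultrafilter ι) (L : ι → ZMean) :
    ∃ M : ZMean, ∀ (c : ℤ → ℝ) (C : ℝ), (∀ n, |c n| ≤ C) →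
      Tendsto (fun i => L i c) 𝒰 (𝓝 (M c)) := by
  let p : Submodule ℝ (ℤ → ℝ) :=
    { carrier := {c | ∃ C, ∀ n, |c n| ≤ C}
      add_mem' := by
        rintro a b ⟨A, hA⟩ ⟨B, hB⟩
        exact ⟨A + B, fun n => (abs_add_le _ _).trans (add_le_add (hA n) (hB n))⟩
      zero_mem' := ⟨0, fun n => by simp⟩
      smul_mem' := by
        rintro r a ⟨A, hA⟩
        refine ⟨|r| * A, fun n => ?_⟩
        rw [Pi.smul_apply, smul_eq_mul, abs_mul]
        exact mul_le_mul_of_nonneg_left (hA n) (abs_nonneg r) }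
  have key : ∀ c : p, ∃ x, Tendsto (fun i => L i (c : ℤ → ℝ)) 𝒰 (𝓝 x) := by
    rintro ⟨c, C, hC⟩
    obtain ⟨x, -, hx⟩ := (isCompact_Icc (a := -C) (b := C)).ultrafilter_le_nhds
      (𝒰.map fun i => L i c) (by
        rw [le_principal_iff]
        exact Filter.mem_map.2 (Filter.univ_mem' fun i => Set.mem_Icc.2
          (_root_.abs_le.1 ((L i).abs_le hC))))
    exact ⟨x, hx⟩
  choose l hl using key
  let l' : p →ₗ[ℝ] ℝ :=
    { toFun := l
      map_add' := fun a b => by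
        refine tendsto_nhds_unique (hl (a + b)) (((hl a).add (hl b)).congr fun i => ?_)
        exact (map_add (L i).toLin _ _).symm
      map_smul' := fun r a => by
        refine tendsto_nhds_unique (hl (r • a)) (((hl a).const_mul r).congr fun i => ?_)
        exact (map_smul (L i).toLin r _).symm }
  obtain ⟨g, hg⟩ := LinearMap.exists_extend l'
  have hg' : ∀ (c : ℤ → ℝ) (C : ℝ), (∀ n, |c n| ≤ C) →
      Tendsto (fun i => L i c) 𝒰 (𝓝 (g c)) := fun c C hC => by
    have : g c = l ⟨c, C, hC⟩ := LinearMap.congr_fun hg ⟨c, C, hC⟩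
    rw [this]
    exact hl _
  refine ⟨⟨g, ?_, fun c C h0 hC => ?_⟩, hg'⟩
  · refine tendsto_nhds_unique (hg' (fun _ => 1) 1 (by simp)) ?_
    refine tendsto_const_nhds.congr fun i => ?_
    exact (L i).one.symm
  · exact ge_of_tendsto' (hg' c C fun n => by rw [abs_of_nonneg (h0 n)]; exact hC n)
      fun i => (L i).nonneg c C h0 hC

/-- The uniform mean over the interval `[s, s + N]`. -/
noncomputable def avg (s : ℤ) (N : ℕ) : ZMean where
  toLin :=
    { toFun := fun c => ((N : ℝ) + 1)⁻¹ * ∑ k ∈ Finset.range (N + 1), c (s + k)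
      map_add' := fun a b => by simp [Finset.sum_add_distrib, mul_add]
      map_smul' := fun r a => by simp [← Finset.mul_sum]; ring }
  one := by simp; field_simp
  nonneg := fun c _ h0 _ => mul_nonneg (by positivity) (Finset.sum_nonneg fun k _ => h0 _)

theorem avg_apply (s : ℤ) (N : ℕ) (c : ℤ → ℝ) :
    avg s N c = ((N : ℝ) + 1)⁻¹ * ∑ k ∈ Finset.range (N + 1), c (s + k) := rfl

/-- Shift invariance of a mean. -/
def Invariant (L : ZMean) : Prop :=
  ∀ (c : ℤ → ℝ) (C : ℝ), (∀ n, |c n| ≤ C) → ∀ m, L (fun n => c (n + m)) = L c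

theorem avg_shift_sub (s : ℤ) (N : ℕ) (c : ℤ → ℝ) :
    avg s N (fun n => c (n + 1)) - avg s N c = ((N : ℝ) + 1)⁻¹ * (c (s + (N + 1)) - c s) := by
  rw [avg_apply, avg_apply, ← mul_sub, ← Finset.sum_sub_distrib]
  congr 1
  have := Finset.sum_range_sub (fun k : ℕ => c (s + k)) (N + 1)
  simp only [Nat.cast_add, Nat.cast_one, Nat.cast_zero, add_zero] at this
  rw [← this]
  simp [add_assoc]

/-- A shift-invariant mean along given intervals of growing length. -/
theorem exists_invariant (s : ℕ → ℤ) :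
    ∃ L : ZMean, L.Invariant ∧ ∀ (c : ℤ → ℝ) (C β : ℝ) , (∀ n, |c n| ≤ C) →
      (∀ N, avg (s N) N c ≤ β) → L c ≤ β := by
  obtain ⟨M, hM⟩ := exists_ultralimit (hyperfilter ℕ) (fun N => avg (s N) N)
  have h1 : ∀ (c : ℤ → ℝ) (C : ℝ), (∀ n, |c n| ≤ C) → M (fun n => c (n + 1)) = M c := by
    intro c C hC
    rw [← sub_eq_zero]
    refine tendsto_nhds_unique ((hM (fun n => c (n + 1)) C fun n => hC _).sub (hM c C hC)) ?_
    have hz : Tendsto (fun N : ℕ => ((N : ℝ) + 1)⁻¹ * (2 * C)) (hyperfilter ℕ : Filter ℕ)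
        (𝓝 0) := by
      have : Tendsto (fun N : ℕ => ((N : ℝ) + 1)⁻¹) atTop (𝓝 0) :=
        tendsto_inv_atTop_zero.comp (tendsto_atTop_add_const_right _ _ tendsto_natCast_atTop_atTop)
      simpa using (this.mul_const (2 * C)).mono_left (Nat.hyperfilter_le_atTop)
    refine squeeze_zero_norm (fun N => ?_) hz
    rw [avg_shift_sub, norm_mul, Real.norm_of_nonneg (by positivity)]
    refine mul_le_mul_of_nonneg_left ?_ (by positivity)
    refine (norm_sub_le _ _).trans ?_
    linarith [hC (s N + (N + 1)), hC (s N), Real.norm_eq_abs (c (s N)),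
      Real.norm_eq_abs (c (s N + (N + 1)))]
  refine ⟨M, fun c C hC m => ?_, fun c C β hC h => le_of_tendsto' (hM c C hC) h⟩
  induction m using Int.induction_on with
  | zero => simp
  | succ k ih =>
    rw [← ih, ← h1 (fun n => c (n + k)) C fun n => hC _]
    congr 1; ext n; congr 1; ring
  | pred k ih =>
    rw [← ih, ← h1 (fun n => c (n + (-k - 1))) C fun n => hC _]
    congr 1; ext n; congr 1; ring

theorem Invariant.cx {L : ZMean} (hL : L.Invariant) {c : ℤ → ℂ} {C : ℝ} (h : ∀ n, ‖c n‖ ≤ C)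
    (m : ℤ) : L.cx (fun n => c (n + m)) = L.cx c := by
  apply Complex.ext
  · exact hL (fun n => (c n).re) C (fun n => (Complex.abs_re_le_norm _).trans (h n)) m
  · exact hL (fun n => (c n).im) C (fun n => (Complex.abs_im_le_norm _).trans (h n)) m

end ZMean

/-- The character `n ↦ γ ^ n` of `ℤ`. -/
noncomputable def intChar : Circle →* (ℤ → ℂ) where
  toFun γ n := ((γ ^ n : Circle) : ℂ)
  map_one' := by ext; simp
  map_mul' a b := by ext n; simp [mul_zpow]

theorem intChar_apply (γ : Circle) (n : ℤ) : intChar γ n = ((γ ^ n : Circle) : ℂ) := rfl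

theorem norm_intChar (γ : Circle) (n : ℤ) : ‖intChar γ n‖ = 1 := Circle.norm_coe _

theorem intChar_add (γ : Circle) (m n : ℤ) : intChar γ (m + n) = intChar γ m * intChar γ n := by
  simp [intChar_apply, zpow_add]

theorem conj_intChar (γ : Circle) (n : ℤ) : conj (intChar γ n) = intChar γ (-n) := by
  rw [intChar_apply, intChar_apply, zpow_neg, Circle.coe_inv_eq_conj]

theorem intChar_zero (γ : Circle) : intChar γ 0 = 1 := by simp [intChar_apply]

theorem ZMean.Invariant.cx_intChar {A : ZMean} (hA : A.Invariant) (γ : Circle) :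
    0 ≤ (A.cx (intChar γ)).re := by
  by_cases h : γ = 1
  · subst h
    rw [map_one]
    have := A.cx_const 1
    change A.cx 1 = 1 at this
    simp [this]
  · have h1 := hA.cx (c := intChar γ) (C := 1) (fun n => (norm_intChar γ n).le) 1
    have h2 : A.cx (fun n => intChar γ (n + 1)) = γ * A.cx (intChar γ) := by
      rw [← A.cx_smul]
      congr 1; ext n
      rw [add_comm, intChar_add]; simp [intChar_apply]
    rw [h2] at h1
    have h3 : ((γ : ℂ) - 1) * A.cx (intChar γ) = 0 := by rw [sub_mul, h1]; ring
    rcases mul_eq_zero.1 h3 with h4 | h4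
    · exact absurd (Circle.ext (by simpa using sub_eq_zero.1 h4)) h
    · simp [h4]

/-- Trigonometric polynomials with nonnegative integer coefficients. -/
noncomputable def posTrig : Subsemiring (ℤ → ℂ) := (MonoidHom.mrange intChar).subsemiringClosure

theorem intChar_mem (γ : Circle) : intChar γ ∈ posTrig :=
  (Submonoid.subsemiringClosure_mem (MonoidHom.mrange intChar)).2
    (AddSubmonoid.subset_closure ⟨γ, rfl⟩)

theorem posTrig_induction {p : (ℤ → ℂ) → Prop} (hc : ∀ γ, p (intChar γ)) (h0 : p 0)
    (ha : ∀ a b, p a → p b → p (a + b)) {w : ℤ → ℂ} (hw : w ∈ posTrig) : p w := by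
  have hw' : w ∈ AddSubmonoid.closure (MonoidHom.mrange intChar : Set (ℤ → ℂ)) :=
    (Submonoid.subsemiringClosure_mem _).1 hw
  induction hw' using AddSubmonoid.closure_induction with
  | mem x hx => obtain ⟨γ, rfl⟩ := hx; exact hc γ
  | zero => exact h0
  | add a b ha' hb' h1 h2 =>
    exact ha a b (h1 ((Submonoid.subsemiringClosure_mem _).2 ha'))
      (h2 ((Submonoid.subsemiringClosure_mem _).2 hb'))

theorem posTrig_bounded {w : ℤ → ℂ} (hw : w ∈ posTrig) : ∃ C, ∀ n, ‖w n‖ ≤ C := by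
  refine posTrig_induction (p := fun w => ∃ C, ∀ n, ‖w n‖ ≤ C)
    (fun γ => ⟨1, fun n => (norm_intChar γ n).le⟩) ⟨0, by simp⟩ ?_ hw
  rintro a b ⟨A, hA⟩ ⟨B, hB⟩
  exact ⟨A + B, fun n => (norm_add_le _ _).trans (add_le_add (hA n) (hB n))⟩

theorem ZMean.Invariant.posTrig_nonneg {A : ZMean} (hA : A.Invariant) {w : ℤ → ℂ}
    (hw : w ∈ posTrig) : 0 ≤ (A.cx w).re := by
  refine posTrig_induction (p := fun w => 0 ≤ (A.cx w).re) hA.cx_intChar (by simp) (fun a b h1 h2 => ?_) hw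
  rw [map_add, Complex.add_re]; exact add_nonneg h1 h2

theorem posTrig_tendsto (A : ZMean) {ι : Type*} {l : Filter ι} {c : ι → ℤ → ℂ}
    (h : ∀ γ, Tendsto (fun i => A.cx (intChar γ * c i)) l (𝓝 0)) {w : ℤ → ℂ}
    (hw : w ∈ posTrig) : Tendsto (fun i => A.cx (w * c i)) l (𝓝 0) := by
  refine posTrig_induction (p := fun w => Tendsto (fun i => A.cx (w * c i)) l (𝓝 0)) h
    (by simpa using tendsto_const_nhds) (fun a b h1 h2 => ?_) hw
  simpa [add_mul] using h1.add h2

/-- An unnormalised Fejér kernel. -/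
noncomputable def fejer (γ : Circle) (k : ℕ) : ℤ → ℂ :=
  (∑ m ∈ Finset.range k, intChar (γ ^ m)) * ∑ m ∈ Finset.range k, intChar (γ⁻¹ ^ m)

theorem fejer_mem (γ : Circle) (k : ℕ) : fejer γ k ∈ posTrig :=
  mul_mem (sum_mem fun _ _ => intChar_mem _) (sum_mem fun _ _ => intChar_mem _)

theorem fejer_eq (γ : Circle) (k : ℕ) (n : ℤ) :
    fejer γ k n = ((‖∑ m ∈ Finset.range k, intChar (γ ^ m) n‖ ^ 2 : ℝ) : ℂ) := by
  rw [← Complex.normSq_eq_norm_sq, Complex.normSq_eq_conj_mul_self, mul_comm]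
  simp only [fejer, Pi.mul_apply, Finset.sum_apply, map_sum]
  congr 1
  refine Finset.sum_congr rfl fun m _ => ?_
  rw [intChar_apply, intChar_apply, ← Circle.coe_inv_eq_conj]
  simp

theorem fejer_mul_sub_one (γ : Circle) (k : ℕ) (n : ℤ) :
    ‖∑ m ∈ Finset.range k, intChar (γ ^ m) n‖ ^ 2 * ‖intChar γ n - 1‖ ^ 2 ≤ 4 := by
  rw [← mul_pow, ← norm_mul]
  have : (∑ m ∈ Finset.range k, intChar (γ ^ m) n) * (intChar γ n - 1)
      = intChar (γ ^ k) n - 1 := by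
    simp only [map_pow, Pi.pow_apply]
    exact geom_sum_mul _ _
  rw [this]
  have h2 : ‖intChar (γ ^ k) n - 1‖ ≤ 2 :=
    (norm_sub_le _ _).trans (by rw [norm_intChar, norm_one]; norm_num)
  nlinarith [norm_nonneg (intChar (γ ^ k) n - 1)]

theorem ZMean.Invariant.fejer_le {A : ZMean} (hA : A.Invariant) {w : ℤ → ℂ}
    (hw : w ∈ posTrig) (γ : Circle) (k : ℕ) :
    k * (A.cx w).re ≤ (A.cx (w * fejer γ k)).re := by
  have h1 : w * fejer γ k = ∑ m ∈ Finset.range k, ∑ m' ∈ Finset.range k,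
      w * intChar (γ ^ m * γ⁻¹ ^ m') := by
    simp_rw [fejer, Finset.sum_mul_sum, Finset.mul_sum, map_mul]
  have h2 : ∀ γ', 0 ≤ (A.cx (w * intChar γ')).re := fun γ' =>
    hA.posTrig_nonneg (mul_mem hw (intChar_mem _))
  simp_rw [h1, map_sum, Complex.re_sum]
  calc (k : ℝ) * (A.cx w).re = ∑ m ∈ Finset.range k, (A.cx w).re := by simp
    _ ≤ _ := Finset.sum_le_sum fun m hm => ?_
  refine le_trans (le_of_eq ?_) (Finset.single_le_sum (fun m' _ => h2 _) hm)
  simp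

/-- Product of Fejér kernels, as a nonnegative real sequence. -/
noncomputable def fejerProd (S : Finset Circle) (k : ℕ) (n : ℤ) : ℝ :=
  ∏ γ ∈ S, ‖∑ m ∈ Finset.range k, intChar (γ ^ m) n‖ ^ 2

theorem fejerProd_nonneg (S : Finset Circle) (k : ℕ) (n : ℤ) : 0 ≤ fejerProd S k n :=
  Finset.prod_nonneg fun _ _ => by positivity

theorem coe_fejerProd (S : Finset Circle) (k : ℕ) :
    (fun n => (fejerProd S k n : ℂ)) = ∏ γ ∈ S, fejer γ k := by
  ext n
  simp only [fejerProd, Complex.ofReal_prod, Finset.prod_apply, fejer_eq]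

theorem coe_fejerProd_mem (S : Finset Circle) (k : ℕ) :
    (fun n => (fejerProd S k n : ℂ)) ∈ posTrig := by
  rw [coe_fejerProd]; exact prod_mem fun _ _ => fejer_mem _ _

theorem fejerProd_bounded (S : Finset Circle) (k : ℕ) : ∃ C, ∀ n, fejerProd S k n ≤ C := by
  obtain ⟨C, hC⟩ := posTrig_bounded (coe_fejerProd_mem S k)
  exact ⟨C, fun n => by
    simpa [abs_of_nonneg (fejerProd_nonneg S k n)] using hC n⟩

open Classical in
theorem ZMean.Invariant.fejerProd_insert {A : ZMean} (hA : A.Invariant) (S : Finset Circle)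
    {γ : Circle} (hγ : γ ∉ S) (k : ℕ) :
    k * A (fejerProd S k) ≤ A (fejerProd (insert γ S) k) := by
  have := hA.fejer_le (coe_fejerProd_mem S k) γ k
  rw [A.cx_ofReal, Complex.ofReal_re] at this
  have h2 : ((fun n => (fejerProd S k n : ℂ)) * fejer γ k)
      = fun n => (fejerProd (insert γ S) k n : ℂ) := by
    rw [coe_fejerProd, coe_fejerProd, Finset.prod_insert hγ, mul_comm]
  rwa [h2, A.cx_ofReal, Complex.ofReal_re] at this

open Classical in
theorem ZMean.Invariant.one_le_fejerProd {A : ZMean} (hA : A.Invariant) (S : Finset Circle)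
    (k : ℕ) : 1 ≤ A (fejerProd S (k + 1)) := by
  induction S using Finset.induction_on with
  | empty =>
    have : fejerProd ∅ (k + 1) = fun _ => 1 := by ext; simp [fejerProd]
    rw [this, A.one]
  | insert γ S hγ ih =>
    have := hA.fejerProd_insert S hγ (k + 1)
    push_cast at this
    nlinarith [(Nat.cast_nonneg k : (0 : ℝ) ≤ k)]

/-- The mean with density `w`. -/
noncomputable def ZMean.withDensity (A : ZMean) (w : ℤ → ℝ) (hw : ∀ n, 0 ≤ w n) (C : ℝ)
    (hC : ∀ n, w n ≤ C) (hA : 1 ≤ A w) : ZMean where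
  toLin := (A w)⁻¹ • A.toLin ∘ₗ LinearMap.mulLeft ℝ w
  one := by
    simp only [LinearMap.smul_apply, LinearMap.comp_apply, LinearMap.mulLeft_apply, smul_eq_mul]
    have : (w * fun _ => (1 : ℝ)) = w := by ext; simp
    rw [this]
    exact inv_mul_cancel₀ (by positivity)
  nonneg := fun c D h0 hD => by
    refine mul_nonneg (by positivity) (A.nonneg _ (C * D) (fun n => mul_nonneg (hw n) (h0 n))
      fun n => ?_)
    exact mul_le_mul (hC n) (hD n) (h0 n) ((hw n).trans (hC n))

open Classical in
/-- A mean supported on Bohr neighbourhoods of zero. -/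
theorem ZMean.Invariant.exists_bohr {A : ZMean} (hA : A.Invariant) :
    ∃ M : ZMean, (∀ γ, M (fun n => ‖intChar γ n - 1‖) = 0) ∧
      (∀ (c : ℕ → ℤ → ℝ) (d : ℤ → ℝ) (C δ : ℝ),
        (∀ γ, Tendsto (fun i => A.cx (intChar γ * fun n => (c i n : ℂ))) atTop (𝓝 0)) →
        (∀ n, |d n| ≤ C) → (∀ᶠ i in atTop, ∀ n, |d n - c i n| ≤ δ) → |M d| ≤ δ) ∧
      (∀ (c : ℤ → ℝ) (C β : ℝ), (∀ n, |c n| ≤ C) →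
        (∀ (w : ℤ → ℝ) (D : ℝ), (∀ n, 0 ≤ w n) → (∀ n, w n ≤ D) → A (w * c) ≤ β * A w) →
        M c ≤ β) := by
  let 𝒰 : Ultrafilter (Finset Circle × ℕ) := Ultrafilter.of atTop
  have h𝒰 : (𝒰 : Filter (Finset Circle × ℕ)) ≤ atTop := Ultrafilter.of_le _
  choose D hD using fun i : Finset Circle × ℕ => fejerProd_bounded i.1 (i.2 + 1)
  let L : Finset Circle × ℕ → ZMean := fun i => A.withDensity (fejerProd i.1 (i.2 + 1))
    (fejerProd_nonneg _ _) (D i) (hD i) (hA.one_le_fejerProd _ _)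
  have hLpos : ∀ i : Finset Circle × ℕ, 0 < A (fejerProd i.1 (i.2 + 1)) := fun i =>
    zero_lt_one.trans_le (hA.one_le_fejerProd i.1 i.2)
  obtain ⟨M, hM⟩ := exists_ultralimit 𝒰 L
  have hn2 : ∀ γ n, ‖intChar γ n - 1‖ ≤ 2 := fun γ n =>
    (norm_sub_le _ _).trans (by rw [norm_intChar, norm_one]; norm_num)
  have hsq : ∀ γ n, ‖intChar γ n - 1‖ ^ 2 ≤ 4 := fun γ n => by
    nlinarith [hn2 γ n, norm_nonneg (intChar γ n - 1)]
  refine ⟨M, fun γ => ?_, fun c d C δ hc hd hcd => ?_, fun c C β hC hβ => ?_⟩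
  · refine M.eq_zero_of_sq (fun n => norm_nonneg _) (hn2 γ) ?_
    have h1 := hM (fun n => ‖intChar γ n - 1‖ ^ 2) 4 fun n => by
      rw [abs_of_nonneg (by positivity)]; exact hsq γ n
    have h2 : Tendsto (fun i : Finset Circle × ℕ => 4 * ((i.2 : ℝ) + 1)⁻¹) 𝒰 (𝓝 (4 * 0)) := by
      refine Tendsto.const_mul _ (Tendsto.mono_left ?_ h𝒰)
      rw [← prod_atTop_atTop_eq]
      exact (tendsto_inv_atTop_zero.comp (tendsto_atTop_add_const_right _ _
        tendsto_natCast_atTop_atTop)).comp tendsto_snd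
    rw [mul_zero] at h2
    refine le_of_tendsto_of_tendsto h1 h2 (h𝒰 ?_)
    filter_upwards [eventually_ge_atTop (({γ}, 0) : Finset Circle × ℕ)] with i hi
    have hγ : γ ∈ i.1 := Finset.singleton_subset_iff.1 hi.1
    change (A (fejerProd i.1 (i.2 + 1)))⁻¹ * A _ ≤ _
    rw [← div_eq_inv_mul, div_le_iff₀ (hLpos i)]
    have h3 := hA.fejerProd_insert (i.1.erase γ) (Finset.notMem_erase γ i.1) (i.2 + 1)
    rw [Finset.insert_erase hγ] at h3
    have h4 : A (fejerProd i.1 (i.2 + 1) * fun n => ‖intChar γ n - 1‖ ^ 2)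
        ≤ A ((4 : ℝ) • fejerProd (i.1.erase γ) (i.2 + 1)) := by
      obtain ⟨B, hB⟩ := fejerProd_bounded (i.1.erase γ) (i.2 + 1)
      have h0 := fejerProd_nonneg
      refine A.mono (fun n => ?_) (4 * B) fun n => ?_
      · simp only [Pi.mul_apply, Pi.smul_apply, smul_eq_mul]
        have h5 : fejerProd i.1 (i.2 + 1) n = fejerProd (i.1.erase γ) (i.2 + 1) n *
            ‖∑ m ∈ Finset.range (i.2 + 1), intChar (γ ^ m) n‖ ^ 2 :=
          (Finset.prod_erase_mul i.1 _ hγ).symm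
        rw [h5, mul_assoc, mul_comm 4]
        exact mul_le_mul_of_nonneg_left (fejer_mul_sub_one _ _ _) (h0 _ _ _)
      · simp only [Pi.mul_apply, Pi.smul_apply, smul_eq_mul]
        have := mul_nonneg (h0 i.1 (i.2 + 1) n) (sq_nonneg ‖intChar γ n - 1‖)
        linarith [hB n]
    rw [map_smul, smul_eq_mul] at h4
    refine h4.trans ?_
    push_cast at h3
    rw [mul_assoc, ← div_eq_inv_mul]
    refine mul_le_mul_of_nonneg_left ?_ (by norm_num)
    rw [le_div_iff₀ (by positivity)]
    linarith
  · refine le_of_tendsto' ((hM d C hd).abs) fun i => ?_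
    change |(A (fejerProd i.1 (i.2 + 1)))⁻¹ * A (fejerProd i.1 (i.2 + 1) * d)| ≤ δ
    rw [abs_mul, abs_of_pos (inv_pos.2 (hLpos i)), inv_mul_le_iff₀ (hLpos i)]
    have ht := (posTrig_tendsto A hc (coe_fejerProd_mem i.1 (i.2 + 1))).norm
    rw [norm_zero] at ht
    have ht' := ht.add_const (A (fejerProd i.1 (i.2 + 1)) * δ)
    rw [zero_add] at ht'
    refine ge_of_tendsto ht' (hcd.mono fun j hj => ?_)
    have e1 : (fun n => ((fejerProd i.1 (i.2 + 1) n : ℝ) : ℂ)) * (fun n => (c j n : ℂ))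
        = fun n => ((fejerProd i.1 (i.2 + 1) n * c j n : ℝ) : ℂ) := by ext n; simp
    rw [e1, A.cx_ofReal, Complex.norm_real, Real.norm_eq_abs]
    have e2 : fejerProd i.1 (i.2 + 1) * d = (fun n => fejerProd i.1 (i.2 + 1) n * c j n)
        + fun n => fejerProd i.1 (i.2 + 1) n * (d n - c j n) := by ext n; simp; ring
    rw [e2, map_add]
    refine (abs_add_le _ _).trans (add_le_add le_rfl ?_)
    have h6 := A.norm_cx_le (c := fun n => ((fejerProd i.1 (i.2 + 1) n * (d n - c j n) : ℝ) : ℂ))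
      (d := δ • fejerProd i.1 (i.2 + 1)) (δ * D i) (fun n => ?_) (fun n => ?_)
    · rw [A.cx_ofReal, Complex.norm_real, Real.norm_eq_abs, map_smul, smul_eq_mul] at h6
      linarith
    · rw [Complex.norm_real, Real.norm_eq_abs, abs_mul, abs_of_nonneg (fejerProd_nonneg _ _ _),
        mul_comm]
      exact mul_le_mul_of_nonneg_right (hj n) (fejerProd_nonneg _ _ _)
    · exact mul_le_mul_of_nonneg_left (hD i n) ((abs_nonneg _).trans (hj n))
  · refine le_of_tendsto' (hM c C hC) fun i => ?_
    change (A (fejerProd i.1 (i.2 + 1)))⁻¹ * A _ ≤ β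
    rw [inv_mul_le_iff₀ (hLpos i), mul_comm]
    exact hβ _ (D i) (fejerProd_nonneg _ _) (hD i)

section Hilbert

variable {H : Type*} [NormedAddCommGroup H] [InnerProductSpace ℂ H]

theorem exists_orthonormal_maximal {B : H →L[ℂ] H} {C : ℝ}
    (htr : ∀ s : Finset H, Orthonormal ℂ (fun e : s => (e : H)) →
      ∑ e ∈ s, (inner ℂ (B e) e).re ≤ C) {ε : ℝ} (hε : 0 < ε) :
    ∃ s : Finset H, ∀ x, (∀ e ∈ s, inner ℂ e x = 0) → ‖x‖ = 1 → (inner ℂ (B x) x).re ≤ ε := by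
  classical
  by_contra! hcon
  have key : ∀ k : ℕ, ∃ s : Finset H, s.card = k ∧ Orthonormal ℂ (fun e : s => (e : H)) ∧
      ∀ e ∈ s, ε ≤ (inner ℂ (B e) e).re := by
    intro k
    induction k with
    | zero => exact ⟨∅, rfl, ⟨fun i => absurd i.2 (Finset.notMem_empty _),
      fun i => absurd i.2 (Finset.notMem_empty _)⟩, by simp⟩
    | succ k ih =>
      obtain ⟨s, hs, hso, hsε⟩ := ih
      obtain ⟨x, hx, hx1, hxε⟩ := hcon s
      have hxs : x ∉ s := fun h => by
        have := hx x h
        rw [inner_self_eq_zero] at this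
        simp [this] at hx1
      refine ⟨insert x s, by rw [Finset.card_insert_of_notMem hxs, hs], ⟨?_, ?_⟩, ?_⟩
      · rintro ⟨e, he⟩
        rcases Finset.mem_insert.1 he with rfl | he
        · exact hx1
        · exact hso.1 ⟨e, he⟩
      · rintro ⟨e, he⟩ ⟨e', he'⟩ hne
        have hne' : e ≠ e' := fun h => hne (Subtype.ext h)
        rcases Finset.mem_insert.1 he with rfl | he <;>
          rcases Finset.mem_insert.1 he' with rfl | he'
        · exact absurd rfl hne'
        · exact inner_eq_zero_symm.1 (hx e' (by assumption))
        · exact hx e (by assumption)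
        · exact hso.2 (i := ⟨e, he⟩) (j := ⟨e', he'⟩) (fun h => hne' (congrArg Subtype.val h))
      · intro e he
        rcases Finset.mem_insert.1 he with rfl | he
        · exact hxε.le
        · exact hsε e he
  obtain ⟨k, hk⟩ := exists_nat_gt (C / ε)
  obtain ⟨s, hs, hso, hsε⟩ := key k
  have h1 := htr s hso
  have h2 := Finset.card_nsmul_le_sum s _ ε hsε
  rw [hs, nsmul_eq_mul] at h2
  rw [div_lt_iff₀ hε] at hk
  linarith

theorem isCompactOperator_of_trace_le [CompleteSpace H] {B : H →L[ℂ] H} {C D : ℝ}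
    (htr : ∀ s : Finset H, Orthonormal ℂ (fun e : s => (e : H)) →
      ∑ e ∈ s, (inner ℂ (B e) e).re ≤ C)
    (hD : 0 < D) (hB : ∀ x, ‖B x‖ ^ 2 ≤ D * (inner ℂ (B x) x).re) : IsCompactOperator B := by
  refine (isClosed_setOfPred_isCompactOperator (σ₁₂ := RingHom.id ℂ) (M₁ := H)
    (M₂ := H)).closure_subset_iff.2 subset_rfl ?_
  rw [Metric.mem_closure_iff]
  intro δ hδ
  obtain ⟨s, hs⟩ := exists_orthonormal_maximal htr (ε := (δ / 2) ^ 2 / D) (by positivity)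
  let V : Submodule ℂ H := Submodule.span ℂ (s : Set H)
  have : FiniteDimensional ℂ V := FiniteDimensional.span_finset ℂ s
  have : ProperSpace V := FiniteDimensional.proper_rclike ℂ V
  refine ⟨(B ∘L V.subtypeL) ∘L V.orthogonalProjectionOnto, ?_, ?_⟩
  · exact (isCompactOperator_of_locallyCompactSpace_rng (B ∘L V.subtypeL)).comp_clm _
  · rw [dist_eq_norm]
    refine lt_of_le_of_lt (ContinuousLinearMap.opNorm_le_bound _ (half_pos hδ).le fun x => ?_)
      (half_lt_self hδ)
    set y := x - V.starProjection x with hy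
    have hyV : y ∈ Vᗮ := Submodule.sub_starProjection_mem_orthogonal x
    have hyx : ‖y‖ ≤ ‖x‖ := by
      have h0 : inner ℂ (V.starProjection x) y = 0 :=
        hyV _ (Submodule.starProjection_apply_mem _ _)
      have h1 := norm_add_sq_eq_norm_sq_add_norm_sq_of_inner_eq_zero _ _ h0
      have h2 : V.starProjection x + y = x := by rw [hy]; abel
      rw [h2] at h1
      refine abs_le_of_sq_le_sq' ?_ (norm_nonneg _) |>.2
      nlinarith [mul_self_nonneg ‖V.starProjection x‖]
    have hBy : (B - (B ∘L V.subtypeL) ∘L V.orthogonalProjectionOnto) x = B y := by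
      rw [hy, map_sub]; rfl
    rw [hBy]
    refine le_trans ?_ (mul_le_mul_of_nonneg_left hyx (half_pos hδ).le)
    by_cases hy0 : y = 0
    · simp [hy0]
    have hyn : 0 < ‖y‖ := norm_pos_iff.2 hy0
    have h3 := hs (((‖y‖⁻¹ : ℝ) : ℂ) • y) (fun e he => by
      rw [inner_smul_right, hyV e (Submodule.subset_span he), mul_zero])
      (by rw [norm_smul, Complex.norm_real, norm_inv, norm_norm, inv_mul_cancel₀ hyn.ne'])
    rw [map_smul, inner_smul_left, inner_smul_right, Complex.conj_ofReal, Complex.re_ofReal_mul,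
      Complex.re_ofReal_mul] at h3
    have h4 := hB y
    have h5 : D * (inner ℂ (B y) y).re ≤ (δ / 2 * ‖y‖) ^ 2 := by
      rw [mul_pow]
      have : ‖y‖⁻¹ * (‖y‖⁻¹ * (inner ℂ (B y) y).re) = (inner ℂ (B y) y).re / ‖y‖ ^ 2 := by
        field_simp
      rw [this, div_le_div_iff₀ (by positivity) hD] at h3
      linarith
    exact abs_le_of_sq_le_sq' (h4.trans h5) (by positivity) |>.2

variable {U : ℤ → H →ₗᵢ[ℂ] H} (hU : ∀ m n v, U (m + n) v = U m (U n v))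

/-- `v` is an eigenvector of the unitary representation `U` of `ℤ`. -/
def IsEig (U : ℤ → H →ₗᵢ[ℂ] H) (γ : Circle) (v : H) : Prop := ∀ n, U n v = intChar γ n • v

include hU

theorem unitary_zero (v : H) : U 0 v = v := by
  apply (U 0).injective
  rw [← hU, add_zero]

theorem inner_unitary_left (n : ℤ) (u v : H) : inner ℂ (U n u) v = (inner ℂ u (U (-n) v)) := by
  rw [← (U n).inner_map_map u, ← hU, add_neg_cancel, unitary_zero hU]

omit hU in
theorem norm_matrixCoeff_le (γ : Circle) (v u : H) (n : ℤ) :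
    ‖intChar γ n * (inner ℂ (U n v) u)‖ ≤ ‖v‖ * ‖u‖ := by
  rw [norm_mul, norm_intChar, one_mul]
  exact (norm_inner_le_norm _ _).trans (by rw [(U n).norm_map])

theorem exists_eig_riesz [CompleteSpace H] {A : ZMean} (hA : A.Invariant) (γ : Circle) (v : H) :
    ∃ z, IsEig U γ z ∧ ∀ u, inner ℂ z u = A.cx (fun n => intChar γ n * (inner ℂ (U n v) u)) := by
  let l : H →ₗ[ℂ] ℂ :=
    { toFun := fun u => A.cx (fun n => intChar γ n * (inner ℂ (U n v) u))
      map_add' := fun a b => by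
        rw [← map_add]; congr 1; ext n; simp [mul_add]
      map_smul' := fun r a => by
        rw [RingHom.id_apply, ← map_smul]; congr 1; ext n; simp; ring_nf }
  let l' : H →L[ℂ] ℂ := l.mkContinuous ‖v‖ fun u =>
    A.norm_cx_le_const (norm_matrixCoeff_le γ v u)
  refine ⟨(InnerProductSpace.toDual ℂ H).symm l', ?_⟩
  set z := (InnerProductSpace.toDual ℂ H).symm l'
  have hz : ∀ u, inner ℂ z u = A.cx (fun n => intChar γ n * (inner ℂ (U n v) u)) := fun u =>
    InnerProductSpace.toDual_symm_apply
  refine ⟨fun m => ext_inner_right ℂ fun u => ?_, hz⟩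
  rw [inner_unitary_left hU, hz, inner_smul_left, conj_intChar, hz, ← A.cx_smul,
    ← hA.cx (c := fun n => intChar γ (-m) * (intChar γ n * (inner ℂ (U n v) u))) (C := ‖v‖ * ‖u‖)
      (fun n => by
        rw [norm_mul, norm_intChar, one_mul]; exact norm_matrixCoeff_le γ v u n) m]
  congr 1; ext n
  rw [← inner_unitary_left hU, ← hU, add_comm m n, ← mul_assoc, ← intChar_add]
  ring_nf

theorem mean_matrixCoeff_eq_zero [CompleteSpace H] {A : ZMean} (hA : A.Invariant) (γ : Circle) {v : H}
    (h : ∀ z, IsEig U γ z → inner ℂ z v = 0) (u : H) :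
    A.cx (fun n => intChar γ n * (inner ℂ (U n v) u)) = 0 := by
  obtain ⟨z, hz, hzu⟩ := exists_eig_riesz hU hA γ v
  have h0 : z = 0 := by
    rw [← inner_self_eq_zero (𝕜 := ℂ), hzu]
    have : (fun n => intChar γ n * (inner ℂ (U n v) z)) = 0 := by
      ext n
      rw [inner_unitary_left hU, hz, inner_smul_right, inner_eq_zero_symm.1 (h z hz)]
      simp
    rw [this, map_zero]
  rw [← hzu, h0, inner_zero_left]

theorem mean_inner_eq_zero [CompleteSpace H] {A : ZMean} (hA : A.Invariant) {v : H}
    (h : A.cx (fun n => (inner ℂ (U n v) v)) = 0) (u : H) (hu : ∀ n, U n u = u) :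
    inner ℂ v u = 0 := by
  obtain ⟨z, hz, hzu⟩ := exists_eig_riesz hU hA 1 v
  simp only [map_one, Pi.one_apply, one_mul] at hzu
  have hz' : ∀ n, U n z = z := fun n => by simpa using hz n
  have h0 : z = 0 := by
    rw [← inner_self_eq_zero (𝕜 := ℂ), hzu]
    have : (fun n => (inner ℂ (U n v) z)) = fun _ => (inner ℂ v z) := by
      ext n
      rw [inner_unitary_left hU, hz']
    rw [this, A.cx_const, ← inner_conj_symm, hzu, h, map_zero]
  have h1 := hzu u
  have : (fun n => (inner ℂ (U n v) u)) = fun _ => (inner ℂ v u) := by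
    ext n
    rw [inner_unitary_left hU, hu]
  rwa [this, A.cx_const, h0, inner_zero_left, eq_comm] at h1

/-- Wiener's lemma: the autocorrelation of a vector orthogonal to all eigenvectors has zero
quadratic mean. -/
theorem mean_sq_autocorrelation [CompleteSpace H] {A : ZMean} (hA : A.Invariant) {g : H}
    (h : ∀ γ z, IsEig U γ z → inner ℂ z g = 0) :
    A (fun n => ‖inner ℂ (U n g) g‖ ^ 2) = 0 := by
  let b : H → H → ℂ := fun x y => A.cx (fun n => (inner ℂ x (U n g)) * (inner ℂ (U n g) y))
  have hbb : ∀ x y n, ‖(inner ℂ x (U n g)) * (inner ℂ (U n g) y)‖ ≤ ‖g‖ ^ 2 * ‖x‖ * ‖y‖ := fun x y n => by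
    rw [norm_mul]
    calc _ ≤ (‖x‖ * ‖U n g‖) * (‖U n g‖ * ‖y‖) :=
          mul_le_mul (norm_inner_le_norm _ _) (norm_inner_le_norm _ _) (norm_nonneg _)
            (by positivity)
      _ = _ := by rw [(U n).norm_map]; ring
  let l : H →ₗ⋆[ℂ] H →ₗ[ℂ] ℂ := LinearMap.mk₂'ₛₗ (starRingEnd ℂ) (RingHom.id ℂ) b
    (fun x y z => by
      simp only [b]; rw [← map_add]; congr 1; ext n; simp [add_mul])
    (fun r x z => by
      simp only [b]; rw [smul_eq_mul, ← A.cx_smul]; congr 1; ext n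
      simp; ring_nf)
    (fun x y z => by
      simp only [b]; rw [← map_add]; congr 1; ext n; simp [mul_add])
    (fun r x z => by
      simp only [b]; rw [smul_eq_mul, ← A.cx_smul]; congr 1; ext n
      simp; ring_nf)
  let B : H →L[ℂ] H := InnerProductSpace.continuousLinearMapOfBilin
    (l.mkContinuous₂ (‖g‖ ^ 2) fun x y => A.norm_cx_le_const (hbb x y))
  have hB : ∀ x y, inner ℂ (B x) y = b x y := fun x y =>
    InnerProductSpace.continuousLinearMapOfBilin_apply _ _ _
  have hbxx : ∀ x, b x x = (A (fun n => ‖inner ℂ x (U n g)‖ ^ 2) : ℂ) := fun x => by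
    simp only [b]
    rw [← A.cx_ofReal]; congr 1; ext n
    rw [← inner_conj_symm (U n g) x, Complex.mul_conj, Complex.normSq_eq_norm_sq]
  have hsqb : ∀ x n, ‖inner ℂ x (U n g)‖ ^ 2 ≤ ‖x‖ ^ 2 * ‖g‖ ^ 2 := fun x n => by
    rw [← mul_pow]
    refine pow_le_pow_left₀ (norm_nonneg _) ((norm_inner_le_norm _ _).trans ?_) 2
    rw [(U n).norm_map]
  have hsymm : ∀ x y, inner ℂ (B x) y = (inner ℂ x (B y)) := fun x y => by
    rw [hB, ← inner_conj_symm x (B y), hB]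
    simp only [b]
    rw [← A.cx_conj]; congr 1; ext n
    rw [map_mul, inner_conj_symm, inner_conj_symm, mul_comm]
  have hcomm : ∀ m x, B (U m x) = U m (B x) := fun m x => ext_inner_right ℂ fun y => by
    rw [inner_unitary_left hU, hB, hB]
    simp only [b]
    rw [← hA.cx (hbb x (U (-m) y)) (-m)]
    congr 1; ext n
    rw [inner_unitary_left hU, ← hU, ← inner_unitary_left hU m, ← hU, add_comm (-m) n,
      show m + (n + -m) = n by ring]
  have hCS : ∀ x, ‖B x‖ ^ 2 ≤ (‖g‖ ^ 2 + 1) * (inner ℂ (B x) x).re := fun x => by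
    set N := ‖g‖ ^ 2 + 1
    have hN : 0 < N := by positivity
    have h1 : (‖B x‖ ^ 2 : ℝ) = ‖b x (B x)‖ := by
      rw [← hB, inner_self_eq_norm_sq_to_K]; simp
    have h2 : ‖b x (B x)‖ ≤ A ((N / 2) • (fun n => ‖inner ℂ x (U n g)‖ ^ 2)
        + (fun _ => ‖B x‖ ^ 2 / 2)) := by
      refine A.norm_cx_le (N / 2 * (‖x‖ ^ 2 * ‖g‖ ^ 2) + ‖B x‖ ^ 2 / 2) (fun n => ?_) fun n => ?_
      · simp only [Pi.add_apply, Pi.smul_apply, smul_eq_mul]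
        rw [norm_mul]
        have h3 : ‖inner ℂ (U n g) (B x)‖ ≤ ‖g‖ * ‖B x‖ :=
          (norm_inner_le_norm _ _).trans (by rw [(U n).norm_map])
        have h4 : ‖inner ℂ (U n g) (B x)‖ ^ 2 ≤ N * ‖B x‖ ^ 2 := by
          calc _ ≤ (‖g‖ * ‖B x‖) ^ 2 := pow_le_pow_left₀ (norm_nonneg _) h3 2
            _ ≤ N * ‖B x‖ ^ 2 := by
              rw [mul_pow]; exact mul_le_mul_of_nonneg_right (by simp [N]) (by positivity)
        generalize ‖inner ℂ x (U n g)‖ = p at *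
        generalize ‖inner ℂ (U n g) (B x)‖ = q at *
        have h5 : N * (N / 2 * p ^ 2 + ‖B x‖ ^ 2 / 2 - p * q)
            = (N * p - q) ^ 2 / 2 + (N * ‖B x‖ ^ 2 - q ^ 2) / 2 := by ring
        have h6 : 0 ≤ N * (N / 2 * p ^ 2 + ‖B x‖ ^ 2 / 2 - p * q) := by
          rw [h5]; have := sq_nonneg (N * p - q); linarith
        have := nonneg_of_mul_nonneg_right h6 hN
        linarith
      · simp only [Pi.add_apply, Pi.smul_apply, smul_eq_mul]
        have := mul_le_mul_of_nonneg_left (hsqb x n) (half_pos hN).le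
        linarith
    rw [map_add, map_smul, A.const, smul_eq_mul] at h2
    rw [hB, hbxx, Complex.ofReal_re]
    linarith
  have htr : ∀ s : Finset H, Orthonormal ℂ (fun e : s => (e : H)) →
      ∑ e ∈ s, (inner ℂ (B e) e).re ≤ ‖g‖ ^ 2 := fun s hs => by
    have h1 : ∑ e ∈ s, (inner ℂ (B e) e).re = A (∑ e ∈ s, fun n => ‖inner ℂ e (U n g)‖ ^ 2) := by
      rw [map_sum]
      refine Finset.sum_congr rfl fun e _ => ?_
      rw [hB, hbxx, Complex.ofReal_re]
    rw [h1]
    refine (le_abs_self _).trans (A.abs_le fun n => ?_)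
    rw [Finset.sum_apply, abs_of_nonneg (Finset.sum_nonneg fun _ _ => by positivity),
      ← Finset.sum_coe_sort]
    refine (hs.sum_inner_products_le (U n g) (s := Finset.univ)).trans ?_
    rw [(U n).norm_map]
  have hcpt : IsCompactOperator B :=
    isCompactOperator_of_trace_le htr (by positivity) hCS
  have hfin : ∀ n, ‖inner ℂ (U n g) g‖ = ‖inner ℂ g (U n g)‖ := fun n => norm_inner_symm _ _
  simp_rw [hfin]
  by_contra hne
  have hB0 : B ≠ 0 := fun h0 => hne (by
    have := hB g g
    rw [hbxx, h0] at this
    simpa using this.symm)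
  have hsym : (B : H →ₗ[ℂ] H).IsSymmetric := hsymm
  rw [Ne, ← ContinuousLinearMap.eq_zero_of_forall_hasEigenvalue_eq_zero hcpt hsym] at hB0
  push Not at hB0
  obtain ⟨μ, hμ, hμ0⟩ := hB0
  set E := Module.End.eigenspace (B : H →ₗ[ℂ] H) μ
  have hE : FiniteDimensional ℂ E := ContinuousLinearMap.finite_dimensional_eigenspace hcpt μ hμ0
  have hEn : Nontrivial E := by
    rw [Submodule.nontrivial_iff_ne_bot]; exact hμ
  have hmem : ∀ x, x ∈ E ↔ B x = μ • x := fun x => Module.End.mem_eigenspace_iff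
  have hUE : ∀ x ∈ E, (U 1).toLinearMap x ∈ E := fun x hx => by
    rw [hmem] at hx ⊢
    change B (U 1 x) = μ • U 1 x
    rw [hcomm, hx, map_smul]
  obtain ⟨a, ha⟩ := Module.End.exists_eigenvalue ((U 1).toLinearMap.restrict hUE)
  obtain ⟨⟨v, hvE⟩, hv⟩ := ha.exists_hasEigenvector
  have hv0 : v ≠ 0 := fun h => hv.2 (Subtype.ext h)
  have hUv : U 1 v = a • v := congrArg Subtype.val hv.apply_eq_smul
  have ha1 : ‖a‖ = 1 := by
    have := congrArg norm hUv
    rw [(U 1).norm_map, norm_smul] at this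
    exact (mul_right_cancel₀ (norm_ne_zero_iff.2 hv0) (by rw [one_mul]; exact this)).symm
  let γ : Circle := ⟨a, by simp [Submonoid.unitSphere, ha1]⟩
  have hγ : intChar γ 1 = a := by simp [intChar, γ]
  have heig : IsEig U γ v := fun n => by
    induction n using Int.induction_on with
    | zero => rw [unitary_zero hU, intChar_zero, one_smul]
    | succ k ih => rw [add_comm, hU, ih, map_smul, hUv, smul_smul, intChar_add, hγ, mul_comm]
    | pred k ih =>
      apply (U 1).injective
      rw [← hU, show (1 : ℤ) + (-k - 1) = -k by ring, ih, map_smul, hUv, smul_smul, ← hγ,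
        ← intChar_add]
      ring_nf
  have hvg := h γ v heig
  have hbv : b v v = 0 := by
    simp only [b]
    have : (fun n => (inner ℂ v (U n g)) * (inner ℂ (U n g) v)) = 0 := by
      ext n
      rw [inner_unitary_left hU, heig, inner_smul_right, inner_eq_zero_symm.1 hvg]
      simp
    rw [this, map_zero]
  rw [← hB, (hmem v).1 hvE, inner_smul_left] at hbv
  rcases mul_eq_zero.1 hbv with h1 | h1
  · exact hμ0 ((map_eq_zero _).1 h1)
  · exact hv0 (inner_self_eq_zero.1 h1)

end Hilbert

section System

variable {Y : Type*} [mY : MeasurableSpace Y]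

/-- A measure preserving action of `ℤ × ℤ`. -/
structure IsZZSystem (ν : Measure Y) (σ : ℤ × ℤ → Y → Y) : Prop where
  zero : ∀ y, σ 0 y = y
  add : ∀ u v y, σ (u + v) y = σ u (σ v y)
  mp : ∀ u, MeasurePreserving (σ u) ν ν

/-- Ergodicity of an action of `ℤ × ℤ`. -/
def IsZZErgodic (ν : Measure Y) (σ : ℤ × ℤ → Y → Y) : Prop :=
  ∀ s, MeasurableSet s → (∀ u, σ u ⁻¹' s = s) → ν s = 0 ∨ ν s = 1

variable {ν : Measure Y} {σ : ℤ × ℤ → Y → Y}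

namespace IsZZSystem

theorem neg_left (h : IsZZSystem ν σ) (u : ℤ × ℤ) (y : Y) : σ (-u) (σ u y) = y := by
  rw [← h.add, neg_add_cancel, h.zero]

theorem neg_right (h : IsZZSystem ν σ) (u : ℤ × ℤ) (y : Y) : σ u (σ (-u) y) = y := by
  rw [← h.add, add_neg_cancel, h.zero]

theorem comm (h : IsZZSystem ν σ) (u v : ℤ × ℤ) (y : Y) : σ u (σ v y) = σ v (σ u y) := by
  rw [← h.add, add_comm, h.add]

theorem measurableEmbedding (h : IsZZSystem ν σ) (u : ℤ × ℤ) : MeasurableEmbedding (σ u) :=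
  MeasurableEquiv.measurableEmbedding
    { toFun := σ u
      invFun := σ (-u)
      left_inv := h.neg_left u
      right_inv := h.neg_right u
      measurable_toFun := (h.mp u).measurable
      measurable_invFun := (h.mp (-u)).measurable }

theorem integral_comp (h : IsZZSystem ν σ) {E : Type*} [NormedAddCommGroup E] [NormedSpace ℝ E]
    (u : ℤ × ℤ) (φ : Y → E) : ∫ y, φ (σ u y) ∂ν = ∫ y, φ y ∂ν :=
  (h.mp u).integral_comp (h.measurableEmbedding u) φ

theorem integrable_comp (h : IsZZSystem ν σ) {E : Type*} [NormedAddCommGroup E]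
    (u : ℤ × ℤ) {φ : Y → E} (hφ : Integrable φ ν) : Integrable (fun y => φ (σ u y)) ν :=
  (h.mp u).integrable_comp_of_integrable hφ

theorem ae_comp (h : IsZZSystem ν σ) (u : ℤ × ℤ) {p : Y → Prop} (hp : ∀ᵐ y ∂ν, p y) :
    ∀ᵐ y ∂ν, p (σ u y) :=
  (h.mp u).quasiMeasurePreserving.ae hp

theorem measure_eq_zero_or_one [IsProbabilityMeasure ν] (h : IsZZSystem ν σ) (hE : IsZZErgodic ν σ)
    {s : Set Y} (hs : MeasurableSet s) (hinv : ∀ u, σ u ⁻¹' s =ᵐ[ν] s) : ν s = 0 ∨ ν s = 1 := by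
  have h1 : (⋂ v, σ v ⁻¹' s : Set Y) =ᵐ[ν] s := by
    have : ∀ᵐ y ∂ν, ∀ v, (σ v y ∈ s) = (y ∈ s) := ae_all_iff.2 fun v => hinv v
    filter_upwards [this] with y hy
    have : (y ∈ ⋂ v, σ v ⁻¹' s) = (y ∈ s) := by
      simp only [Set.mem_iInter, Set.mem_preimage, hy, forall_const]
    exact this
  rw [← measure_congr h1]
  refine hE _ (MeasurableSet.iInter fun v => (h.mp v).measurable hs) fun u => ?_
  ext y
  simp only [Set.mem_preimage, Set.mem_iInter, ← h.add]
  exact ⟨fun H v => by simpa using H (v - u), fun H v => H _⟩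

theorem ae_eq_const [IsProbabilityMeasure ν] (h : IsZZSystem ν σ) (hE : IsZZErgodic ν σ)
    {φ : Y → ℝ} (hφ : Measurable φ) (hinv : ∀ u, ∀ᵐ y ∂ν, φ (σ u y) = φ y) :
    ∃ c, ∀ᵐ y ∂ν, φ y = c := by
  refine Filter.exists_eventuallyEq_const_of_forall_separating (l := ae ν) MeasurableSet
    fun U hU => ?_
  have := h.measure_eq_zero_or_one hE (hφ hU) fun u => by
    filter_upwards [hinv u] with y hy
    change (φ (σ u y) ∈ U) = (φ y ∈ U)
    rw [hy]
  rcases this with h0 | h1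
  · right
    exact measure_eq_zero_iff_ae_notMem.1 h0
  · left
    exact (prob_compl_eq_zero_iff (hφ hU)).2 h1

/-- Conditional expectation on an invariant `σ`-algebra is equivariant. -/
theorem condExp_comp [IsProbabilityMeasure ν] (h : IsZZSystem ν σ) {𝒢 : MeasurableSpace Y}
    (h𝒢 : 𝒢 ≤ mY) (hσ : ∀ u, Measurable[𝒢, 𝒢] (σ u)) (u : ℤ × ℤ) {φ : Y → ℝ}
    (hφ : Integrable φ ν) :
    (fun y => (ν[φ|𝒢]) (σ u y)) =ᵐ[ν] ν[fun y => φ (σ u y)|𝒢] := by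
  refine ae_eq_condExp_of_forall_setIntegral_eq h𝒢 (h.integrable_comp (mY := mY) u hφ)
    (fun s _ _ => (h.integrable_comp (mY := mY) u integrable_condExp).integrableOn) (fun s hs _ => ?_)
    (stronglyMeasurable_condExp.comp_measurable (hσ u)).aestronglyMeasurable
  have key : ∀ ψ : Y → ℝ, ∫ y in s, ψ (σ u y) ∂ν = ∫ y in σ (-u) ⁻¹' s, ψ y ∂ν := by
    intro ψ
    have := (IsZZSystem.mp (mY := mY) h u).setIntegral_preimage_emb (h.measurableEmbedding (mY := mY) u) ψ (σ (-u) ⁻¹' s)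
    rw [← this]
    congr 2
    ext y
    simp [h.neg_left (mY := mY)]
  rw [key, key, setIntegral_condExp h𝒢 hφ (hσ (-u) hs)]

end IsZZSystem

theorem integral_mul_condExp [IsProbabilityMeasure ν] {𝒢 : MeasurableSpace Y}
    (h𝒢 : 𝒢 ≤ mY) {φ ψ : Y → ℝ} (hφ : StronglyMeasurable[𝒢] φ)
    (hψ : Integrable ψ ν) (hφψ : Integrable (fun y => φ y * ψ y) ν) :
    ∫ y, φ y * (ν[ψ|𝒢]) y ∂ν = ∫ y, φ y * ψ y ∂ν := by
  rw [← integral_condExp h𝒢 (f := fun y => φ y * ψ y)]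
  exact integral_congr_ae (condExp_mul_of_stronglyMeasurable_left hφ hφψ hψ).symm

/-- Functions that are almost invariant under `σ (n • w)` on average with respect to `M`. -/
structure Rigid (M : ZMean) (ν : Measure Y) (σ : ℤ × ℤ → Y → Y) (w : ℤ × ℤ) (φ : Y → ℝ) : Prop where
  integrable : Integrable φ ν
  mean : M (fun n => ∫ y, |φ (σ (n • w) y) - φ y| ∂ν) = 0

variable {M : ZMean} {w : ℤ × ℤ} {φ ψ ψ₁ ψ₂ : Y → ℝ}

theorem IsZZSystem.integrable_sub (h : IsZZSystem ν σ) (hφ : Integrable φ ν) (u : ℤ × ℤ) :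
    Integrable (fun y => |φ (σ u y) - φ y|) ν :=
  ((h.integrable_comp u hφ).sub hφ).abs

theorem IsZZSystem.integral_sub_le (h : IsZZSystem ν σ) (hφ : Integrable φ ν) (u : ℤ × ℤ) :
    ∫ y, |φ (σ u y) - φ y| ∂ν ≤ 2 * ∫ y, |φ y| ∂ν := by
  calc ∫ y, |φ (σ u y) - φ y| ∂ν ≤ ∫ y, (|φ (σ u y)| + |φ y|) ∂ν :=
        integral_mono (h.integrable_sub hφ u) ((h.integrable_comp u hφ.abs).add hφ.abs)
          fun y => abs_sub _ _
    _ = _ := by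
        rw [integral_add (h.integrable_comp u hφ.abs) hφ.abs, h.integral_comp u fun y => |φ y|]
        ring

theorem IsZZSystem.integral_sub_nonneg (_ : IsZZSystem ν σ) (u : ℤ × ℤ) :
    0 ≤ ∫ y, |φ (σ u y) - φ y| ∂ν :=
  integral_nonneg fun _ => abs_nonneg _

theorem Rigid.of_mean_le (h : IsZZSystem ν σ) (hφ : Integrable φ ν) (c : ℤ → ℝ)
    (hc : M c ≤ 0) (B : ℝ) (hB : ∀ n, c n ≤ B)
    (hle : ∀ n, ∫ y, |φ (σ (n • w) y) - φ y| ∂ν ≤ c n) : Rigid M ν σ w φ := by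
  refine ⟨hφ, le_antisymm (le_trans (M.mono hle B fun n => ?_) hc) ?_⟩
  · have := h.integral_sub_nonneg (φ := φ) (n • w)
    have h2 := hB n
    linarith
  · exact M.nonneg _ (2 * ∫ y, |φ y| ∂ν) (fun n => integral_nonneg fun y => abs_nonneg _)
      (fun n => h.integral_sub_le hφ _)

theorem Rigid.of_dominated (h : IsZZSystem ν σ) (hφ : Integrable φ ν) (h₁ : Rigid M ν σ w ψ₁)
    (h₂ : Rigid M ν σ w ψ₂) (K : ℝ) (hK : 0 ≤ K)
    (hle : ∀ y y', |φ y - φ y'| ≤ K * (|ψ₁ y - ψ₁ y'| + |ψ₂ y - ψ₂ y'|)) : Rigid M ν σ w φ := by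
  refine Rigid.of_mean_le h hφ
    (K • ((fun n => ∫ y, |ψ₁ (σ (n • w) y) - ψ₁ y| ∂ν) +
      fun n => ∫ y, |ψ₂ (σ (n • w) y) - ψ₂ y| ∂ν)) ?_
    (K * (2 * ∫ y, |ψ₁ y| ∂ν + 2 * ∫ y, |ψ₂ y| ∂ν)) (fun n => ?_) fun n => ?_
  · have := M.toLin.map_smul K ((fun n => ∫ y, |ψ₁ (σ (n • w) y) - ψ₁ y| ∂ν) +
      fun n => ∫ y, |ψ₂ (σ (n • w) y) - ψ₂ y| ∂ν)
    rw [this, map_add]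
    have e1 := h₁.mean
    have e2 := h₂.mean
    rw [e1, e2]
    simp
  · exact mul_le_mul_of_nonneg_left
      (add_le_add (h.integral_sub_le h₁.integrable _) (h.integral_sub_le h₂.integrable _)) hK
  · simp only [Pi.smul_apply, Pi.add_apply, smul_eq_mul]
    rw [← integral_add (h.integrable_sub h₁.integrable _) (h.integrable_sub h₂.integrable _),
      ← integral_const_mul]
    exact integral_mono (h.integrable_sub hφ _)
      (((h.integrable_sub h₁.integrable _).add (h.integrable_sub h₂.integrable _)).const_mul K)
      fun y => hle _ _

theorem Rigid.of_approx (h : IsZZSystem ν σ) (hφ : Integrable φ ν)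
    (happ : ∀ ε > 0, ∃ ψ, Rigid M ν σ w ψ ∧ ∫ y, |φ y - ψ y| ∂ν ≤ ε) : Rigid M ν σ w φ := by
  refine ⟨hφ, le_antisymm (le_of_forall_pos_le_add fun ε hε => ?_) ?_⟩
  · obtain ⟨ψ, hψ, hle⟩ := happ (ε / 2) (half_pos hε)
    have hi : Integrable (fun y => |φ y - ψ y|) ν := (hφ.sub hψ.integrable).abs
    have hb : ∀ n : ℤ, ∫ y, |φ (σ (n • w) y) - φ y| ∂ν ≤
        ((fun _ => ε : ℤ → ℝ) + fun n => ∫ y, |ψ (σ (n • w) y) - ψ y| ∂ν : ℤ → ℝ) n := by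
      intro n
      have hi' := h.integrable_comp (n • w) hi
      calc ∫ y, |φ (σ (n • w) y) - φ y| ∂ν
          ≤ ∫ y, (|φ (σ (n • w) y) - ψ (σ (n • w) y)| + |φ y - ψ y| +
              |ψ (σ (n • w) y) - ψ y|) ∂ν := by
            refine integral_mono (h.integrable_sub hφ _)
              ((hi'.add hi).add (h.integrable_sub hψ.integrable _)) fun y => ?_
            have e : φ (σ (n • w) y) - φ y = (φ (σ (n • w) y) - ψ (σ (n • w) y)) -
              (φ y - ψ y) + (ψ (σ (n • w) y) - ψ y) := by ring
            simp only
            rw [e]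
            exact (abs_add_le _ _).trans (add_le_add (abs_sub _ _) le_rfl)
        _ = (∫ y, |φ y - ψ y| ∂ν) + (∫ y, |φ y - ψ y| ∂ν) +
            ∫ y, |ψ (σ (n • w) y) - ψ y| ∂ν := by
            erw [integral_add (hi'.add hi) (h.integrable_sub hψ.integrable _), integral_add hi' hi,
              h.integral_comp (n • w) fun y => |φ y - ψ y|]
        _ ≤ _ := by
            simp only [Pi.add_apply]
            linarith
    have h2 := M.mono hb (ε + 2 * ∫ y, |ψ y| ∂ν) fun n => by
      have h1 := h.integral_sub_le hψ.integrable (n • w)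
      have := h.integral_sub_nonneg (φ := φ) (n • w)
      simp only [Pi.add_apply]
      linarith
    rw [map_add] at h2
    have e1 := hψ.mean
    have e2 := M.const ε
    rw [e1, e2] at h2
    linarith
  · exact M.nonneg _ (2 * ∫ y, |φ y| ∂ν) (fun n => integral_nonneg fun y => abs_nonneg _)
      (fun n => h.integral_sub_le hφ _)

theorem Rigid.congr (h : IsZZSystem ν σ) (hφ : Rigid M ν σ w φ) (he : φ =ᵐ[ν] ψ) :
    Rigid M ν σ w ψ := by
  refine Rigid.of_approx h (hφ.integrable.congr he) fun ε hε => ⟨φ, hφ, ?_⟩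
  rw [integral_eq_zero_of_ae]
  · exact hε.le
  · filter_upwards [he] with y hy
    simp [hy]

theorem Rigid.const [IsProbabilityMeasure ν] (c : ℝ) : Rigid M ν σ w (fun _ => c) := by
  refine ⟨integrable_const _, ?_⟩
  simp only [sub_self, abs_zero, integral_zero]
  exact map_zero M.toLin

theorem Rigid.comp (h : IsZZSystem ν σ) (hφ : Rigid M ν σ w φ) (u : ℤ × ℤ) :
    Rigid M ν σ w (fun y => φ (σ u y)) := by
  refine ⟨h.integrable_comp u hφ.integrable, ?_⟩
  rw [← hφ.mean]
  congr 1
  ext n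
  simp only [h.comm u (n • w)]
  exact h.integral_comp u fun y => |φ (σ (n • w) y) - φ y|

theorem Rigid.lipschitz (h : IsZZSystem ν σ) (hφ : Integrable φ ν) (h₁ : Rigid M ν σ w ψ)
    (K : ℝ) (hK : 0 ≤ K) (hle : ∀ y y', |φ y - φ y'| ≤ K * |ψ y - ψ y'|) : Rigid M ν σ w φ :=
  Rigid.of_dominated h hφ h₁ h₁ K hK fun y y' => (hle y y').trans
    (mul_le_mul_of_nonneg_left (le_add_of_nonneg_right (abs_nonneg _)) hK)

theorem Rigid.add (h : IsZZSystem ν σ) (h₁ : Rigid M ν σ w ψ₁) (h₂ : Rigid M ν σ w ψ₂) :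
    Rigid M ν σ w (fun y => ψ₁ y + ψ₂ y) := by
  refine Rigid.of_dominated h (h₁.integrable.add h₂.integrable) h₁ h₂ 1 zero_le_one fun y y' => ?_
  rw [one_mul, add_sub_add_comm]
  exact abs_add_le _ _

theorem Rigid.const_mul (h : IsZZSystem ν σ) (h₁ : Rigid M ν σ w ψ) (c : ℝ) :
    Rigid M ν σ w (fun y => c * ψ y) :=
  Rigid.lipschitz h (h₁.integrable.const_mul c) h₁ |c| (abs_nonneg c) fun y y' => by
    rw [← mul_sub, abs_mul]

theorem Rigid.of_tendsto [IsFiniteMeasure ν] (h : IsZZSystem ν σ) {ψ : ℕ → Y → ℝ} {C : ℝ}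
    (hφ : Measurable φ)
    (hψ : ∀ j, Rigid M ν σ w (ψ j)) (hb : ∀ j y, |ψ j y| ≤ C)
    (hl : ∀ y, Tendsto (fun j => ψ j y) atTop (𝓝 (φ y))) : Rigid M ν σ w φ := by
  have hφb : ∀ y, |φ y| ≤ C := fun y =>
    le_of_tendsto ((hl y).abs) (Eventually.of_forall fun j => hb j y)
  have hφi : Integrable φ ν := Integrable.of_bound hφ.aestronglyMeasurable C
    (Eventually.of_forall hφb)
  refine Rigid.of_approx h hφi fun ε hε => ?_
  have : Tendsto (fun j => ∫ y, |φ y - ψ j y| ∂ν) atTop (𝓝 (∫ _, (0 : ℝ) ∂ν)) := by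
    refine tendsto_integral_of_dominated_convergence (fun _ => 2 * C)
      (fun j => (hφi.sub (hψ j).integrable).abs.aestronglyMeasurable) (integrable_const _)
      (fun j => Eventually.of_forall fun y => ?_) (Eventually.of_forall fun y => ?_)
    · rw [Real.norm_eq_abs, abs_abs]
      exact (abs_sub _ _).trans (by linarith [hb j y, hφb y])
    · have := ((tendsto_const_nhds (x := φ y)).sub (hl y)).abs
      simpa using this
  rw [integral_zero] at this
  obtain ⟨j, hj⟩ := (this.eventually_lt_const hε).exists
  exact ⟨ψ j, hψ j, hj.le⟩

/-- The `σ`-algebra of sets with rigid indicator. -/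
@[reducible] def rigidAlgebra [IsProbabilityMeasure ν] (M : ZMean) (h : IsZZSystem ν σ) (w : ℤ × ℤ) :
    MeasurableSpace Y where
  MeasurableSet' s := MeasurableSet s ∧ Rigid M ν σ w (s.indicator 1)
  measurableSet_empty := ⟨MeasurableSet.empty, by
    rw [Set.indicator_empty]; exact Rigid.const 0⟩
  measurableSet_compl s hs := ⟨hs.1.compl, by
    refine ((Rigid.const 1).add h (hs.2.const_mul h (-1))).congr h (Eventually.of_forall fun y => ?_)
    by_cases hy : y ∈ s <;> simp [hy]⟩
  measurableSet_iUnion f hf := by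
    have hfin : ∀ N, Rigid M ν σ w ((⋃ k < N, f k).indicator 1) := by
      intro N
      induction N with
      | zero => simpa using Rigid.const (M := M) (σ := σ) (w := w) (ν := ν) 0
      | succ N ih =>
        refine Rigid.of_dominated h ((integrable_const (1 : ℝ)).indicator
          (.iUnion fun k => .iUnion fun _ => (hf k).1)) ih (hf N).2 1 zero_le_one fun y y' => ?_
        have e : ∀ z, (⋃ k < N + 1, f k).indicator (1 : Y → ℝ) z =
            max ((⋃ k < N, f k).indicator 1 z) ((f N).indicator 1 z) := by
          intro z
          rw [Set.biUnion_lt_succ]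
          by_cases h1 : z ∈ ⋃ k < N, f k <;> by_cases h2 : z ∈ f N <;>
            simp only [Set.indicator, Set.mem_union, h1, h2] <;> simp
        rw [e, e, one_mul]
        exact (abs_max_sub_max_le_max _ _ _ _).trans
          (max_le_add_of_nonneg (abs_nonneg _) (abs_nonneg _))
    have hm : MeasurableSet (⋃ k, f k) := .iUnion fun k => (hf k).1
    refine ⟨hm, Rigid.of_tendsto h (C := 1) (measurable_one.indicator hm) hfin (fun j y => ?_)
      fun y => ?_⟩
    · by_cases hy : y ∈ ⋃ k < j, f k <;> simp only [Set.indicator, hy] <;> simp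
    · refine tendsto_const_nhds.congr' ?_
      by_cases hy : y ∈ ⋃ k, f k
      · obtain ⟨k, hk⟩ := Set.mem_iUnion.1 hy
        filter_upwards [eventually_gt_atTop k] with j hj
        rw [Set.indicator_of_mem hy, Set.indicator_of_mem]
        exact Set.mem_iUnion₂.2 ⟨k, hj, hk⟩
      · refine Eventually.of_forall fun j => ?_
        beta_reduce
        rw [Set.indicator_of_notMem hy, Set.indicator_of_notMem]
        exact fun h' => hy (Set.iUnion₂_subset_iUnion _ _ h')

variable [IsProbabilityMeasure ν]

theorem rigidAlgebra_le (h : IsZZSystem ν σ) : rigidAlgebra M h w ≤ mY :=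
  fun _ hs => hs.1

theorem rigidAlgebra_equivariant (h : IsZZSystem ν σ) (u : ℤ × ℤ) :
    Measurable[rigidAlgebra M h w, rigidAlgebra M h w] (σ u) :=
  fun _ hs => ⟨(h.mp u).measurable hs.1, hs.2.comp h u⟩

theorem Rigid.measurable (h : IsZZSystem ν σ) (hφ : Measurable φ) (hr : Rigid M ν σ w φ) :
    Measurable[rigidAlgebra M h w] φ := by
  refine measurable_of_Ioi fun t => ⟨hφ measurableSet_Ioi, ?_⟩
  refine Rigid.of_tendsto h (C := 1) (ψ := fun j y => min 1 (j * max (φ y - t) 0))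
    (measurable_one.indicator (hφ measurableSet_Ioi)) (fun j => ?_) (fun j y => ?_) fun y => ?_
  · have hm : Measurable fun y => min 1 ((j : ℝ) * max (φ y - t) 0) := by fun_prop
    have hb : ∀ y, 0 ≤ (j : ℝ) * max (φ y - t) 0 := fun y => by positivity
    refine Rigid.lipschitz h (Integrable.of_bound hm.aestronglyMeasurable 1
      (Eventually.of_forall fun y => ?_)) hr j (Nat.cast_nonneg j) fun y y' => ?_
    · rw [Real.norm_eq_abs, abs_of_nonneg (le_min zero_le_one (hb y))]
      exact min_le_left _ _
    · refine (abs_min_sub_min_le_max _ _ _ _).trans ?_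
      rw [sub_self, abs_zero, max_eq_right (abs_nonneg _), ← mul_sub, abs_mul, Nat.abs_cast]
      refine mul_le_mul_of_nonneg_left ?_ (Nat.cast_nonneg j)
      refine (abs_max_sub_max_le_max _ _ _ _).trans ?_
      simp
  · have hb : 0 ≤ (j : ℝ) * max (φ y - t) 0 := by positivity
    rw [abs_of_nonneg (le_min zero_le_one hb)]
    exact min_le_left _ _
  · by_cases hy : t < φ y
    · rw [Set.indicator_of_mem (show y ∈ φ ⁻¹' Set.Ioi t from hy)]
      refine tendsto_const_nhds.congr' ?_
      obtain ⟨k, hk⟩ := exists_nat_gt (1 / (φ y - t))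
      have hp : 0 < φ y - t := sub_pos.2 hy
      filter_upwards [eventually_ge_atTop k] with j hj
      rw [max_eq_left hp.le, min_eq_left, Pi.one_apply]
      have : (k : ℝ) ≤ j := Nat.cast_le.2 hj
      rw [div_lt_iff₀ hp] at hk
      nlinarith
    · rw [Set.indicator_of_notMem (show y ∉ φ ⁻¹' Set.Ioi t from hy)]
      have : max (φ y - t) 0 = 0 := max_eq_right (by linarith)
      simp [this]

theorem Rigid.of_measurable (h : IsZZSystem ν σ) (hi : Integrable φ ν)
    (hφ : StronglyMeasurable[rigidAlgebra M h w] φ) : Rigid M ν σ w φ := by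
  refine MemLp.induction_stronglyMeasurable (p := 1) (rigidAlgebra_le h) ENNReal.one_ne_top
    (fun φ => Rigid M ν σ w φ) (fun c s hs _ => ?_) (fun f g _ _ _ _ _ hf hg => hf.add h hg) ?_
    (fun f g hfg _ hf => hf.congr h hfg) (memLp_one_iff_integrable.2 hi) hφ.aestronglyMeasurable
  · refine (hs.2.const_mul h c).congr h (Eventually.of_forall fun y => ?_)
    by_cases hy : y ∈ s <;> simp [hy]
  · refine isClosed_iff_clusterPt.2 fun f hf => ?_
    rw [clusterPt_principal_iff] at hf
    refine Rigid.of_approx h (L1.integrable_coeFn _) fun ε hε => ?_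
    obtain ⟨g, hg, hgr⟩ := hf _ (Metric.ball_mem_nhds f hε)
    refine ⟨_, hgr, ?_⟩
    have := Metric.mem_ball'.1 hg
    rw [Subtype.dist_eq, dist_eq_norm, L1.norm_eq_integral_norm] at this
    refine le_trans (le_of_eq (integral_congr_ae ?_)) this.le
    filter_upwards [Lp.coeFn_sub (f : Lp ℝ 1 ν) (g : Lp ℝ 1 ν)] with y hy
    rw [hy]
    rfl

end System

section Koopman

/-- The pair of properties of a mean `M` expressing that it is concentrated at the identity of the
Bohr compactification, relative to the mean `A`. -/
structure IsBohr (A M : ZMean) : Prop where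
  char : ∀ γ, M (fun n => ‖intChar γ n - 1‖) = 0
  null : ∀ (c : ℤ → ℝ) (C : ℝ), (∀ n, |c n| ≤ C) →
    (∀ γ, A.cx (intChar γ * fun n => (c n : ℂ)) = 0) → M c = 0

/-- Evaluation at an integer. -/
def ZMean.eval (m : ℤ) : ZMean where
  toLin := LinearMap.proj m
  one := rfl
  nonneg _ _ h _ := h m

variable {Y : Type*} [mY : MeasurableSpace Y] {ν : Measure Y} {σ : ℤ × ℤ → Y → Y}

/-- The isometries of `L²` induced by the action in direction `w`. -/
noncomputable def koopman (h : IsZZSystem ν σ) (w : ℤ × ℤ) (n : ℤ) :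
    Lp ℂ 2 ν →ₗᵢ[ℂ] Lp ℂ 2 ν :=
  Lp.compMeasurePreservingₗᵢ ℂ (σ (n • w)) (h.mp _)

theorem coeFn_koopman (h : IsZZSystem ν σ) (w : ℤ × ℤ) (n : ℤ) (v : Lp ℂ 2 ν) :
    ∀ᵐ y ∂ν, koopman h w n v y = v (σ (n • w) y) :=
  Lp.coeFn_compMeasurePreserving v (h.mp _)

theorem koopman_add (h : IsZZSystem ν σ) (w : ℤ × ℤ) (m n : ℤ) (v : Lp ℂ 2 ν) :
    koopman h w (m + n) v = koopman h w m (koopman h w n v) := by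
  refine Lp.ext ?_
  filter_upwards [coeFn_koopman h w (m + n) v, coeFn_koopman h w m (koopman h w n v),
    h.ae_comp (m • w) (coeFn_koopman h w n v)] with y h1 h2 h3
  rw [h1, h2, h3, ← h.add, ← add_smul, add_comm n m]

theorem IsEig.ae_eq {h : IsZZSystem ν σ} {w : ℤ × ℤ} {γ : Circle} {z : Lp ℂ 2 ν}
    (hz : IsEig (koopman h w) γ z) (n : ℤ) :
    ∀ᵐ y ∂ν, z (σ (n • w) y) = intChar γ n * z y := by
  have h1 := hz n
  filter_upwards [coeFn_koopman h w n z, Lp.coeFn_smul (intChar γ n) z] with y h2 h3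
  rw [← h2, h1, h3]
  rfl

variable [IsProbabilityMeasure ν]

omit [IsProbabilityMeasure ν] in
theorem IsZZSystem.ae_invariant_of_gen (h : IsZZSystem ν σ) {φ : Y → ℝ}
    (h₁ : ∀ᵐ y ∂ν, φ (σ (1, 0) y) = φ y) (h₃ : ∀ᵐ y ∂ν, φ (σ (-1, 1) y) = φ y) (u : ℤ × ℤ) :
    ∀ᵐ y ∂ν, φ (σ u y) = φ y := by
  let G : AddSubgroup (ℤ × ℤ) :=
    { carrier := {u | ∀ᵐ y ∂ν, φ (σ u y) = φ y}
      zero_mem' := show ∀ᵐ y ∂ν, φ (σ 0 y) = φ y from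
        Eventually.of_forall fun y => by rw [h.zero]
      add_mem' := fun {u v} hu hv => by
        change ∀ᵐ y ∂ν, φ (σ (u + v) y) = φ y
        filter_upwards [h.ae_comp v hu, hv] with y h1 h2
        rw [h.add, h1, h2]
      neg_mem' := fun {u} hu => by
        change ∀ᵐ y ∂ν, φ (σ (-u) y) = φ y
        filter_upwards [h.ae_comp (-u) hu] with y h1
        rw [← h1, h.neg_right] }
  have h1 : ((1, 0) : ℤ × ℤ) ∈ G := h₁
  have h3 : ((-1, 1) : ℤ × ℤ) ∈ G := h₃
  have : u = (u.1 + u.2) • ((1, 0) : ℤ × ℤ) + u.2 • ((-1, 1) : ℤ × ℤ) := by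
    ext <;> simp
  have hu : u ∈ G := by
    rw [this]
    exact G.add_mem (G.zsmul_mem h1 _) (G.zsmul_mem h3 _)
  exact hu

theorem IsZZSystem.integral_mul_of_invariant (h : IsZZSystem ν σ) (hE : IsZZErgodic ν σ)
    {a b : Y → ℝ} (ha : MemLp a ⊤ ν) (hb : Integrable b ν) (hbm : Measurable b)
    (ha₁ : ∀ᵐ y ∂ν, a (σ (1, 0) y) = a y) (hb₃ : ∀ᵐ y ∂ν, b (σ (-1, 1) y) = b y) :
    ∫ y, b y * a y ∂ν = (∫ y, b y ∂ν) * ∫ y, a y ∂ν := by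
  have hai : Integrable a ν := ha.integrable le_top
  have hbr : Rigid (ZMean.eval 1) ν σ (-1, 1) b := by
    refine ⟨hb, ?_⟩
    change ∫ y, |b (σ ((1 : ℤ) • (-1, 1)) y) - b y| ∂ν = 0
    rw [one_smul]
    refine integral_eq_zero_of_ae ?_
    filter_upwards [hb₃] with y hy
    simp [hy]
  have hJ := rigidAlgebra_le (M := ZMean.eval 1) (w := (-1, 1)) h
  rw [← integral_mul_condExp hJ (hbr.measurable h hbm).stronglyMeasurable hai
    (hb.mul_of_top_left ha)]
  set e := ν[a|rigidAlgebra (ZMean.eval 1) h (-1, 1)] with he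
  have her : Rigid (ZMean.eval 1) ν σ (-1, 1) e :=
    Rigid.of_measurable h integrable_condExp stronglyMeasurable_condExp
  have he3 : ∀ᵐ y ∂ν, e (σ (-1, 1) y) = e y := by
    have h1 : ∫ y, |e (σ ((1 : ℤ) • (-1, 1)) y) - e y| ∂ν = 0 := her.mean
    rw [one_smul, integral_eq_zero_iff_of_nonneg (fun _ => abs_nonneg _)
      (h.integrable_sub integrable_condExp _)] at h1
    filter_upwards [h1] with y hy
    exact sub_eq_zero.1 (abs_eq_zero.1 hy)
  have he1 : ∀ᵐ y ∂ν, e (σ (1, 0) y) = e y := by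
    filter_upwards [h.condExp_comp hJ (rigidAlgebra_equivariant h) (1, 0) hai,
      condExp_congr_ae (m := rigidAlgebra (ZMean.eval 1) h (-1, 1)) ha₁] with y h1 h2
    rw [he, h1, h2]
  obtain ⟨c, hc⟩ := h.ae_eq_const hE (stronglyMeasurable_condExp.mono hJ).measurable
    (h.ae_invariant_of_gen he1 he3)
  have h1 : ∫ y, a y ∂ν = c := by
    rw [← integral_condExp hJ, integral_congr_ae hc]
    simp
  rw [h1, ← integral_mul_const]
  refine integral_congr_ae ?_
  filter_upwards [hc] with y hy
  rw [he, hy]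

theorem IsZZSystem.integral_mul_of_invariant_complex (h : IsZZSystem ν σ) (hE : IsZZErgodic ν σ)
    {a : Y → ℝ} {b : Y → ℂ} (ha : MemLp a ⊤ ν) (hb : Integrable b ν) (hbm : Measurable b)
    (ha₁ : ∀ᵐ y ∂ν, a (σ (1, 0) y) = a y) (hb₃ : ∀ᵐ y ∂ν, b (σ (-1, 1) y) = b y) :
    ∫ y, b y * a y ∂ν = (∫ y, b y ∂ν) * ((∫ y, a y ∂ν : ℝ) : ℂ) := by
  have hba : Integrable (fun y => b y * a y) ν := hb.mul_of_top_left ha.ofReal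
  have hr := h.integral_mul_of_invariant hE ha hb.re (Complex.measurable_re.comp hbm) ha₁
    (by filter_upwards [hb₃] with y hy; rw [hy])
  have hi := h.integral_mul_of_invariant hE ha hb.im (Complex.measurable_im.comp hbm) ha₁
    (by filter_upwards [hb₃] with y hy; rw [hy])
  have e1 := integral_re hb
  have e2 := integral_im hb
  have e3 := integral_re hba
  have e4 := integral_im hba
  simp only [RCLike.re_to_complex, RCLike.im_to_complex, Complex.mul_re, Complex.mul_im,
    Complex.ofReal_re, Complex.ofReal_im, mul_zero, sub_zero, zero_add] at *
  apply Complex.ext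
  · rw [← e3, hr, e1]; simp
  · rw [← e4]; simp [hi, e2]

/-- A bounded real function as an element of complex `L²`. -/
noncomputable def toC {φ : Y → ℝ} (hφ : MemLp φ ⊤ ν) : Lp ℂ 2 ν :=
  ((hφ.mono_exponent le_top).ofReal (K := ℂ)).toLp _

variable {φ ψ : Y → ℝ}

theorem coeFn_toC (hφ : MemLp φ ⊤ ν) : ∀ᵐ y ∂ν, toC hφ y = (φ y : ℂ) :=
  MemLp.coeFn_toLp _

theorem inner_toC (z : Lp ℂ 2 ν) (hφ : MemLp φ ⊤ ν) :
    inner ℂ z (toC hφ) = ∫ y, (φ y : ℂ) * conj (z y) ∂ν := by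
  rw [L2.inner_def]
  refine integral_congr_ae ?_
  filter_upwards [coeFn_toC hφ] with y hy
  rw [hy]
  rfl

theorem inner_koopman_toC (h : IsZZSystem ν σ) (w : ℤ × ℤ) (n : ℤ) (hφ : MemLp φ ⊤ ν)
    (hψ : MemLp ψ ⊤ ν) :
    inner ℂ (koopman h w n (toC hφ)) (toC hψ) = ((∫ y, ψ y * φ (σ (n • w) y) ∂ν : ℝ) : ℂ) := by
  rw [inner_toC, ← integral_complex_ofReal]
  refine integral_congr_ae ?_
  filter_upwards [coeFn_koopman h w n (toC hφ), h.ae_comp (n • w) (coeFn_toC hφ)] with y h1 h2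
  rw [h1, h2]
  simp

variable {A M : ZMean} {w : ℤ × ℤ}

theorem IsEig.rigid {h : IsZZSystem ν σ} {γ : Circle} {z : Lp ℂ 2 ν} (hAM : IsBohr A M)
    (hz : IsEig (koopman h w) γ z) {l : ℂ → ℝ} (hl : ∀ u v, l u - l v = l (u - v))
    (hl' : ∀ u, |l u| ≤ ‖u‖) (hli : Integrable (fun y => l (z y)) ν) :
    Rigid M ν σ w fun y => l (z y) := by
  have hzi : Integrable z ν := (Lp.memLp z).integrable one_le_two
  refine Rigid.of_mean_le h hli ((∫ y, ‖z y‖ ∂ν) • fun n => ‖intChar γ n - 1‖) ?_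
    ((∫ y, ‖z y‖ ∂ν) * 2) (fun n => ?_) fun n => ?_
  · have := M.toLin.map_smul (∫ y, ‖z y‖ ∂ν) fun n => ‖intChar γ n - 1‖
    have e := hAM.char γ
    rw [this, e, smul_zero]
  · refine mul_le_mul_of_nonneg_left ?_ (integral_nonneg fun _ => norm_nonneg _)
    refine (norm_sub_le _ _).trans ?_
    rw [norm_intChar, norm_one]
    norm_num
  · rw [Pi.smul_apply, smul_eq_mul, ← integral_mul_const]
    refine integral_mono_ae (h.integrable_sub hli _) (hzi.norm.mul_const _) ?_
    filter_upwards [hz.ae_eq n] with y hy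
    rw [hl, hy]
    refine (hl' _).trans (le_of_eq ?_)
    rw [← sub_one_mul, norm_mul, mul_comm]

theorem IsEig.inner_sub_condExp {h : IsZZSystem ν σ} {γ : Circle} {z : Lp ℂ 2 ν}
    (hAM : IsBohr A M) (hz : IsEig (koopman h w) γ z) (hφ : MemLp φ ⊤ ν)
    (hφ' : MemLp (φ - ν[φ|rigidAlgebra M h w]) ⊤ ν) : inner ℂ z (toC hφ') = 0 := by
  have hzi : Integrable z ν := (Lp.memLp z).integrable one_le_two
  have hzm : Measurable z := (Lp.stronglyMeasurable z).measurable
  have hK := rigidAlgebra_le (M := M) (w := w) h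
  have key : ∀ ρ : Y → ℝ, Measurable ρ → Rigid M ν σ w ρ →
      ∫ y, ρ y * (φ - ν[φ|rigidAlgebra M h w]) y ∂ν = 0 := by
    intro ρ hρm hρ
    simp only [Pi.sub_apply, mul_sub]
    have i1 : Integrable (fun y => ρ y * φ y) ν := hρ.integrable.mul_of_top_left hφ
    have i2 : Integrable (fun y => ρ y * (ν[φ|rigidAlgebra M h w]) y) ν :=
      hρ.integrable.mul_of_top_left (hφ.condExp le_top)
    rw [integral_sub i1 i2, integral_mul_condExp hK (hρ.measurable h hρm).stronglyMeasurable
      (hφ.integrable le_top) i1, sub_self]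
  have h1 := key _ (Complex.measurable_re.comp hzm)
    (hz.rigid hAM (l := Complex.re) (fun _ _ => rfl) Complex.abs_re_le_norm hzi.re)
  have h2 := key _ (Complex.measurable_im.comp hzm)
    (hz.rigid hAM (l := Complex.im) (fun _ _ => rfl) Complex.abs_im_le_norm hzi.im)
  have hi : Integrable (fun y => (((φ - ν[φ|rigidAlgebra M h w]) y : ℝ) : ℂ) * conj (z y)) ν := by
    have : Integrable (fun y => conj (z y)) ν := hzi.norm.mono'
      (Complex.continuous_conj.comp_aestronglyMeasurable hzi.aestronglyMeasurable)
      (Eventually.of_forall fun y => by simp)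
    exact this.mul_of_top_right hφ'.ofReal
  have e3 := integral_re hi
  have e4 := integral_im hi
  simp only [RCLike.re_to_complex, RCLike.im_to_complex, Complex.mul_re, Complex.mul_im,
    Complex.ofReal_re, Complex.ofReal_im, zero_mul, sub_zero, add_zero, neg_zero, Complex.conj_re,
    Complex.conj_im, mul_neg, integral_neg, Function.comp_apply] at *
  rw [inner_toC]
  apply Complex.ext
  · rw [← e3, Complex.zero_re]
    refine Eq.trans (integral_congr_ae (Eventually.of_forall fun y => mul_comm _ _)) h1
  · rw [← e4, Complex.zero_im, neg_eq_zero]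
    refine Eq.trans (integral_congr_ae (Eventually.of_forall fun y => mul_comm _ _)) h2

end Koopman

section Factor

variable {Y : Type*} [mY : MeasurableSpace Y] {ν : Measure Y} {σ : ℤ × ℤ → Y → Y}
  [IsProbabilityMeasure ν] {A M : ZMean} {φ ψ k : Y → ℝ} {w : ℤ × ℤ}

omit [IsProbabilityMeasure ν] in
theorem exists_ae_abs_le_of_memLp_top (hφ : MemLp φ ⊤ ν) : ∃ C, 0 ≤ C ∧ ∀ᵐ y ∂ν, |φ y| ≤ C := by
  refine ⟨(eLpNorm φ ⊤ ν).toReal, ENNReal.toReal_nonneg, ?_⟩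
  have h1 := hφ.2
  rw [eLpNorm_exponent_top] at h1 ⊢
  filter_upwards [ae_le_eLpNormEssSup (f := φ) (μ := ν)] with y hy
  rw [← Real.norm_eq_abs, ← toReal_enorm]
  exact ENNReal.toReal_mono h1.ne hy

theorem integrable_mul_comp (h : IsZZSystem ν σ) (hφ : MemLp φ ⊤ ν) (hψ : MemLp ψ ⊤ ν)
    (u : ℤ × ℤ) : Integrable (fun y => ψ y * φ (σ u y)) ν :=
  (hψ.integrable le_top).mul_of_top_left (hφ.comp_measurePreserving (h.mp u))

theorem exists_abs_integral_mul_comp_le (h : IsZZSystem ν σ) (hφ : MemLp φ ⊤ ν)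
    (hψ : MemLp ψ ⊤ ν) : ∃ C, ∀ n : ℤ, |∫ y, ψ y * φ (σ (n • w) y) ∂ν| ≤ C := by
  refine ⟨‖toC hφ‖ * ‖toC hψ‖, fun n => ?_⟩
  have := norm_matrixCoeff_le (U := koopman h w) 1 (toC hφ) (toC hψ) n
  rwa [inner_koopman_toC, norm_mul, norm_intChar, one_mul, Complex.norm_real] at this

theorem mean_integral_of_orthogonal (h : IsZZSystem ν σ) (hA : A.Invariant) (hAM : IsBohr A M)
    (hφ : MemLp φ ⊤ ν) (hψ : MemLp ψ ⊤ ν)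
    (ho : ∀ γ z, IsEig (koopman h w) γ z → inner ℂ z (toC hψ) = 0) :
    M (fun n => ∫ y, φ y * ψ (σ (n • w) y) ∂ν) = 0 := by
  obtain ⟨C, hC⟩ := exists_abs_integral_mul_comp_le (w := w) h hψ hφ
  refine hAM.null _ C hC fun γ => ?_
  rw [← mean_matrixCoeff_eq_zero (koopman_add h w) hA γ (ho γ) (toC hφ)]
  congr 1
  ext n
  rw [Pi.mul_apply, inner_koopman_toC]

theorem mean_integral_of_rigid (h : IsZZSystem ν σ) (hφ : MemLp φ ⊤ ν) (hψ : MemLp ψ ⊤ ν)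
    (hr : Rigid M ν σ w ψ) :
    M (fun n => ∫ y, φ y * ψ (σ (n • w) y) ∂ν) = ∫ y, φ y * ψ y ∂ν := by
  obtain ⟨C, hC0, hC⟩ := exists_ae_abs_le_of_memLp_top hφ
  have i1 : Integrable (fun y => φ y * ψ y) ν := (hφ.integrable le_top).mul_of_top_left hψ
  have key : ∀ n : ℤ, |(∫ y, φ y * ψ (σ (n • w) y) ∂ν) - ∫ y, φ y * ψ y ∂ν| ≤
      C * ∫ y, |ψ (σ (n • w) y) - ψ y| ∂ν := by
    intro n
    rw [← integral_sub (integrable_mul_comp h hψ hφ _) i1, ← integral_const_mul]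
    refine (abs_integral_le_integral_abs).trans
      (integral_mono_ae ((integrable_mul_comp h hψ hφ _).sub i1).abs
        ((h.integrable_sub (hψ.integrable le_top) _).const_mul C) ?_)
    filter_upwards [hC] with y hy
    rw [← mul_sub, abs_mul]
    exact mul_le_mul_of_nonneg_right hy (abs_nonneg _)
  have hb : ∀ n : ℤ, C * ∫ y, |ψ (σ (n • w) y) - ψ y| ∂ν ≤ C * (2 * ∫ y, |ψ y| ∂ν) := fun n =>
    mul_le_mul_of_nonneg_left (h.integral_sub_le (hψ.integrable le_top) _) hC0
  have hm : M (C • fun n : ℤ => ∫ y, |ψ (σ (n • w) y) - ψ y| ∂ν) = 0 := by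
    have := M.toLin.map_smul C fun n : ℤ => ∫ y, |ψ (σ (n • w) y) - ψ y| ∂ν
    have e := hr.mean
    rw [this, e, smul_zero]
  set c : ℤ → ℝ := fun n => ∫ y, φ y * ψ (σ (n • w) y) ∂ν
  set a := ∫ y, φ y * ψ y ∂ν
  have h0 : M (c - fun _ => a) = 0 := by
    refine le_antisymm ?_ ?_
    · rw [← hm]
      refine M.mono (fun n => (le_abs_self _).trans (key n)) (2 * (C * (2 * ∫ y, |ψ y| ∂ν)))
        fun n => ?_
      have h1 := hb n
      have h2 := (neg_abs_le (c n - a))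
      have h3 := key n
      simp only [Pi.smul_apply, Pi.sub_apply, smul_eq_mul]
      linarith
    · have h4 : M (-(C • fun n : ℤ => ∫ y, |ψ (σ (n • w) y) - ψ y| ∂ν)) = 0 := by
        rw [map_neg, hm, neg_zero]
      rw [← h4]
      refine M.mono (fun n => ?_) (2 * (C * (2 * ∫ y, |ψ y| ∂ν))) fun n => ?_
      · have h2 := (neg_abs_le (c n - a))
        have h3 := key n
        simp only [Pi.smul_apply, Pi.sub_apply, smul_eq_mul, Pi.neg_apply]
        linarith
      · have h1 := hb n
        have h2 := (le_abs_self (c n - a))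
        have h3 := key n
        simp only [Pi.smul_apply, Pi.sub_apply, smul_eq_mul, Pi.neg_apply]
        linarith
  rw [map_sub] at h0
  have e := M.const a
  linarith

theorem mean_integral_eq (h : IsZZSystem ν σ) (hA : A.Invariant) (hAM : IsBohr A M)
    (hφ : MemLp φ ⊤ ν) (hψ : MemLp ψ ⊤ ν) :
    M (fun n => ∫ y, φ y * ψ (σ (n • w) y) ∂ν) =
      ∫ y, (ν[φ|rigidAlgebra M h w]) y * (ν[ψ|rigidAlgebra M h w]) y ∂ν := by
  set e := ν[ψ|rigidAlgebra M h w] with he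
  have hem : MemLp e ⊤ ν := hψ.condExp le_top
  have h1 : (fun n : ℤ => ∫ y, φ y * ψ (σ (n • w) y) ∂ν) =
      (fun n : ℤ => ∫ y, φ y * (ψ - e) (σ (n • w) y) ∂ν) +
      fun n : ℤ => ∫ y, φ y * e (σ (n • w) y) ∂ν := by
    ext n
    rw [Pi.add_apply, ← integral_add (integrable_mul_comp h (hψ.sub hem) hφ _)
      (integrable_mul_comp h hem hφ _)]
    congr 1
    ext y
    rw [Pi.sub_apply]
    ring
  rw [h1, map_add]
  have h2 := mean_integral_of_orthogonal (w := w) h hA hAM hφ (hψ.sub hem)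
    fun γ z hz => hz.inner_sub_condExp hAM hψ (hψ.sub hem)
  have h3 := mean_integral_of_rigid h hφ hem
    (Rigid.of_measurable h integrable_condExp stronglyMeasurable_condExp)
  have h4 := integral_mul_condExp (rigidAlgebra_le (M := M) (w := w) h) (φ := e)
    stronglyMeasurable_condExp (hφ.integrable le_top)
    ((hem.integrable le_top).mul_of_top_left hφ)
  rw [h2, h3, zero_add]
  simp only [mul_comm _ (e _)]
  exact h4.symm

theorem integral_mul_eq_zero_of_orthogonal (h : IsZZSystem ν σ) (hE : IsZZErgodic ν σ)
    (hA : A.Invariant) (hAM : IsBohr A M) {g q : Y → ℝ} (hg : MemLp g ⊤ ν) (hq : MemLp q ⊤ ν)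
    (hk : MemLp k ⊤ ν)
    (hg₁ : ∀ n : ℤ, ∀ᵐ y ∂ν, g (σ (n, 0) y) = g y)
    (hq₂ : ∀ n : ℤ, ∀ᵐ y ∂ν, q (σ (0, n) y) = q y)
    (ho : ∀ γ z, IsEig (koopman h (-1, 1)) γ z → inner ℂ z (toC hg) = 0)
    (hkr : Rigid M ν σ (-1, 1) k) : ∫ y, g y * q y * k y ∂ν = 0 := by
  have hgq : MemLp (fun y => g y * q y) ⊤ ν := hq.mul' hg
  rw [← mean_integral_of_rigid h hgq hk hkr]
  obtain ⟨C, hC⟩ := exists_abs_integral_mul_comp_le (w := (-1, 1)) h hk hgq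
  refine hAM.null _ C hC fun γ => ?_
  obtain ⟨z, hz, hzu⟩ := exists_eig_riesz (koopman_add h (-1, 1)) hA γ (toC hk)
  have e1 : (intChar γ * fun n : ℤ => ((∫ y, g y * q y * k (σ (n • (-1, 1)) y) ∂ν : ℝ) : ℂ)) =
      fun n => intChar γ n * inner ℂ (koopman h (-1, 1) n (toC hk)) (toC hgq) := by
    ext n
    rw [Pi.mul_apply, inner_koopman_toC]
  rw [e1, ← hzu]
  have hzm : Measurable z := (Lp.stronglyMeasurable z).measurable
  have hzg : MemLp (fun y => z y * (g y : ℂ)) 2 ν := hg.ofReal.mul' (Lp.memLp z)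
  let v : Lp ℂ 2 ν := hzg.toLp _
  have hv : ∀ᵐ y ∂ν, v y = z y * (g y : ℂ) := MemLp.coeFn_toLp _
  have e2 : inner ℂ z (toC hgq) = inner ℂ v (toC hq) := by
    rw [inner_toC, inner_toC]
    refine integral_congr_ae ?_
    filter_upwards [hv] with y hy
    rw [hy]
    simp
    ring
  rw [e2]
  refine mean_inner_eq_zero (koopman_add h (0, 1)) hA ?_ _ fun n => ?_
  · have hform : ∀ n, inner ℂ (koopman h (0, 1) n v) v =
        inner ℂ (koopman h (0, 1) n z) z *
          inner ℂ (koopman h (-1, 1) n (toC hg)) (toC hg) := by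
      intro n
      have hn : n • ((0, 1) : ℤ × ℤ) = (0, n) := by ext <;> simp
      have hb : Integrable (fun y => z y * conj (z (σ (0, n) y))) ν := by
        have h1 : MemLp (fun y => conj (z (σ (0, n) y))) 2 ν :=
          MemLp.star ((Lp.memLp z).comp_measurePreserving (h.mp (0, n)))
        exact (Lp.memLp z).integrable_mul h1
      have ha : MemLp (fun y => g y * g (σ (0, n) y)) ⊤ ν :=
        (hg.comp_measurePreserving (h.mp (0, n))).mul' hg
      have key := h.integral_mul_of_invariant_complex hE ha hb
        (hzm.mul (Complex.continuous_conj.measurable.comp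
          (hzm.comp (h.mp (0, n)).measurable))) ?_ ?_
      · rw [inner_koopman_toC, L2.inner_def, L2.inner_def]
        convert key using 1
        · refine integral_congr_ae ?_
          filter_upwards [hv, coeFn_koopman h (0, 1) n v, h.ae_comp (0, n) hv] with y h1 h2 h3
          rw [hn] at h2
          rw [h2, h3, h1, RCLike.inner_apply]
          simp
          ring
        · congr 1
          · refine integral_congr_ae ?_
            filter_upwards [coeFn_koopman h (0, 1) n z] with y h2
            rw [hn] at h2
            rw [h2, RCLike.inner_apply]
          · congr 1
            refine integral_congr_ae ?_
            filter_upwards [h.ae_comp (0, n) (hg₁ (-n))] with y h2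
            have : n • ((-1, 1) : ℤ × ℤ) = (-n, 0) + (0, n) := by ext <;> simp
            rw [this, h.add, h2]
      · filter_upwards [hg₁ 1, h.ae_comp (0, n) (hg₁ 1)] with y h1 h2
        rw [h.comm (0, n) (1, 0), h2, h1]
      · have h3 := hz.ae_eq 1
        simp only [one_smul] at h3
        filter_upwards [h3, h.ae_comp (0, n) h3] with y h1 h2
        rw [h.comm (0, n) (-1, 1), h1, h2, map_mul]
        have := conj_intChar γ 1
        have h4 : intChar γ 1 * conj (intChar γ 1) = 1 := by
          rw [this, ← intChar_add]
          exact intChar_zero γ ▸ rfl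
        linear_combination (z y * conj (z (σ (0, n) y))) * h4
    have hz0 : A (fun n => ‖inner ℂ (koopman h (-1, 1) n (toC hg)) (toC hg)‖) = 0 := by
      refine A.eq_zero_of_sq (C := ‖toC hg‖ * ‖toC hg‖) (fun n => norm_nonneg _) (fun n => ?_) ?_
      · have := norm_matrixCoeff_le (U := koopman h (-1, 1)) 1 (toC hg) (toC hg) n
        rwa [norm_mul, norm_intChar, one_mul] at this
      · exact (mean_sq_autocorrelation (koopman_add h (-1, 1)) hA ho).le
    rw [← norm_le_zero_iff]
    refine (A.norm_cx_le (d := (‖z‖ * ‖z‖) •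
      fun n => ‖inner ℂ (koopman h (-1, 1) n (toC hg)) (toC hg)‖)
      (‖z‖ * ‖z‖ * (‖toC hg‖ * ‖toC hg‖)) (fun n => ?_) fun n => ?_).trans ?_
    · rw [hform, norm_mul, Pi.smul_apply, smul_eq_mul]
      refine mul_le_mul_of_nonneg_right ?_ (norm_nonneg _)
      exact (norm_inner_le_norm _ _).trans (by rw [LinearIsometry.norm_map])
    · rw [Pi.smul_apply, smul_eq_mul]
      refine mul_le_mul_of_nonneg_left ?_ (by positivity)
      exact (norm_inner_le_norm _ _).trans (by rw [LinearIsometry.norm_map])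
    · have := A.toLin.map_smul (‖z‖ * ‖z‖)
        fun n => ‖inner ℂ (koopman h (-1, 1) n (toC hg)) (toC hg)‖
      rw [this, hz0, smul_zero]
  · refine Lp.ext ?_
    have hn : n • ((0, 1) : ℤ × ℤ) = (0, n) := by ext <;> simp
    filter_upwards [coeFn_koopman h (0, 1) n (toC hq), h.ae_comp (0, n) (coeFn_toC hq),
      coeFn_toC hq, hq₂ n] with y h1 h2 h3 h4
    rw [hn] at h1
    rw [h1, h2, h3, h4]

theorem integral_mul_mul_eq (h : IsZZSystem ν σ) (hE : IsZZErgodic ν σ)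
    (hA : A.Invariant) (hAM : IsBohr A M) {p q : Y → ℝ} (hp : MemLp p ⊤ ν) (hq : MemLp q ⊤ ν)
    (hk : MemLp k ⊤ ν)
    (hp₁ : ∀ n y, p (σ (n, 0) y) = p y) (hq₂ : ∀ n y, q (σ (0, n) y) = q y)
    (hkm : StronglyMeasurable[rigidAlgebra M h (-1, 1)] k) :
    ∫ y, p y * q y * k y ∂ν = ∫ y, (ν[p|rigidAlgebra M h (-1, 1)]) y *
      (ν[q|rigidAlgebra M h (-1, 1)]) y * k y ∂ν := by
  have hK := rigidAlgebra_le (M := M) (w := (-1, 1)) h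
  set e := ν[p|rigidAlgebra M h (-1, 1)] with he
  have hem : MemLp e ⊤ ν := hp.condExp le_top
  have hg := hp.sub hem
  have h0 := integral_mul_eq_zero_of_orthogonal h hE hA hAM hg hq hk
    (fun n => ?_)
    (fun n => Eventually.of_forall (hq₂ n))
    (fun γ z hz => hz.inner_sub_condExp hAM hp hg)
    (Rigid.of_measurable h (hk.integrable le_top) hkm)
  · have hpq : MemLp (fun y => p y * q y) ⊤ ν := hq.mul' hp
    have heq : MemLp (fun y => e y * q y) ⊤ ν := hq.mul' hem
    have i1 : Integrable (fun y => p y * q y * k y) ν := (hpq.integrable le_top).mul_of_top_left hk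
    have i2 : Integrable (fun y => e y * q y * k y) ν := (heq.integrable le_top).mul_of_top_left hk
    have h1 : ∫ y, p y * q y * k y ∂ν = ∫ y, e y * q y * k y ∂ν := by
      rw [← sub_eq_zero, ← integral_sub i1 i2, ← h0]
      congr 1
      ext y
      rw [Pi.sub_apply]
      ring
    have hek : MemLp (fun y => e y * k y) ⊤ ν := hk.mul' hem
    have h2 := integral_mul_condExp hK (φ := fun y => e y * k y)
      (stronglyMeasurable_condExp.mul hkm) (hq.integrable le_top)
      ((hek.integrable le_top).mul_of_top_left hq)
    rw [h1]
    simp only [mul_right_comm _ _ (k _)]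
    exact h2.symm
  · have hpn : (fun y => p (σ (n, 0) y)) = p := funext (hp₁ n)
    have := h.condExp_comp hK (rigidAlgebra_equivariant h) (n, 0) (hp.integrable le_top)
    rw [hpn] at this
    filter_upwards [this] with y hy
    rw [Pi.sub_apply, Pi.sub_apply, hp₁, he, hy]

end Factor

section Inequality

theorem four_le_add_of_pos {α x y z : ℝ} (hα : 0 < α) (hx : 0 < x) (hy : 0 < y) (hz : 0 < z) :
    4 ≤ x * y * z / α ^ 3 + α / x + α / y + α / z := by
  have h0 := Real.log_le_sub_one_of_pos (show 0 < x * y * z / α ^ 3 by positivity)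
  have h1 := Real.log_le_sub_one_of_pos (show 0 < α / x by positivity)
  have h2 := Real.log_le_sub_one_of_pos (show 0 < α / y by positivity)
  have h3 := Real.log_le_sub_one_of_pos (show 0 < α / z by positivity)
  rw [Real.log_div (by positivity) (by positivity), Real.log_mul (by positivity) (by positivity),
    Real.log_mul (by positivity) (by positivity), Real.log_pow] at h0
  rw [Real.log_div (by positivity) (by positivity)] at h1 h2 h3
  push_cast at h0
  linarith

variable {Y : Type*} [mY : MeasurableSpace Y] {ν : Measure Y} [IsProbabilityMeasure ν]

theorem integrable_of_Icc {f : Y → ℝ} (hf : Measurable f) {C : ℝ} (h0 : ∀ y, 0 ≤ f y)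
    (h1 : ∀ y, f y ≤ C) : Integrable f ν :=
  Integrable.of_bound hf.aestronglyMeasurable C (Eventually.of_forall fun y => by
    rw [Real.norm_eq_abs, abs_of_nonneg (h0 y)]; exact h1 y)

omit [IsProbabilityMeasure ν] in
theorem memLp_top_of_Icc {f : Y → ℝ} (hf : Measurable f) {C : ℝ} (h0 : ∀ y, 0 ≤ f y)
    (h1 : ∀ y, f y ≤ C) : MemLp f ⊤ ν :=
  memLp_top_of_bound hf.aestronglyMeasurable C (Eventually.of_forall fun y => by
    rw [Real.norm_eq_abs, abs_of_nonneg (h0 y)]; exact h1 y)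

theorem pow_four_integral_le {f p₀ p₁ p₂ : Y → ℝ} (hfm : Measurable f) (hm₀ : Measurable p₀)
    (hm₁ : Measurable p₁) (hm₂ : Measurable p₂) (hf : ∀ y, f y ∈ Set.Icc 0 1)
    (h₀ : ∀ y, p₀ y ∈ Set.Icc 0 1) (h₁ : ∀ y, p₁ y ∈ Set.Icc 0 1)
    (h₂ : ∀ y, p₂ y ∈ Set.Icc 0 1)
    (hi₀ : ∀ τ > 0, ∫ y, f y / (p₀ y + τ) ∂ν ≤ 1) (hi₁ : ∀ τ > 0, ∫ y, f y / (p₁ y + τ) ∂ν ≤ 1)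
    (hi₂ : ∀ τ > 0, ∫ y, f y / (p₂ y + τ) ∂ν ≤ 1) :
    (∫ y, f y ∂ν) ^ 4 ≤ ∫ y, p₀ y * p₁ y * p₂ y ∂ν := by
  set α := ∫ y, f y ∂ν with hα
  have hα0 : 0 ≤ α := integral_nonneg fun y => (hf y).1
  have hp0 : ∀ y, 0 ≤ p₀ y * p₁ y * p₂ y := fun y =>
    mul_nonneg (mul_nonneg (h₀ y).1 (h₁ y).1) (h₂ y).1
  have hp1 : ∀ y, p₀ y * p₁ y * p₂ y ≤ 1 := fun y =>
    mul_le_one₀ (mul_le_one₀ (h₀ y).2 (h₁ y).1 (h₁ y).2) (h₂ y).1 (h₂ y).2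
  rcases hα0.eq_or_lt with h | hαp
  · rw [← h, zero_pow four_ne_zero]
    exact integral_nonneg hp0
  have hfi : Integrable f ν := integrable_of_Icc hfm (fun y => (hf y).1) fun y => (hf y).2
  have hpi : Integrable (fun y => p₀ y * p₁ y * p₂ y) ν :=
    integrable_of_Icc (by fun_prop) hp0 hp1
  have hdi : ∀ p : Y → ℝ, Measurable p → (∀ y, p y ∈ Set.Icc (0 : ℝ) 1) → ∀ τ > 0,
      Integrable (fun y => f y / (p y + τ)) ν := fun p hp h τ hτ =>
    integrable_of_Icc (C := 1 / τ) (hfm.div (hp.add_const τ))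
      (fun y => div_nonneg (hf y).1 (add_nonneg (h y).1 hτ.le))
      fun y => div_le_div₀ zero_le_one (hf y).2 hτ (by linarith [(h y).1])
  have key : ∀ τ > 0, τ ≤ 1 → α ^ 4 ≤ (∫ y, p₀ y * p₁ y * p₂ y ∂ν) + 7 * τ := by
    intro τ hτ hτ1
    have j₀ := hdi p₀ hm₀ h₀ τ hτ
    have j₁ := hdi p₁ hm₁ h₁ τ hτ
    have j₂ := hdi p₂ hm₂ h₂ τ hτ
    have hpt : ∀ y, 4 * f y ≤ (p₀ y * p₁ y * p₂ y + 7 * τ) * (1 / α ^ 3) +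
        α * (f y / (p₀ y + τ)) + α * (f y / (p₁ y + τ)) + α * (f y / (p₂ y + τ)) := by
      intro y
      have hx : 0 < p₀ y + τ := add_pos_of_nonneg_of_pos (h₀ y).1 hτ
      have hy : 0 < p₁ y + τ := add_pos_of_nonneg_of_pos (h₁ y).1 hτ
      have hz : 0 < p₂ y + τ := add_pos_of_nonneg_of_pos (h₂ y).1 hτ
      have h4 := mul_le_mul_of_nonneg_left (four_le_add_of_pos hαp hx hy hz) (hf y).1
      have h5 : f y * ((p₀ y + τ) * (p₁ y + τ) * (p₂ y + τ)) ≤ p₀ y * p₁ y * p₂ y + 7 * τ := by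
        have h6 : (p₀ y + τ) * (p₁ y + τ) * (p₂ y + τ) ≤ p₀ y * p₁ y * p₂ y + 7 * τ := by
          obtain ⟨a0, a1⟩ := h₀ y
          obtain ⟨b0, b1⟩ := h₁ y
          obtain ⟨c0, c1⟩ := h₂ y
          have e1 : p₀ y * p₁ y ≤ 1 := mul_le_one₀ a1 b0 b1
          have e2 : p₀ y * p₂ y ≤ 1 := mul_le_one₀ a1 c0 c1
          have e3 : p₁ y * p₂ y ≤ 1 := mul_le_one₀ b1 c0 c1
          have t2 : τ * τ ≤ τ := by nlinarith
          have t3 : τ * τ * τ ≤ τ := by nlinarith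
          nlinarith [mul_le_mul_of_nonneg_left e1 hτ.le, mul_le_mul_of_nonneg_left e2 hτ.le,
            mul_le_mul_of_nonneg_left e3 hτ.le,
            mul_le_mul_of_nonneg_left a1 (mul_pos hτ hτ).le,
            mul_le_mul_of_nonneg_left b1 (mul_pos hτ hτ).le,
            mul_le_mul_of_nonneg_left c1 (mul_pos hτ hτ).le]
        refine le_trans ?_ h6
        exact mul_le_of_le_one_left (mul_pos (mul_pos hx hy) hz).le (hf y).2
      have h7 := mul_le_mul_of_nonneg_right h5 (show 0 ≤ 1 / α ^ 3 by positivity)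
      calc 4 * f y = f y * 4 := mul_comm _ _
        _ ≤ _ := h4
        _ = f y * ((p₀ y + τ) * (p₁ y + τ) * (p₂ y + τ)) * (1 / α ^ 3) +
          α * (f y / (p₀ y + τ)) + α * (f y / (p₁ y + τ)) + α * (f y / (p₂ y + τ)) := by ring
        _ ≤ _ := by linarith
    have k0 : Integrable (fun y => (p₀ y * p₁ y * p₂ y + 7 * τ) * (1 / α ^ 3)) ν :=
      (hpi.add (integrable_const _)).mul_const _
    have h8 := integral_mono (hfi.const_mul 4)
      (((k0.add (j₀.const_mul α)).add (j₁.const_mul α)).add (j₂.const_mul α)) hpt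
    erw [integral_add ((k0.add (j₀.const_mul α)).add (j₁.const_mul α)) (j₂.const_mul α),
      integral_add (k0.add (j₀.const_mul α)) (j₁.const_mul α),
      integral_add k0 (j₀.const_mul α), integral_mul_const,
      integral_add hpi (integrable_const _)] at h8
    simp only [integral_const_mul, integral_const, probReal_univ, one_smul] at h8
    have b0 := mul_le_mul_of_nonneg_left (hi₀ τ hτ) hα0
    have b1 := mul_le_mul_of_nonneg_left (hi₁ τ hτ) hα0
    have b2 := mul_le_mul_of_nonneg_left (hi₂ τ hτ) hα0
    rw [← hα] at h8
    have h9 : α ≤ ((∫ y, p₀ y * p₁ y * p₂ y ∂ν) + 7 * τ) * (1 / α ^ 3) := by linarith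
    rw [mul_one_div, le_div_iff₀ (by positivity)] at h9
    calc α ^ 4 = α * α ^ 3 := by ring
      _ ≤ _ := h9
  refine le_of_forall_pos_le_add fun δ hδ => ?_
  have hτ : 0 < min (δ / 7) 1 := by positivity
  have := key _ hτ (min_le_right _ _)
  have := min_le_left (δ / 7) 1
  linarith

variable {ι : Type*} [Fintype ι] [DecidableEq ι]

/-- The indicator of a fibre. -/
def fib (P : Y → ι) (i : ι) (y : Y) : ℝ := if P y = i then 1 else 0

omit mY in
theorem sum_fib_mul (P : Y → ι) (G : ι → ℝ) (y : Y) : ∑ i, G i * fib P i y = G (P y) := by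
  simp [fib]

omit mY [Fintype ι] in
theorem fib_mem (P : Y → ι) (i : ι) (y : Y) : fib P i y ∈ Set.Icc (0 : ℝ) 1 := by
  unfold fib; split_ifs <;> simp

omit [Fintype ι] in
theorem measurable_fib {P : Y → ι} (hP : ∀ i, MeasurableSet (P ⁻¹' {i})) (i : ι) :
    Measurable (fib P i) :=
  Measurable.ite (hP i) measurable_const measurable_const

variable {f : Y → ℝ} {P Q : Y → ι} {𝒢 : MeasurableSpace Y}

/-- The conditional density of `f` on the fibre over `i`, relative to `𝒢`. -/
noncomputable def relDensity (ν : Measure Y) (𝒢 : MeasurableSpace Y) (f : Y → ℝ) (P : Y → ι)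
    (i : ι) (y : Y) : ℝ :=
  max 0 (min 1 ((ν[fun y => f y * fib P i y|𝒢]) y / (ν[fib P i|𝒢]) y))

omit [IsProbabilityMeasure ν] [Fintype ι] in
theorem relDensity_mem (i : ι) (y : Y) : relDensity ν 𝒢 f P i y ∈ Set.Icc (0 : ℝ) 1 :=
  ⟨le_max_left _ _, max_le zero_le_one (min_le_left _ _)⟩

omit [IsProbabilityMeasure ν] [Fintype ι] in
theorem measurable_relDensity (i : ι) : Measurable[𝒢] (relDensity ν 𝒢 f P i) := by
  have h1 : Measurable[𝒢] (ν[fun y => f y * fib P i y|𝒢]) := stronglyMeasurable_condExp.measurable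
  have h2 : Measurable[𝒢] (ν[fib P i|𝒢]) := stronglyMeasurable_condExp.measurable
  exact measurable_const.max (measurable_const.min (h1.div h2))

omit [Fintype ι] in
theorem condExp_mul_fib (hfm : Measurable[mY] f) (hf : ∀ y, f y ∈ Set.Icc 0 1)
    (hP : ∀ i, MeasurableSet[mY] (P ⁻¹' {i})) (i : ι) :
    ∀ᵐ y ∂ν, (ν[fun y => f y * fib P i y|𝒢]) y = relDensity ν 𝒢 f P i y * (ν[fib P i|𝒢]) y := by
  have i1 : Integrable (fib P i) ν := integrable_of_Icc (mY := mY) (measurable_fib (mY := mY) hP i)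
    (fun y => (fib_mem P i y).1) fun y => (fib_mem P i y).2
  have i2 : Integrable (fun y => f y * fib P i y) ν :=
    integrable_of_Icc (mY := mY) (C := 1) (hfm.mul (measurable_fib (mY := mY) hP i))
      (fun y => mul_nonneg (hf y).1 (fib_mem P i y).1)
      fun y => mul_le_one₀ (hf y).2 (fib_mem P i y).1 (fib_mem P i y).2
  have h0 : 0 ≤ᵐ[ν] ν[fun y => f y * fib P i y|𝒢] :=
    condExp_nonneg (Eventually.of_forall fun y => mul_nonneg (hf y).1 (fib_mem P i y).1)
  have h1 : ν[fun y => f y * fib P i y|𝒢] ≤ᵐ[ν] ν[fib P i|𝒢] :=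
    condExp_mono i2 i1 (Eventually.of_forall fun y =>
      mul_le_of_le_one_left (fib_mem P i y).1 (hf y).2)
  filter_upwards [h0, h1] with y ha hab
  rw [Pi.zero_apply] at ha
  unfold relDensity
  rcases (ha.trans hab).eq_or_lt with h | h
  · rw [← h] at hab ⊢
    rw [mul_zero]
    exact le_antisymm hab ha
  · rw [min_eq_right ((div_le_one h).2 hab), max_eq_right (div_nonneg ha h.le),
      div_mul_cancel₀ _ h.ne']

theorem integral_div_relDensity_le (h𝒢 : 𝒢 ≤ mY) (hfm : Measurable[mY] f)
    (hf : ∀ y, f y ∈ Set.Icc 0 1)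
    (hP : ∀ i, MeasurableSet[mY] (P ⁻¹' {i})) {τ : ℝ} (hτ : 0 < τ) :
    ∫ y, f y / (relDensity ν 𝒢 f P (P y) y + τ) ∂ν ≤ 1 := by
  have i1 : ∀ i, Integrable (fib P i) ν := fun i =>
    integrable_of_Icc (mY := mY) (measurable_fib (mY := mY) hP i)
    (fun y => (fib_mem P i y).1) fun y => (fib_mem P i y).2
  have i2 : ∀ i, Integrable (fun y => f y * fib P i y) ν := fun i =>
    integrable_of_Icc (mY := mY) (C := 1) (hfm.mul (measurable_fib (mY := mY) hP i))
      (fun y => mul_nonneg (hf y).1 (fib_mem P i y).1)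
      fun y => mul_le_one₀ (hf y).2 (fib_mem P i y).1 (fib_mem P i y).2
  have hr : ∀ i, Measurable[𝒢] fun y => 1 / (relDensity ν 𝒢 f P i y + τ) := fun i =>
    measurable_const.div ((measurable_relDensity (mY := mY) i).add_const τ)
  have hb : ∀ i y, |1 / (relDensity ν 𝒢 f P i y + τ)| ≤ 1 / τ := fun i y => by
    have := (relDensity_mem (mY := mY) (ν := ν) (𝒢 := 𝒢) (f := f) (P := P) i y).1
    rw [abs_of_nonneg (by positivity)]
    exact one_div_le_one_div_of_le hτ (by linarith)
  have i3 : ∀ i (g : Y → ℝ), Integrable g ν →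
      Integrable (fun y => 1 / (relDensity ν 𝒢 f P i y + τ) * g y) ν := fun i g hg =>
    hg.bdd_mul (c := 1 / τ) ((hr i).mono h𝒢 le_rfl).aestronglyMeasurable
      (Eventually.of_forall (hb i))
  have e1 : ∀ y, f y / (relDensity ν 𝒢 f P (P y) y + τ) =
      ∑ i, 1 / (relDensity ν 𝒢 f P i y + τ) * (f y * fib P i y) := by
    intro y
    have := sum_fib_mul P (fun i => 1 / (relDensity ν 𝒢 f P i y + τ) * f y) y
    rw [div_eq_mul_one_div, mul_comm, ← this]
    simp only [mul_assoc]
  simp only [e1]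
  rw [integral_finsetSum _ fun i _ => i3 i _ (i2 i)]
  have e2 : ∀ i, ∫ y, 1 / (relDensity ν 𝒢 f P i y + τ) * (f y * fib P i y) ∂ν ≤
      ∫ y, fib P i y ∂ν := by
    intro i
    rw [← integral_mul_condExp (mY := mY) h𝒢 (hr i).stronglyMeasurable (i2 i) (i3 i _ (i2 i)),
      ← integral_condExp h𝒢 (f := fib P i)]
    refine integral_mono_ae (i3 i _ integrable_condExp) integrable_condExp ?_
    have h0 : 0 ≤ᵐ[ν] ν[fib P i|𝒢] :=
      condExp_nonneg (Eventually.of_forall fun y => (fib_mem P i y).1)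
    filter_upwards [condExp_mul_fib (mY := mY) (𝒢 := 𝒢) hfm hf hP i, h0] with y h1 h2
    have h3 := (relDensity_mem (mY := mY) (ν := ν) (𝒢 := 𝒢) (f := f) (P := P) i y).1
    rw [h1, ← mul_assoc, one_div_mul_eq_div]
    exact mul_le_of_le_one_left h2 ((div_le_one (by linarith)).2 (by linarith))
  refine (Finset.sum_le_sum fun i _ => e2 i).trans ?_
  rw [← integral_finsetSum _ fun i _ => i1 i]
  have e3 : ∀ y, ∑ i, fib P i y = 1 := fun y => by simp [fib]
  simp [e3]

end Inequality

section Lower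

variable {Y : Type*} [mY : MeasurableSpace Y] {ν : Measure Y} {σ : ℤ × ℤ → Y → Y}
  {A M : ZMean} {ι : Type*} [Fintype ι] [DecidableEq ι] {f : Y → ℝ} {P Q : Y → ι}

omit mY in
theorem sum_fib_mul_fib (P Q : Y → ι) (G : ι → ι → ℝ) (y : Y) :
    ∑ x : ι × ι, G x.1 x.2 * (fib P x.1 y * fib Q x.2 y) = G (P y) (Q y) := by
  rw [Fintype.sum_prod_type]
  simp [fib]

theorem measurable_relDensity_fib {𝒢 : MeasurableSpace Y} (h𝒢 : 𝒢 ≤ mY)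
    (hP : ∀ i, MeasurableSet[mY] (P ⁻¹' {i})) :
    Measurable[mY] fun y => relDensity ν 𝒢 f P (P y) y := by
  have e : (fun y => relDensity ν 𝒢 f P (P y) y) =
      fun y => ∑ i, relDensity ν 𝒢 f P i y * fib P i y := by
    ext y
    rw [sum_fib_mul P (fun i => relDensity ν 𝒢 f P i y)]
  rw [e]
  refine Finset.measurable_sum _ fun i _ => ?_
  exact ((measurable_relDensity (mY := mY) i).mono h𝒢 le_rfl).mul (measurable_fib (mY := mY) hP i)

theorem measurable_fib_comp (hP : ∀ i, MeasurableSet (P ⁻¹' {i}))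
    (hQ : ∀ i, MeasurableSet (Q ⁻¹' {i})) (F : ι → ι → ℝ) :
    Measurable fun y => F (P y) (Q y) := by
  simp only [← sum_fib_mul_fib P Q F]
  exact Finset.measurable_sum _ fun x _ =>
    ((measurable_fib hP x.1).mul (measurable_fib hQ x.2)).const_mul _

variable [IsProbabilityMeasure ν]

theorem integral_fib_shift (h : IsZZSystem ν σ) (hfm : Measurable f)
    (hf : ∀ y, f y ∈ Set.Icc (0 : ℝ) 1)
    (hP : ∀ i, MeasurableSet (P ⁻¹' {i})) (hQ : ∀ i, MeasurableSet (Q ⁻¹' {i}))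
    (hP₁ : ∀ n y, P (σ (n, 0) y) = P y) (hQ₂ : ∀ n y, Q (σ (0, n) y) = Q y)
    (F : ι → ι → ℝ) (n : ℤ) :
    ∫ y, F (P y) (Q y) * f (σ (n, 0) y) * f (σ (0, n) y) ∂ν =
      ∑ x : ι × ι, F x.1 x.2 * ∫ y, (fun y => f y * fib P x.1 y) y *
        (fun y => f y * fib Q x.2 y) (σ (n • (-1, 1)) y) ∂ν := by
  have hm : ∀ u, Measurable (σ u) := fun u => (h.mp u).measurable
  have e1 : ∀ i j, ∫ y, (fun y => f y * fib P i y) y *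
        (fun y => f y * fib Q j y) (σ (n • (-1, 1)) y) ∂ν =
      ∫ y, (f (σ (n, 0) y) * f (σ (0, n) y)) * (fib P i y * fib Q j y) ∂ν := by
    intro i j
    rw [← h.integral_comp (n, 0)]
    congr 1
    ext y
    have hn : n • ((-1, 1) : ℤ × ℤ) + (n, 0) = (0, n) := by ext <;> simp
    rw [← h.add, hn]
    simp only [fib, hP₁, hQ₂]
    ring
  have i1 : ∀ i j, Integrable (fun y => F i j *
      ((f (σ (n, 0) y) * f (σ (0, n) y)) * (fib P i y * fib Q j y))) ν := by
    intro i j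
    refine Integrable.const_mul (integrable_of_Icc (C := 1) ?_ (fun y => ?_) fun y => ?_) _
    · exact ((hfm.comp (hm _)).mul (hfm.comp (hm _))).mul
        ((measurable_fib hP i).mul (measurable_fib hQ j))
    · exact mul_nonneg (mul_nonneg (hf _).1 (hf _).1)
        (mul_nonneg (fib_mem _ _ _).1 (fib_mem _ _ _).1)
    · exact mul_le_one₀ (mul_le_one₀ (hf _).2 (hf _).1 (hf _).2)
        (mul_nonneg (fib_mem _ _ _).1 (fib_mem _ _ _).1)
        (mul_le_one₀ (fib_mem _ _ _).2 (fib_mem _ _ _).1 (fib_mem _ _ _).2)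
  simp only [e1, ← integral_const_mul]
  rw [← integral_finsetSum _ fun x _ => i1 x.1 x.2]
  congr 1
  ext y
  rw [mul_assoc, ← sum_fib_mul_fib P Q F, Finset.sum_mul]
  refine Finset.sum_congr rfl fun x _ => ?_
  ring

omit [Fintype ι] in
theorem mean_integral_fib (h : IsZZSystem ν σ) (hE : IsZZErgodic ν σ) (hA : A.Invariant)
    (hAM : IsBohr A M) (hfm : Measurable f) (hf : ∀ y, f y ∈ Set.Icc (0 : ℝ) 1)
    (hP : ∀ i, MeasurableSet (P ⁻¹' {i})) (hQ : ∀ i, MeasurableSet (Q ⁻¹' {i}))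
    (hP₁ : ∀ n y, P (σ (n, 0) y) = P y) (hQ₂ : ∀ n y, Q (σ (0, n) y) = Q y) (i j : ι) :
    M (fun n => ∫ y, (fun y => f y * fib P i y) y *
        (fun y => f y * fib Q j y) (σ (n • (-1, 1)) y) ∂ν) =
      ∫ y, fib P i y * fib Q j y * (relDensity ν (rigidAlgebra M h (-1, 1)) f P i y *
        relDensity ν (rigidAlgebra M h (-1, 1)) f Q j y) ∂ν := by
  have hK := rigidAlgebra_le (M := M) (w := (-1, 1)) h
  have hL : ∀ {R : Y → ι}, (∀ i, MeasurableSet (R ⁻¹' {i})) → ∀ i,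
      MemLp (fun y => f y * fib R i y) ⊤ ν := fun hR i =>
    memLp_top_of_Icc (C := 1) (hfm.mul (measurable_fib hR i))
      (fun y => mul_nonneg (hf y).1 (fib_mem _ i y).1)
      fun y => mul_le_one₀ (hf y).2 (fib_mem _ i y).1 (fib_mem _ i y).2
  have hfib : ∀ {R : Y → ι}, (∀ i, MeasurableSet (R ⁻¹' {i})) → ∀ i, MemLp (fib R i) ⊤ ν :=
    fun hR i => memLp_top_of_Icc (C := 1) (measurable_fib hR i)
      (fun y => (fib_mem _ i y).1) fun y => (fib_mem _ i y).2
  have hk : Measurable[rigidAlgebra M h (-1, 1)] fun y =>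
      relDensity ν (rigidAlgebra M h (-1, 1)) f P i y *
        relDensity ν (rigidAlgebra M h (-1, 1)) f Q j y :=
    (measurable_relDensity i).mul (measurable_relDensity j)
  have hkL : MemLp (fun y =>
      relDensity ν (rigidAlgebra M h (-1, 1)) f P i y *
        relDensity ν (rigidAlgebra M h (-1, 1)) f Q j y) ⊤ ν :=
    memLp_top_of_Icc (C := 1) (hk.mono hK le_rfl)
      (fun y => mul_nonneg (relDensity_mem i y).1 (relDensity_mem j y).1)
      fun y => mul_le_one₀ (relDensity_mem i y).2 (relDensity_mem j y).1 (relDensity_mem j y).2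
  rw [mean_integral_eq h hA hAM (hL hP i) (hL hQ j),
    integral_mul_mul_eq h hE hA hAM (hfib hP i) (hfib hQ j) hkL (fun n y => ?_) (fun n y => ?_)
      hk.stronglyMeasurable]
  · refine integral_congr_ae ?_
    filter_upwards [condExp_mul_fib (ν := ν) (𝒢 := rigidAlgebra M h (-1, 1)) hfm hf hP i,
      condExp_mul_fib (ν := ν) (𝒢 := rigidAlgebra M h (-1, 1)) hfm hf hQ j] with y h1 h2
    rw [h1, h2]
    ring
  · simp only [fib, hP₁]
  · simp only [fib, hQ₂]

theorem pow_four_integral_le_mean (h : IsZZSystem ν σ) (hE : IsZZErgodic ν σ) (hA : A.Invariant)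
    (hAM : IsBohr A M) (hfm : Measurable f) (hf : ∀ y, f y ∈ Set.Icc (0 : ℝ) 1)
    (hP : ∀ i, MeasurableSet (P ⁻¹' {i})) (hQ : ∀ i, MeasurableSet (Q ⁻¹' {i}))
    (hP₁ : ∀ n y, P (σ (n, 0) y) = P y) (hQ₂ : ∀ n y, Q (σ (0, n) y) = Q y)
    {F : ι → ι → ℝ} (hF01 : ∀ i j, F i j ∈ Set.Icc (0 : ℝ) 1)
    (hF : ∀ χ : ι → ι → ℝ, ∫ y, f y * χ (P y) (Q y) ∂ν = ∫ y, F (P y) (Q y) * χ (P y) (Q y) ∂ν) :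
    (∫ y, f y ∂ν) ^ 4 ≤
      M (fun n => ∫ y, F (P y) (Q y) * f (σ (n, 0) y) * f (σ (0, n) y) ∂ν) := by
  have hK := rigidAlgebra_le (M := M) (w := (-1, 1)) h
  set r := relDensity ν (rigidAlgebra M h (-1, 1)) f P with hr
  set s := relDensity ν (rigidAlgebra M h (-1, 1)) f Q with hs
  have hrm : ∀ i, Measurable (r i) := fun i => (measurable_relDensity i).mono hK le_rfl
  have hsm : ∀ i, Measurable (s i) := fun i => (measurable_relDensity i).mono hK le_rfl
  have hr01 : ∀ i y, r i y ∈ Set.Icc (0 : ℝ) 1 := fun i y => relDensity_mem i y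
  have hs01 : ∀ i y, s i y ∈ Set.Icc (0 : ℝ) 1 := fun i y => relDensity_mem i y
  have e1 : M (fun n => ∫ y, F (P y) (Q y) * f (σ (n, 0) y) * f (σ (0, n) y) ∂ν) =
      ∑ x : ι × ι, F x.1 x.2 * ∫ y, fib P x.1 y * fib Q x.2 y * (r x.1 y * s x.2 y) ∂ν := by
    simp only [integral_fib_shift h hfm hf hP hQ hP₁ hQ₂]
    have e2 : (fun n : ℤ => ∑ x : ι × ι, F x.1 x.2 * ∫ y, (fun y => f y * fib P x.1 y) y *
        (fun y => f y * fib Q x.2 y) (σ (n • (-1, 1)) y) ∂ν) =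
        ∑ x : ι × ι, F x.1 x.2 • fun n : ℤ => ∫ y, (fun y => f y * fib P x.1 y) y *
          (fun y => f y * fib Q x.2 y) (σ (n • (-1, 1)) y) ∂ν := by
      ext n
      rw [Finset.sum_apply]
      rfl
    rw [e2, map_sum]
    refine Finset.sum_congr rfl fun x _ => ?_
    rw [map_smul, smul_eq_mul]
    have := mean_integral_fib h hE hA hAM hfm hf hP hQ hP₁ hQ₂ x.1 x.2
    rw [this]
  have i1 : ∀ x : ι × ι, Integrable (fun y => F x.1 x.2 *
      (fib P x.1 y * fib Q x.2 y * (r x.1 y * s x.2 y))) ν := by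
    intro x
    refine Integrable.const_mul (integrable_of_Icc (C := 1) ?_ (fun y => ?_) fun y => ?_) _
    · exact ((measurable_fib hP _).mul (measurable_fib hQ _)).mul ((hrm _).mul (hsm _))
    · exact mul_nonneg (mul_nonneg (fib_mem _ _ _).1 (fib_mem _ _ _).1)
        (mul_nonneg (hr01 _ _).1 (hs01 _ _).1)
    · exact mul_le_one₀ (mul_le_one₀ (fib_mem _ _ _).2 (fib_mem _ _ _).1 (fib_mem _ _ _).2)
        (mul_nonneg (hr01 _ _).1 (hs01 _ _).1)
        (mul_le_one₀ (hr01 _ _).2 (hs01 _ _).1 (hs01 _ _).2)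
  have e3 : ∑ x : ι × ι, F x.1 x.2 * ∫ y, fib P x.1 y * fib Q x.2 y * (r x.1 y * s x.2 y) ∂ν =
      ∫ y, F (P y) (Q y) * r (P y) y * s (Q y) y ∂ν := by
    simp only [← integral_const_mul]
    rw [← integral_finsetSum _ fun x _ => i1 x]
    congr 1
    ext y
    rw [mul_assoc, ← sum_fib_mul_fib P Q (fun i j => F i j * (r i y * s j y))]
    refine Finset.sum_congr rfl fun x _ => ?_
    ring
  rw [e1, e3]
  refine pow_four_integral_le hfm (measurable_fib_comp hP hQ F) (measurable_relDensity_fib hK hP)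
    (measurable_relDensity_fib hK hQ) hf (fun y => hF01 _ _) (fun y => hr01 _ _)
    (fun y => hs01 _ _) (fun τ hτ => ?_)
    (fun τ hτ => integral_div_relDensity_le hK hfm hf hP hτ)
    (fun τ hτ => integral_div_relDensity_le hK hfm hf hQ hτ)
  have h1 := hF fun i j => (F i j + τ)⁻¹
  simp only [← div_eq_mul_inv] at h1
  rw [h1]
  have h2 : ∫ y, F (P y) (Q y) / (F (P y) (Q y) + τ) ∂ν ≤ ∫ _, (1 : ℝ) ∂ν := by
    refine integral_mono_of_nonneg (Eventually.of_forall fun y => ?_) (integrable_const _)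
      (Eventually.of_forall fun y => ?_)
    · exact div_nonneg (hF01 _ _).1 (add_nonneg (hF01 _ _).1 hτ.le)
    · have := (hF01 (P y) (Q y)).1
      exact (div_le_one (by linarith)).2 (by linarith)
  simpa using h2

end Lower

section Ergodic

theorem IsZZSystem.eq_smul_of_le {Y : Type*} [MeasurableSpace Y] {ν ρ : Measure Y}
    {σ : ℤ × ℤ → Y → Y} [IsProbabilityMeasure ν] [IsFiniteMeasure ρ] (h : IsZZSystem ν σ)
    (hE : IsZZErgodic ν σ) (hρ : ∀ u, MeasurePreserving (σ u) ρ ρ) (hle : ρ ≤ ν) :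
    ρ = ρ Set.univ • ν := by
  have hac : ρ ≪ ν := Measure.absolutelyContinuous_of_le hle
  obtain ⟨c, hc⟩ := h.ae_eq_const hE (Measure.measurable_rnDeriv ρ ν).ennreal_toReal fun u => by
    filter_upwards [(hρ u).rnDeriv_comp_aeEq (h.mp u)] with y hy
    rw [Function.comp_apply] at hy
    rw [hy]
  have hd : ρ.rnDeriv ν =ᵐ[ν] fun _ => ENNReal.ofReal c := by
    filter_upwards [hc, Measure.rnDeriv_lt_top ρ ν] with y h1 h2
    rw [← h1, ENNReal.ofReal_toReal h2.ne]
  have e : ρ = ENNReal.ofReal c • ν := by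
    rw [← withDensity_const, ← withDensity_congr_ae hd, Measure.withDensity_rnDeriv_eq _ _ hac]
  have e2 : ρ Set.univ = ENNReal.ofReal c := by
    rw [e]; simp
  rw [e2]
  exact e

variable {Z Z' : Type*} [TopologicalSpace Z] [CompactSpace Z] [T2Space Z] [MeasurableSpace Z]
  [BorelSpace Z] [HasOuterApproxClosed Z]
  [TopologicalSpace Z'] [MeasurableSpace Z'] [BorelSpace Z']
  [HasOuterApproxClosed Z']

/-- Invariant states on `C(Z, ℝ)` which project to `ν`. -/
structure IsState (S : ℤ × ℤ → C(Z, Z)) (π : C(Z, Z')) (ν : Measure Z') (Λ : C(Z, ℝ) → ℝ) :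
    Prop where
  add : ∀ φ ψ, Λ (φ + ψ) = Λ φ + Λ ψ
  smul : ∀ (c : ℝ) φ, Λ (c • φ) = c * Λ φ
  nonneg : ∀ φ : C(Z, ℝ), (∀ z, 0 ≤ φ z) → 0 ≤ Λ φ
  inv : ∀ u φ, Λ (φ.comp (S u)) = Λ φ
  proj : ∀ φ : C(Z', ℝ), Λ (φ.comp π) = ∫ y, φ y ∂ν

variable {S : ℤ × ℤ → C(Z, Z)} {π : C(Z, Z')} {ν : Measure Z'} [IsProbabilityMeasure ν]
  {Λ : C(Z, ℝ) → ℝ}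

omit [T2Space Z] [MeasurableSpace Z] [BorelSpace Z] [HasOuterApproxClosed Z]
  [BorelSpace Z'] [HasOuterApproxClosed Z'] in
theorem IsState.mem_Icc (h : IsState S π ν Λ) (φ : C(Z, ℝ)) : Λ φ ∈ Set.Icc (-‖φ‖) ‖φ‖ := by
  have h1 : Λ 1 = 1 := by
    have := h.proj 1
    simpa using this
  have h2 := h.nonneg (‖φ‖ • (1 : C(Z, ℝ)) + φ) fun z => by
    have := (abs_le.1 (φ.norm_coe_le_norm z)).1
    simp only [ContinuousMap.add_apply, ContinuousMap.smul_apply, ContinuousMap.one_apply,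
      smul_eq_mul, mul_one]
    linarith
  have h3 := h.nonneg (‖φ‖ • (1 : C(Z, ℝ)) + (-1 : ℝ) • φ) fun z => by
    have := (abs_le.1 (φ.norm_coe_le_norm z)).2
    simp only [ContinuousMap.add_apply, ContinuousMap.smul_apply, ContinuousMap.one_apply,
      smul_eq_mul, mul_one]
    linarith
  rw [h.add, h.smul, h1] at h2 h3
  rw [h.smul] at h3
  exact ⟨by linarith, by linarith⟩

omit [T2Space Z] [MeasurableSpace Z] [BorelSpace Z] [HasOuterApproxClosed Z]
  [BorelSpace Z'] [HasOuterApproxClosed Z'] in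
theorem isCompact_setOf_isState (S : ℤ × ℤ → C(Z, Z)) (π : C(Z, Z')) (ν : Measure Z')
    [IsProbabilityMeasure ν] : IsCompact {Λ : C(Z, ℝ) → ℝ | IsState S π ν Λ} := by
  refine (isCompact_univ_pi fun φ : C(Z, ℝ) =>
    isCompact_Icc (a := -‖φ‖) (b := ‖φ‖)).of_isClosed_subset ?_ fun Λ h φ _ => IsState.mem_Icc h φ
  have e : {Λ : C(Z, ℝ) → ℝ | IsState S π ν Λ} =
      {Λ | ∀ φ ψ, Λ (φ + ψ) = Λ φ + Λ ψ} ∩ {Λ | ∀ (c : ℝ) φ, Λ (c • φ) = c * Λ φ} ∩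
      {Λ | ∀ φ : C(Z, ℝ), (∀ z, 0 ≤ φ z) → 0 ≤ Λ φ} ∩ {Λ | ∀ u φ, Λ (φ.comp (S u)) = Λ φ} ∩
      {Λ | ∀ φ : C(Z', ℝ), Λ (φ.comp π) = ∫ y, φ y ∂ν} := by
    ext Λ
    exact ⟨fun h => ⟨⟨⟨⟨h.add, h.smul⟩, h.nonneg⟩, h.inv⟩, h.proj⟩,
      fun ⟨⟨⟨⟨h1, h2⟩, h3⟩, h4⟩, h5⟩ => ⟨h1, h2, h3, h4, h5⟩⟩
  rw [e]
  simp only [Set.ofPred_forall]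
  refine ((((?_ : IsClosed _).inter ?_).inter ?_).inter ?_).inter ?_
  · exact isClosed_iInter fun φ => isClosed_iInter fun ψ =>
      isClosed_eq (by fun_prop) (by fun_prop)
  · exact isClosed_iInter fun c => isClosed_iInter fun φ =>
      isClosed_eq (by fun_prop) (by fun_prop)
  · exact isClosed_iInter fun φ => isClosed_iInter fun _ =>
      isClosed_le (by fun_prop) (by fun_prop)
  · exact isClosed_iInter fun u => isClosed_iInter fun φ =>
      isClosed_eq (by fun_prop) (by fun_prop)
  · exact isClosed_iInter fun φ => isClosed_eq (by fun_prop) (by fun_prop)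

theorem IsState.exists_measure (h : IsState S π ν Λ) :
    ∃ lam : Measure Z, IsProbabilityMeasure lam ∧ (∀ φ, ∫ z, φ z ∂lam = Λ φ) ∧
      (∀ u, MeasurePreserving (S u) lam lam) ∧ MeasurePreserving π lam ν := by
  let Λ' : CompactlySupportedContinuousMap Z ℝ →ₚ[ℝ] ℝ :=
    PositiveLinearMap.mk₀
      { toFun := fun g => Λ g.toContinuousMap
        map_add' := fun g g' => h.add _ _
        map_smul' := fun c g => h.smul _ _ }
      fun g hg => h.nonneg _ fun z => hg z
  have hintg : ∀ φ : C(Z, ℝ), ∫ z, φ z ∂(RealRMK.rieszMeasure Λ') = Λ φ := fun φ =>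
    RealRMK.integral_rieszMeasure Λ' (CompactlySupportedContinuousMap.continuousMapEquiv φ)
  have hmp : ∀ u, MeasurePreserving (S u) (RealRMK.rieszMeasure Λ') (RealRMK.rieszMeasure Λ') := by
    intro u
    refine ⟨(S u).measurable, ext_of_forall_integral_eq_of_IsFiniteMeasure fun f => ?_⟩
    rw [integral_map (S u).measurable.aemeasurable f.continuous.aestronglyMeasurable]
    exact (hintg (f.toContinuousMap.comp (S u))).trans
      ((h.inv u _).trans (hintg f.toContinuousMap).symm)
  have hpr : MeasurePreserving π (RealRMK.rieszMeasure Λ') ν := by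
    refine ⟨π.measurable, ext_of_forall_integral_eq_of_IsFiniteMeasure fun f => ?_⟩
    rw [integral_map π.measurable.aemeasurable f.continuous.aestronglyMeasurable]
    exact (hintg (f.toContinuousMap.comp π)).trans (h.proj _)
  refine ⟨RealRMK.rieszMeasure Λ', ⟨?_⟩, hintg, hmp, hpr⟩
  have := hpr.measure_preimage (s := Set.univ) nullMeasurableSet_univ
  rw [Set.preimage_univ] at this
  exact this.trans measure_univ

omit [T2Space Z] [HasOuterApproxClosed Z] in
theorem continuousMap_integrable (lam : Measure Z) [IsFiniteMeasure lam] (φ : C(Z, ℝ)) :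
    Integrable φ lam :=
  Integrable.of_bound φ.continuous.aestronglyMeasurable ‖φ‖
    (Eventually.of_forall φ.norm_coe_le_norm)

omit [T2Space Z] [HasOuterApproxClosed Z] [HasOuterApproxClosed Z'] in
theorem isState_restrict {lam : Measure Z} [IsProbabilityMeasure lam] {σ : ℤ × ℤ → Z' → Z'}
    (hS : ∀ u, MeasurePreserving (S u) lam lam) (hπ : MeasurePreserving π lam ν)
    (hπS : ∀ u z, π (S u z) = σ u (π z)) (h : IsZZSystem ν σ) (hE : IsZZErgodic ν σ)
    {s : Set Z} (hs : MeasurableSet s) (hinv : ∀ u, S u ⁻¹' s = s) (h0 : lam s ≠ 0) :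
    IsState S π ν fun φ => (lam.real s)⁻¹ * ∫ z in s, φ z ∂lam := by
  have h0' : lam.real s ≠ 0 := (measureReal_ne_zero_iff).2 h0
  have hr : ∀ u, MeasurePreserving (S u) (lam.restrict s) (lam.restrict s) := fun u => by
    have := (hS u).restrict_preimage hs
    rwa [hinv u] at this
  refine ⟨fun φ ψ => ?_, fun c φ => ?_, fun φ hφ => ?_, fun u φ => ?_, fun φ => ?_⟩
  · have := integral_add (continuousMap_integrable (lam.restrict s) φ)
      (continuousMap_integrable (lam.restrict s) ψ)
    simp only [ContinuousMap.add_apply]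
    rw [this]
    ring
  · simp only [ContinuousMap.smul_apply, smul_eq_mul, integral_const_mul]
    ring
  · exact mul_nonneg (inv_nonneg.2 measureReal_nonneg) (integral_nonneg hφ)
  · have := integral_map (μ := lam.restrict s) (S u).measurable.aemeasurable
      (f := φ) φ.continuous.aestronglyMeasurable
    rw [(hr u).map_eq] at this
    simp only [ContinuousMap.comp_apply]
    rw [← this]
  · have hle : (lam.restrict s).map π ≤ ν := by
      rw [← hπ.map_eq]
      exact Measure.map_mono Measure.restrict_le_self π.measurable
    have hu : (lam.restrict s).map π Set.univ = lam s := by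
      rw [Measure.map_apply π.measurable MeasurableSet.univ, Set.preimage_univ,
        Measure.restrict_apply_univ]
    have key := h.eq_smul_of_le hE (ρ := (lam.restrict s).map π) (fun u => ?_) hle
    · have := integral_map (μ := lam.restrict s) π.measurable.aemeasurable
        (f := φ) φ.continuous.aestronglyMeasurable
      rw [key, hu, integral_smul_measure, smul_eq_mul] at this
      simp only [ContinuousMap.comp_apply]
      rw [← this, ← mul_assoc]
      exact (congrArg (· * _) (inv_mul_cancel₀ h0')).trans (one_mul _)
    · refine ⟨(h.mp u).measurable, ?_⟩
      rw [Measure.map_map (h.mp u).measurable π.measurable]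
      have : σ u ∘ π = π ∘ S u := funext fun z => (hπS u z).symm
      rw [this, ← Measure.map_map π.measurable (S u).measurable, (hr u).map_eq]

theorem IsState.exists_ergodic (h₀ : IsState S π ν Λ) {σ : ℤ × ℤ → Z' → Z'}
    (hS0 : ∀ z, S 0 z = z) (hSadd : ∀ u v z, S (u + v) z = S u (S v z))
    (hπS : ∀ u z, π (S u z) = σ u (π z)) (h : IsZZSystem ν σ) (hE : IsZZErgodic ν σ)
    (j : C(Z, ℝ)) :
    ∃ lam : Measure Z, IsProbabilityMeasure lam ∧ IsZZSystem lam (fun u => S u) ∧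
      IsZZErgodic lam (fun u => S u) ∧ MeasurePreserving π lam ν ∧ Λ j ≤ ∫ z, j z ∂lam := by
  have hK := isCompact_setOf_isState S π ν
  obtain ⟨Λ₁, h1, hmax⟩ := hK.exists_isMaxOn ⟨Λ, h₀⟩
    (f := fun Λ : C(Z, ℝ) → ℝ => Λ j) (by fun_prop)
  have hmax' : ∀ Λ', IsState S π ν Λ' → Λ' j ≤ Λ₁ j := fun Λ' h' => hmax h'
  have hK2 : IsCompact ({Λ : C(Z, ℝ) → ℝ | IsState S π ν Λ} ∩ {Λ | Λ₁ j ≤ Λ j}) :=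
    hK.inter_right (isClosed_le (by fun_prop) (by fun_prop))
  obtain ⟨Λ₂, hext⟩ := hK2.extremePoints_nonempty ⟨Λ₁, h1, le_refl (Λ₁ j)⟩
  obtain ⟨⟨h2, h2j⟩, hx⟩ := mem_extremePoints.1 hext
  obtain ⟨lam, hp, hintg, hmp, hpr⟩ := h2.exists_measure
  refine ⟨lam, hp, ⟨hS0, hSadd, hmp⟩, fun s hs hinv => ?_, hpr, ?_⟩
  · by_contra hcon
    rw [not_or] at hcon
    obtain ⟨hne0, hne1⟩ := hcon
    have hc0 : lam sᶜ ≠ 0 := fun hc => hne1 ((prob_compl_eq_zero_iff hs).1 hc)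
    have hinvc : ∀ u, S u ⁻¹' sᶜ = sᶜ := fun u => by rw [Set.preimage_compl, hinv u]
    have s1 := isState_restrict hmp hpr hπS h hE hs hinv hne0
    have s2 := isState_restrict hmp hpr hπS h hE hs.compl hinvc hc0
    set t := lam.real s with ht
    have ht0 : 0 < t := measureReal_nonneg.lt_of_ne' ((measureReal_ne_zero_iff).2 hne0)
    have htc : lam.real sᶜ = 1 - t := by rw [probReal_compl_eq_one_sub hs]
    have ht1 : 0 < 1 - t := by
      rw [← htc]
      exact measureReal_nonneg.lt_of_ne' ((measureReal_ne_zero_iff).2 hc0)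
    rw [htc] at s2
    have hsum : ∀ φ : C(Z, ℝ), t * (t⁻¹ * ∫ z in s, φ z ∂lam) +
        (1 - t) * ((1 - t)⁻¹ * ∫ z in sᶜ, φ z ∂lam) = Λ₂ φ := by
      intro φ
      rw [mul_inv_cancel_left₀ ht0.ne', mul_inv_cancel_left₀ ht1.ne',
        integral_add_compl hs (continuousMap_integrable lam φ), hintg]
    have m1 := hmax' _ s1
    have m2 := hmax' _ s2
    have hj := hsum j
    have h2j' : Λ₁ j ≤ Λ₂ j := h2j
    have j1 : Λ₁ j ≤ t⁻¹ * ∫ z in s, j z ∂lam := by nlinarith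
    have j2 : Λ₁ j ≤ (1 - t)⁻¹ * ∫ z in sᶜ, j z ∂lam := by nlinarith
    have e1 := hx _ ⟨s1, j1⟩ _ ⟨s2, j2⟩ ⟨t, 1 - t, ht0, ht1, by ring, funext hsum⟩
    have e2 : lam.restrict s = lam s • lam := by
      have : IsFiniteMeasure (lam s • lam) := Measure.smul_finite _ (measure_ne_top _ _)
      refine ext_of_forall_integral_eq_of_IsFiniteMeasure fun f => ?_
      have h3 := congrFun e1.1 f.toContinuousMap
      rw [← hintg] at h3
      rw [integral_smul_measure, smul_eq_mul]
      have h4 := congrArg (t * ·) h3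
      simp only [mul_inv_cancel_left₀ ht0.ne'] at h4
      exact h4
    have e3 : lam.real s = lam.real s * lam.real s := by
      calc lam.real s = (lam.restrict s).real s := by simp [measureReal_def]
        _ = (lam s • lam).real s := by rw [e2]
        _ = _ := by simp [measureReal_def, ENNReal.toReal_mul]
    rw [← ht] at e3
    nlinarith
  · rw [hintg]
    exact (hmax' Λ h₀).trans h2j

end Ergodic

section Cell

variable {Y Y' : Type*} [MeasurableSpace Y] [MeasurableSpace Y'] {ν : Measure Y} {ν' : Measure Y'}
  {ι ι' : Type*} [Fintype ι] [DecidableEq ι] [Fintype ι'] [DecidableEq ι'] {f : Y → ℝ}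
  {P Q : Y → ι} {f' : Y' → ℝ} {P' Q' : Y' → ι'} {π : Y' → Y} {e : ι' → ι}

theorem MeasureTheory.MeasurePreserving.integral_comp_measurable (hπ : MeasurePreserving π ν' ν)
    {φ : Y → ℝ} (hφ : Measurable φ) : ∫ y, φ (π y) ∂ν' = ∫ y, φ y ∂ν := by
  rw [← hπ.map_eq, integral_map hπ.measurable.aemeasurable hφ.aestronglyMeasurable]

/-- The average of `f` on the cell `{P = i, Q = j}`. -/
noncomputable def cell (ν : Measure Y) (f : Y → ℝ) (P Q : Y → ι) (i j : ι) : ℝ :=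
  (∫ y, f y * (fib P i y * fib Q j y) ∂ν) / ∫ y, fib P i y * fib Q j y ∂ν

/-- The energy of `f` relative to the partition generated by `P` and `Q`. -/
noncomputable def energy (ν : Measure Y) (f : Y → ℝ) (P Q : Y → ι) : ℝ :=
  ∫ y, cell ν f P Q (P y) (Q y) ^ 2 ∂ν

omit [MeasurableSpace Y] [Fintype ι] in
theorem fib_mul_fib_mem (P Q : Y → ι) (i j : ι) (y : Y) :
    fib P i y * fib Q j y ∈ Set.Icc (0 : ℝ) 1 :=
  ⟨mul_nonneg (fib_mem _ _ _).1 (fib_mem _ _ _).1,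
    mul_le_one₀ (fib_mem _ _ _).2 (fib_mem _ _ _).1 (fib_mem _ _ _).2⟩

variable [IsProbabilityMeasure ν] [IsProbabilityMeasure ν']

omit [Fintype ι] in
theorem integrable_mul_fib_mul_fib (hfm : Measurable f) (hf : ∀ y, f y ∈ Set.Icc (0 : ℝ) 1)
    (hP : ∀ i, MeasurableSet (P ⁻¹' {i})) (hQ : ∀ i, MeasurableSet (Q ⁻¹' {i})) (i j : ι) :
    Integrable (fun y => f y * (fib P i y * fib Q j y)) ν :=
  integrable_of_Icc (C := 1) (hfm.mul ((measurable_fib hP i).mul (measurable_fib hQ j)))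
    (fun y => mul_nonneg (hf y).1 (fib_mul_fib_mem P Q i j y).1)
    fun y => mul_le_one₀ (hf y).2 (fib_mul_fib_mem P Q i j y).1 (fib_mul_fib_mem P Q i j y).2

omit [Fintype ι] in
theorem integral_mul_fib_mul_fib_mem (hfm : Measurable f) (hf : ∀ y, f y ∈ Set.Icc (0 : ℝ) 1)
    (hP : ∀ i, MeasurableSet (P ⁻¹' {i})) (hQ : ∀ i, MeasurableSet (Q ⁻¹' {i})) (i j : ι) :
    ∫ y, f y * (fib P i y * fib Q j y) ∂ν ∈ Set.Icc 0 (∫ y, fib P i y * fib Q j y ∂ν) := by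
  refine ⟨integral_nonneg fun y => mul_nonneg (hf y).1 (fib_mul_fib_mem P Q i j y).1,
    integral_mono (integrable_mul_fib_mul_fib hfm hf hP hQ i j) ?_ fun y =>
      mul_le_of_le_one_left (fib_mul_fib_mem P Q i j y).1 (hf y).2⟩
  exact integrable_of_Icc (C := 1) ((measurable_fib hP i).mul (measurable_fib hQ j))
    (fun y => (fib_mul_fib_mem P Q i j y).1) fun y => (fib_mul_fib_mem P Q i j y).2

omit [Fintype ι] in
theorem cell_mem (hfm : Measurable f) (hf : ∀ y, f y ∈ Set.Icc (0 : ℝ) 1)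
    (hP : ∀ i, MeasurableSet (P ⁻¹' {i})) (hQ : ∀ i, MeasurableSet (Q ⁻¹' {i})) (i j : ι) :
    cell ν f P Q i j ∈ Set.Icc (0 : ℝ) 1 := by
  have h := integral_mul_fib_mul_fib_mem (ν := ν) hfm hf hP hQ i j
  exact ⟨div_nonneg h.1 (h.1.trans h.2), div_le_one_of_le₀ h.2 (h.1.trans h.2)⟩

theorem integral_mul_cell (hfm : Measurable f) (hf : ∀ y, f y ∈ Set.Icc (0 : ℝ) 1)
    (hP : ∀ i, MeasurableSet (P ⁻¹' {i})) (hQ : ∀ i, MeasurableSet (Q ⁻¹' {i}))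
    (χ : ι → ι → ℝ) :
    ∫ y, f y * χ (P y) (Q y) ∂ν = ∫ y, cell ν f P Q (P y) (Q y) * χ (P y) (Q y) ∂ν := by
  have i2 : ∀ x : ι × ι, Integrable (fun y => fib P x.1 y * fib Q x.2 y) ν := fun x =>
    integrable_of_Icc (C := 1) ((measurable_fib hP _).mul (measurable_fib hQ _))
    (fun y => (fib_mul_fib_mem P Q _ _ y).1) fun y => (fib_mul_fib_mem P Q _ _ y).2
  have e1 : ∀ y, f y * χ (P y) (Q y) =
      ∑ x : ι × ι, χ x.1 x.2 * (f y * (fib P x.1 y * fib Q x.2 y)) := fun y => by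
    rw [← sum_fib_mul_fib P Q χ, Finset.mul_sum]
    exact Finset.sum_congr rfl fun x _ => by ring
  have e2 : ∀ y, cell ν f P Q (P y) (Q y) * χ (P y) (Q y) =
      ∑ x : ι × ι, χ x.1 x.2 * cell ν f P Q x.1 x.2 * (fib P x.1 y * fib Q x.2 y) := fun y => by
    rw [← sum_fib_mul_fib P Q fun i j => cell ν f P Q i j * χ i j]
    exact Finset.sum_congr rfl fun x _ => by ring
  simp only [e1, e2]
  rw [integral_finsetSum _ fun x _ =>
      (integrable_mul_fib_mul_fib hfm hf hP hQ x.1 x.2).const_mul _,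
    integral_finsetSum _ fun x _ => (i2 x).const_mul _]
  refine Finset.sum_congr rfl fun x _ => ?_
  rw [integral_const_mul, integral_const_mul, mul_assoc]
  congr 1
  have h := integral_mul_fib_mul_fib_mem (ν := ν) hfm hf hP hQ x.1 x.2
  unfold cell
  by_cases h0 : ∫ y, fib P x.1 y * fib Q x.2 y ∂ν = 0
  · rw [h0, mul_zero]
    rw [h0] at h
    exact le_antisymm h.2 h.1
  · rw [div_mul_cancel₀ _ h0]

omit [Fintype ι] in
theorem energy_mem (hfm : Measurable f) (hf : ∀ y, f y ∈ Set.Icc (0 : ℝ) 1)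
    (hP : ∀ i, MeasurableSet (P ⁻¹' {i})) (hQ : ∀ i, MeasurableSet (Q ⁻¹' {i})) :
    energy ν f P Q ∈ Set.Icc (0 : ℝ) 1 := by
  refine ⟨integral_nonneg fun y => sq_nonneg _, ?_⟩
  have h1 : ∫ y, cell ν f P Q (P y) (Q y) ^ 2 ∂ν ≤ ∫ _, (1 : ℝ) ∂ν :=
    integral_mono_of_nonneg (Eventually.of_forall fun y => sq_nonneg _) (integrable_const _)
      (Eventually.of_forall fun y => pow_le_one₀ (cell_mem hfm hf hP hQ _ _).1
        (cell_mem hfm hf hP hQ _ _).2)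
  rwa [integral_const, probReal_univ, one_smul] at h1

theorem integral_cell_sub_sq (hπ : MeasurePreserving π ν' ν) (hfπ : ∀ y, f' y = f (π y))
    (hPπ : ∀ y, P (π y) = e (P' y)) (hQπ : ∀ y, Q (π y) = e (Q' y))
    (hfm : Measurable f) (hf : ∀ y, f y ∈ Set.Icc (0 : ℝ) 1)
    (hP : ∀ i, MeasurableSet (P ⁻¹' {i})) (hQ : ∀ i, MeasurableSet (Q ⁻¹' {i}))
    (hP' : ∀ i, MeasurableSet (P' ⁻¹' {i})) (hQ' : ∀ i, MeasurableSet (Q' ⁻¹' {i})) :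
    ∫ y, (cell ν' f' P' Q' (P' y) (Q' y) - cell ν f P Q (e (P' y)) (e (Q' y))) ^ 2 ∂ν' =
      energy ν' f' P' Q' - energy ν f P Q := by
  have hf'm : Measurable f' := by
    rw [funext hfπ]; exact hfm.comp hπ.measurable
  have hf' : ∀ y, f' y ∈ Set.Icc (0 : ℝ) 1 := fun y => by rw [hfπ]; exact hf _
  have hc := cell_mem (ν := ν) hfm hf hP hQ
  have hc' := cell_mem (ν := ν') hf'm hf' hP' hQ'
  have m1 := measurable_fib_comp hP' hQ' (cell ν' f' P' Q')
  have m2 := measurable_fib_comp hP' hQ' fun i j => cell ν f P Q (e i) (e j)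
  have m3 := measurable_fib_comp hP hQ (cell ν f P Q)
  have i1 : Integrable (fun y => cell ν' f' P' Q' (P' y) (Q' y) ^ 2) ν' :=
    integrable_of_Icc (C := 1) (m1.pow_const 2) (fun y => sq_nonneg _)
      fun y => pow_le_one₀ (hc' _ _).1 (hc' _ _).2
  have i2 : Integrable (fun y => cell ν f P Q (e (P' y)) (e (Q' y)) ^ 2) ν' :=
    integrable_of_Icc (C := 1) (m2.pow_const 2) (fun y => sq_nonneg _)
      fun y => pow_le_one₀ (hc _ _).1 (hc _ _).2
  have i3 : Integrable (fun y => cell ν' f' P' Q' (P' y) (Q' y) *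
      cell ν f P Q (e (P' y)) (e (Q' y))) ν' :=
    integrable_of_Icc (C := 1) (m1.mul m2) (fun y => mul_nonneg (hc' _ _).1 (hc _ _).1)
      fun y => mul_le_one₀ (hc' _ _).2 (hc _ _).1 (hc _ _).2
  have e1 : ∀ y, (cell ν' f' P' Q' (P' y) (Q' y) - cell ν f P Q (e (P' y)) (e (Q' y))) ^ 2 =
      cell ν' f' P' Q' (P' y) (Q' y) ^ 2 - 2 * (cell ν' f' P' Q' (P' y) (Q' y) *
        cell ν f P Q (e (P' y)) (e (Q' y))) + cell ν f P Q (e (P' y)) (e (Q' y)) ^ 2 :=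
    fun y => by ring
  have i12 : Integrable (fun y => cell ν' f' P' Q' (P' y) (Q' y) ^ 2 -
      2 * (cell ν' f' P' Q' (P' y) (Q' y) * cell ν f P Q (e (P' y)) (e (Q' y)))) ν' :=
    i1.sub (i3.const_mul 2)
  simp only [e1]
  rw [integral_add i12 i2, integral_sub i1 (i3.const_mul 2), integral_const_mul,
    ← integral_mul_cell hf'm hf' hP' hQ' fun i j => cell ν f P Q (e i) (e j)]
  simp only [hfπ, ← hPπ, ← hQπ]
  rw [hπ.integral_comp_measurable (φ := fun y => f y * cell ν f P Q (P y) (Q y)) (hfm.mul m3),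
    hπ.integral_comp_measurable (φ := fun y => cell ν f P Q (P y) (Q y) ^ 2) (m3.pow_const 2),
    integral_mul_cell hfm hf hP hQ (cell ν f P Q)]
  simp only [← pow_two]
  unfold energy
  ring

theorem abs_integral_mul_le_sqrt {h w : Y' → ℝ} (hm : Measurable h) {C : ℝ}
    (hC : ∀ y, |h y| ≤ C) (hw : ∀ y, |w y| ≤ 1) :
    |∫ y, h y * w y ∂ν'| ≤ √(∫ y, h y ^ 2 ∂ν') := by
  have i1 : Integrable (fun y => |h y|) ν' :=
    integrable_of_Icc (hm.norm) (fun y => abs_nonneg _) hC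
  have i2 : Integrable (fun y => h y ^ 2) ν' :=
    integrable_of_Icc (C := C ^ 2) (hm.pow_const 2) (fun y => sq_nonneg _)
      fun y => by rw [← sq_abs]; exact pow_le_pow_left₀ (abs_nonneg _) (hC y) 2
  have h1 : |∫ y, h y * w y ∂ν'| ≤ ∫ y, |h y| ∂ν' := by
    refine abs_integral_le_integral_abs.trans (integral_mono_of_nonneg
      (Eventually.of_forall fun y => abs_nonneg _) i1 (Eventually.of_forall fun y => ?_))
    simp only [abs_mul]
    exact mul_le_of_le_one_right (abs_nonneg _) (hw y)
  refine h1.trans (Real.le_sqrt_of_sq_le ?_)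
  set m := ∫ y, |h y| ∂ν'
  have h2 : 0 ≤ ∫ y, (|h y| - m) ^ 2 ∂ν' := integral_nonneg fun y => sq_nonneg _
  have e1 : ∀ y, (|h y| - m) ^ 2 = (h y ^ 2 - 2 * m * |h y|) + m ^ 2 := fun y => by
    rw [← sq_abs (h y)]; ring
  have i12 : Integrable (fun y => h y ^ 2 - 2 * m * |h y|) ν' := i2.sub (i1.const_mul (2 * m))
  simp only [e1] at h2
  rw [integral_add i12 (integrable_const _), integral_sub i2 (i1.const_mul _),
    integral_const_mul] at h2
  simp only [integral_const, probReal_univ, one_smul] at h2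
  change 0 ≤ _ - 2 * m * m + m ^ 2 at h2
  linarith

theorem abs_integral_cell_sub_mul_le (hπ : MeasurePreserving π ν' ν)
    (hfπ : ∀ y, f' y = f (π y))
    (hPπ : ∀ y, P (π y) = e (P' y)) (hQπ : ∀ y, Q (π y) = e (Q' y))
    (hfm : Measurable f) (hf : ∀ y, f y ∈ Set.Icc (0 : ℝ) 1)
    (hP : ∀ i, MeasurableSet (P ⁻¹' {i})) (hQ : ∀ i, MeasurableSet (Q ⁻¹' {i}))
    (hP' : ∀ i, MeasurableSet (P' ⁻¹' {i})) (hQ' : ∀ i, MeasurableSet (Q' ⁻¹' {i}))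
    {w : Y' → ℝ} (hw : ∀ y, |w y| ≤ 1) :
    |∫ y, (cell ν' f' P' Q' (P' y) (Q' y) - cell ν f P Q (e (P' y)) (e (Q' y))) * w y ∂ν'| ≤
      √(energy ν' f' P' Q' - energy ν f P Q) := by
  rw [← integral_cell_sub_sq hπ hfπ hPπ hQπ hfm hf hP hQ hP' hQ']
  have hf'm : Measurable f' := by
    rw [funext hfπ]; exact hfm.comp hπ.measurable
  have hf' : ∀ y, f' y ∈ Set.Icc (0 : ℝ) 1 := fun y => by rw [hfπ]; exact hf _
  have hc := cell_mem (ν := ν) hfm hf hP hQ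
  have hc' := cell_mem (ν := ν') hf'm hf' hP' hQ'
  refine abs_integral_mul_le_sqrt (C := 1) ((measurable_fib_comp hP' hQ' _).sub
    (measurable_fib_comp hP' hQ' fun i j => cell ν f P Q (e i) (e j))) (fun y => ?_) hw
  have h1 := hc' (P' y) (Q' y)
  have h2 := hc (e (P' y)) (e (Q' y))
  rw [abs_le]
  exact ⟨by linarith [h1.1, h2.2], by linarith [h1.2, h2.1]⟩

end Cell

namespace ZMean

variable (L : ZMean)

theorem fun_add (c d : ℤ → ℝ) : L (fun n => c n + d n) = L (fun n => c n) + L (fun n => d n) :=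
  map_add L.toLin c d

theorem fun_smul (a : ℝ) (c : ℤ → ℝ) : L (fun n => a * c n) = a * L (fun n => c n) :=
  L.toLin.map_smul a c

end ZMean

section Symbolic

variable {ι κ : Type} [TopologicalSpace ι] [DiscreteTopology ι] [Finite ι] [MeasurableSpace ι]
  [BorelSpace ι] [TopologicalSpace κ] [DiscreteTopology κ] [Finite κ] [MeasurableSpace κ]
  [BorelSpace κ]

/-- The space of colourings of the plane, together with colourings of its rows and columns. -/
abbrev Sig (ι : Type) : Type := (ℤ × ℤ → Bool) × (ℤ → ι) × (ℤ → ι)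

omit [DiscreteTopology ι] [Finite ι] [MeasurableSpace ι] [BorelSpace ι] in
theorem continuous_shift (u : ℤ × ℤ) : Continuous fun z : Sig ι =>
    ((fun v => z.1 (v + u), fun b => z.2.1 (b + u.2), fun a => z.2.2 (a + u.1)) : Sig ι) := by
  fun_prop

/-- The shift action. -/
def sh (u : ℤ × ℤ) : C(Sig ι, Sig ι) where
  toFun z := (fun v => z.1 (v + u), fun b => z.2.1 (b + u.2), fun a => z.2.2 (a + u.1))
  continuous_toFun := continuous_shift u

omit [DiscreteTopology ι] [Finite ι] [MeasurableSpace ι] [BorelSpace ι] in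
theorem sh_zero (z : Sig ι) : sh 0 z = z := by
  simp [sh]

omit [DiscreteTopology ι] [Finite ι] [MeasurableSpace ι] [BorelSpace ι] in
theorem sh_add (u v : ℤ × ℤ) (z : Sig ι) : sh (u + v) z = sh u (sh v z) := by
  simp [sh, add_assoc]

/-- The colour at the origin. -/
def obs : C(Sig ι, ℝ) where
  toFun z := if z.1 0 then 1 else 0
  continuous_toFun := (continuous_of_discreteTopology
    (f := fun t : Bool => if t then (1 : ℝ) else 0)).comp
      ((continuous_apply (0 : ℤ × ℤ)).comp continuous_fst)

omit [DiscreteTopology ι] [Finite ι] [MeasurableSpace ι] [BorelSpace ι] in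
theorem obs_mem (z : Sig ι) : obs z ∈ Set.Icc (0 : ℝ) 1 := by
  change (if z.1 0 then (1 : ℝ) else 0) ∈ Set.Icc (0 : ℝ) 1
  split_ifs <;> simp

/-- The colour of the row of the origin. -/
def rowSym (z : Sig ι) : ι := z.2.1 0

/-- The colour of the column of the origin. -/
def colSym (z : Sig ι) : ι := z.2.2 0

omit [DiscreteTopology ι] [Finite ι] [MeasurableSpace ι] [BorelSpace ι] in
theorem continuous_rowSym : Continuous (rowSym (ι := ι)) := by
  unfold rowSym; fun_prop

omit [DiscreteTopology ι] [Finite ι] [MeasurableSpace ι] [BorelSpace ι] in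
theorem continuous_colSym : Continuous (colSym (ι := ι)) := by
  unfold colSym; fun_prop

theorem measurableSet_rowSym (i : ι) : MeasurableSet (rowSym ⁻¹' {i}) :=
  ((isOpen_discrete {i}).preimage continuous_rowSym).measurableSet

theorem measurableSet_colSym (i : ι) : MeasurableSet (colSym ⁻¹' {i}) :=
  ((isOpen_discrete {i}).preimage continuous_colSym).measurableSet

omit [DiscreteTopology ι] [Finite ι] [MeasurableSpace ι] [BorelSpace ι] in
theorem rowSym_sh (n : ℤ) (z : Sig ι) : rowSym (sh (n, 0) z) = rowSym z := rfl

omit [DiscreteTopology ι] [Finite ι] [MeasurableSpace ι] [BorelSpace ι] in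
theorem colSym_sh (n : ℤ) (z : Sig ι) : colSym (sh (0, n) z) = colSym z := rfl

/-- The recolouring map. -/
def sigMap (e : κ → ι) : C(Sig κ, Sig ι) where
  toFun z := (z.1, fun b => e (z.2.1 b), fun a => e (z.2.2 a))
  continuous_toFun := by
    have : Continuous e := continuous_of_discreteTopology
    fun_prop

/-- Auxiliary colourings of the rows and columns of `z`. -/
def recolour (R C : ℤ → ℤ × ℤ) (r c : ℤ → Bool → κ) : C(Sig ι, Sig (ι × κ)) where
  toFun z := (z.1, fun b => (z.2.1 b, r b (z.1 (R b))), fun a => (z.2.2 a, c a (z.1 (C a))))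
  continuous_toFun := by
    have h1 : ∀ b, Continuous (r b) := fun b => continuous_of_discreteTopology
    have h2 : ∀ b, Continuous (c b) := fun b => continuous_of_discreteTopology
    refine continuous_fst.prodMk (Continuous.prodMk ?_ ?_)
    · exact continuous_pi fun b => Continuous.prodMk (by fun_prop) ((h1 b).comp (by fun_prop))
    · exact continuous_pi fun b => Continuous.prodMk (by fun_prop) ((h2 b).comp (by fun_prop))

omit [MeasurableSpace κ] [BorelSpace κ] in
theorem isState_mean {A : ZMean} (hA : A.Invariant) {ν : Measure (Sig ι)} [IsProbabilityMeasure ν]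
    (h : IsZZSystem ν fun u => sh u) (Θ : ℤ → C(Sig ι, Sig (ι × κ)))
    (hΘ : ∀ m z, sigMap Prod.fst (Θ m z) = z) :
    IsState sh (sigMap Prod.fst) ν fun φ : C(Sig (ι × κ), ℝ) =>
      A fun a => A fun b => A fun m => ∫ z, φ (sh (a, b) (Θ m z)) ∂ν := by
  have hintg : ∀ (φ : C(Sig (ι × κ), ℝ)) u m, Integrable (fun z => φ (sh u (Θ m z))) ν :=
    fun φ u m => continuousMap_integrable ν (φ.comp ((sh u).comp (Θ m)))
  have hbd : ∀ (φ : C(Sig (ι × κ), ℝ)) u m, |∫ z, φ (sh u (Θ m z)) ∂ν| ≤ ‖φ‖ := fun φ u m => by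
    have := norm_integral_le_of_norm_le_const (μ := ν) (f := fun z => φ (sh u (Θ m z)))
      (Eventually.of_forall fun z => φ.norm_coe_le_norm _)
    rwa [probReal_univ, mul_one] at this
  have hbd1 : ∀ (φ : C(Sig (ι × κ), ℝ)) u, |A fun m => ∫ z, φ (sh u (Θ m z)) ∂ν| ≤ ‖φ‖ :=
    fun φ u => A.abs_le fun m => hbd φ u m
  have hbd2 : ∀ (φ : C(Sig (ι × κ), ℝ)) (a : ℤ),
      |A fun b => A fun m => ∫ z, φ (sh (a, b) (Θ m z)) ∂ν| ≤ ‖φ‖ :=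
    fun φ a => A.abs_le fun b => hbd1 φ (a, b)
  refine ⟨fun φ ψ => ?_, fun c φ => ?_, fun φ hφ => ?_, fun u φ => ?_, fun φ => ?_⟩
  · simp only [ContinuousMap.add_apply, integral_add (hintg _ _ _) (hintg _ _ _), A.fun_add]
  · simp only [ContinuousMap.smul_apply, smul_eq_mul, integral_const_mul, A.fun_smul]
  · exact A.nonneg _ ‖φ‖ (fun a => A.nonneg _ ‖φ‖ (fun b => A.nonneg _ ‖φ‖ (fun m =>
      integral_nonneg fun z => hφ _) fun m => (le_abs_self _).trans (hbd _ _ _))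
      fun b => (le_abs_self _).trans (hbd1 _ _)) fun a => (le_abs_self _).trans (hbd2 _ _)
  · have e : ∀ a b, u + (a, b) = ((a + u.1, b + u.2) : ℤ × ℤ) := fun a b =>
      Prod.ext (add_comm _ _) (add_comm _ _)
    simp only [ContinuousMap.comp_apply, ← sh_add, e]
    rw [← hA _ _ (hbd2 φ) u.1]
    congr 1
    funext a
    exact hA (fun b => A fun m => ∫ z, φ (sh (a + u.1, b) (Θ m z)) ∂ν) _
      (fun b => hbd1 φ (a + u.1, b)) u.2
  · have e : ∀ u m z, sigMap Prod.fst (sh u (Θ m z)) = sh u z := fun u m z =>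
      (congrArg (sh u) (hΘ m z) :)
    simp only [ContinuousMap.comp_apply, e, h.integral_comp _ φ, A.const]

end Symbolic

theorem exists_net {δ : ℝ} (hδ : 0 < δ) : ∃ (k : ℕ) (v : Fin k → ℂ) (d : ℂ → Fin k),
    (∀ i, ‖v i‖ ≤ 1) ∧ ∀ w, ‖w‖ ≤ 1 → ‖v (d w) - w‖ ≤ δ := by
  obtain ⟨t, ht, htf, hc⟩ := (isCompact_closedBall (0 : ℂ) 1).finite_cover_balls hδ
  have h : ∀ w : ℂ, ∃ v : htf.toFinset, ‖w‖ ≤ 1 → ‖(v : ℂ) - w‖ ≤ δ := fun w => by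
    have key : ∀ w : ℂ, ‖w‖ ≤ 1 → ∃ v : htf.toFinset, ‖(v : ℂ) - w‖ ≤ δ := fun w hw => by
      obtain ⟨v, hv, hvw⟩ := Set.mem_iUnion₂.1 (hc (mem_closedBall_zero_iff.2 hw))
      refine ⟨⟨v, htf.mem_toFinset.2 hv⟩, ?_⟩
      rw [← dist_eq_norm, dist_comm]
      exact (Metric.mem_ball.1 hvw).le
    by_cases hw : ‖w‖ ≤ 1
    · obtain ⟨v, hv⟩ := key w hw
      exact ⟨v, fun _ => hv⟩
    · obtain ⟨v, -⟩ := key 0 (by simp)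
      exact ⟨v, fun hw' => absurd hw' hw⟩
  choose d hd using h
  refine ⟨_, fun i => htf.toFinset.equivFin.symm i, fun w => htf.toFinset.equivFin (d w),
    fun i => mem_closedBall_zero_iff.1 (ht (htf.mem_toFinset.1 (Subtype.prop _))), fun w hw => ?_⟩
  simp only [Equiv.symm_apply_apply]
  exact hd w hw

theorem exists_norm_eq_one_mul_eq_norm (x : ℂ) : ∃ ξ : ℂ, ‖ξ‖ = 1 ∧ ξ * x = ‖x‖ := by
  by_cases hx : x = 0
  · exact ⟨1, by simp, by simp [hx]⟩
  · have hx' : (‖x‖ : ℂ) ≠ 0 := by simpa using hx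
    refine ⟨conj x / ‖x‖, by simp [hx], ?_⟩
    rw [div_mul_eq_mul_div, Complex.conj_mul', pow_two, mul_div_assoc, div_self hx', mul_one]

theorem mul_ite_mul_re_le {g δ : ℝ} (hg : |g| ≤ 1) (p q : Bool) {G H V W : ℂ} (hH : ‖H‖ ≤ 1)
    (hV : ‖V‖ ≤ 1) (h1 : ‖V - (if p then G else 0)‖ ≤ δ)
    (h2 : ‖W - (if q then H else 0)‖ ≤ δ) :
    g * (if p then 1 else 0) * (if q then 1 else 0) * (G * H).re - 2 * δ ≤ g * (V * W).re := by
  set G' := if p then G else 0 with hG'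
  set H' := if q then H else 0 with hH'
  have e1 : g * (if p then 1 else 0) * (if q then 1 else 0) * (G * H).re =
      g * (G' * H').re := by
    rw [hG', hH']
    cases p <;> cases q <;> simp
  have h3 : ‖H'‖ ≤ 1 := by
    rw [hH']
    split_ifs
    · exact hH
    · simp
  have h4 : ‖V * W - G' * H'‖ ≤ 2 * δ := by
    have e2 : V * W - G' * H' = V * (W - H') + (V - G') * H' := by ring
    rw [e2]
    refine (norm_add_le _ _).trans ?_
    rw [norm_mul, norm_mul]
    nlinarith [norm_nonneg V, norm_nonneg (W - H'), norm_nonneg (V - G'), norm_nonneg H']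
  have h5 : |g * (V * W - G' * H').re| ≤ 2 * δ := by
    rw [abs_mul]
    exact (mul_le_of_le_one_left (abs_nonneg _) hg).trans
      ((Complex.abs_re_le_norm _).trans h4)
  have h6 := (abs_le.1 h5).1
  rw [Complex.sub_re, mul_sub] at h6
  rw [e1]
  linarith

section Symbolic

variable {ι : Type} [TopologicalSpace ι] [DiscreteTopology ι] [Fintype ι] [DecidableEq ι]
  [MeasurableSpace ι] [BorelSpace ι]

instance borelSpace_sig : BorelSpace (Sig ι) := inferInstance

instance hasOuterApproxClosed_sig : HasOuterApproxClosed (Sig ι) := inferInstance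

/-- The average of the colour of the origin on the cells of the row and column colouring. -/
noncomputable def sigCell (ν : Measure (Sig ι)) (z : Sig ι) : ℝ :=
  cell ν obs rowSym colSym (rowSym z) (colSym z)

/-- The energy of the row and column colouring. -/
noncomputable def sigEnergy (ν : Measure (Sig ι)) : ℝ := energy ν obs rowSym colSym

omit [DecidableEq ι] in
theorem measurable_obs : Measurable (obs : Sig ι → ℝ) := obs.continuous.measurable

variable (ν : Measure (Sig ι))

omit [Fintype ι] [BorelSpace ι] in
theorem continuous_sigCell : Continuous (sigCell ν) :=
  (continuous_of_discreteTopology (f := fun x : ι × ι => cell ν obs rowSym colSym x.1 x.2)).comp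
    (continuous_rowSym.prodMk continuous_colSym)

variable [IsProbabilityMeasure ν]

theorem sigCell_mem (z : Sig ι) : sigCell ν z ∈ Set.Icc (0 : ℝ) 1 :=
  cell_mem measurable_obs obs_mem measurableSet_rowSym measurableSet_colSym _ _

theorem abs_obs_sub_sigCell (z : Sig ι) : |obs z - sigCell ν z| ≤ 1 := by
  have h1 := obs_mem z
  have h2 := sigCell_mem ν z
  rw [abs_le]
  exact ⟨by linarith [h1.1, h2.2], by linarith [h1.2, h2.1]⟩

/-- The correlations of the colouring with the average of its first factor on cells removed. -/
noncomputable def resid (n : ℤ) : ℝ :=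
  ∫ z, (obs z - sigCell ν z) * obs (sh (n, 0) z) * obs (sh (0, n) z) ∂ν

theorem abs_integral_sigCell_sub_mul_le {κ : Type} [TopologicalSpace κ] [DiscreteTopology κ]
    [Fintype κ] [DecidableEq κ] [MeasurableSpace κ] [BorelSpace κ] {ν' : Measure (Sig κ)}
    [IsProbabilityMeasure ν'] {e : κ → ι} (hπ : MeasurePreserving (sigMap e) ν' ν)
    {w : Sig κ → ℝ} (hw : ∀ z, |w z| ≤ 1) :
    |∫ z, (sigCell ν' z - sigCell ν (sigMap e z)) * w z ∂ν'| ≤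
      √(sigEnergy ν' - sigEnergy ν) :=
  abs_integral_cell_sub_mul_le hπ (f := obs) (f' := obs) (P := rowSym) (Q := colSym)
    (P' := rowSym) (Q' := colSym) (e := e) (fun _ => rfl) (fun _ => rfl)
    (fun _ => rfl) measurable_obs obs_mem measurableSet_rowSym measurableSet_colSym
    measurableSet_rowSym measurableSet_colSym hw

omit [BorelSpace ι] [IsProbabilityMeasure ν] in
theorem continuous_resid_integrand (n : ℤ) : Continuous fun z : Sig ι =>
    (obs z - sigCell ν z) * obs (sh (n, 0) z) * obs (sh (0, n) z) := by
  have h1 := continuous_sigCell ν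
  fun_prop

theorem integrable_resid_integrand (n : ℤ) : Integrable (fun z : Sig ι =>
    (obs z - sigCell ν z) * obs (sh (n, 0) z) * obs (sh (0, n) z)) ν :=
  continuousMap_integrable ν ⟨_, continuous_resid_integrand ν n⟩

theorem abs_resid_integrand (n : ℤ) (z : Sig ι) :
    |(obs z - sigCell ν z) * obs (sh (n, 0) z) * obs (sh (0, n) z)| ≤ 1 := by
  have h2 := obs_mem (sh (n, 0) z)
  have h3 := obs_mem (sh (0, n) z)
  rw [abs_mul, abs_mul, abs_of_nonneg h2.1, abs_of_nonneg h3.1]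
  exact mul_le_one₀ (mul_le_one₀ (abs_obs_sub_sigCell ν z) h2.1 h2.2) h3.1 h3.2

theorem abs_resid (n : ℤ) : |resid ν n| ≤ 1 := by
  have := norm_integral_le_of_norm_le_const (μ := ν) (C := 1)
    (f := fun z => (obs z - sigCell ν z) * obs (sh (n, 0) z) * obs (sh (0, n) z))
    (Eventually.of_forall fun z => abs_resid_integrand ν n z)
  rwa [probReal_univ, mul_one] at this

variable {ν}

theorem exists_extension {A : ZMean} (hA : A.Invariant) (h : IsZZSystem ν fun u => sh u)
    (hE : IsZZErgodic ν fun u => sh u) (γ : Circle) {δ : ℝ} (hδ : 0 < δ) :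
    ∃ (k : ℕ) (lam : Measure (Sig (ι × Fin k))), IsProbabilityMeasure lam ∧
      IsZZSystem lam (fun u => sh u) ∧ IsZZErgodic lam (fun u => sh u) ∧
      MeasurePreserving (sigMap Prod.fst) lam ν ∧
      ‖A.cx (intChar γ * fun n => (resid ν n : ℂ))‖ ≤
        √(sigEnergy lam - sigEnergy ν) + 2 * δ := by
  obtain ⟨k, v, d, hv, hd⟩ := exists_net hδ
  obtain ⟨ξ, hξ1, hξ⟩ :=
    exists_norm_eq_one_mul_eq_norm (A.cx (intChar γ * fun n => (resid ν n : ℂ)))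
  have key1 : A (fun n => (ξ * intChar γ n).re * resid ν n) =
      ‖A.cx (intChar γ * fun n => (resid ν n : ℂ))‖ := by
    have e : ∀ n, (ξ * intChar γ n).re * resid ν n =
        (ξ * (intChar γ * fun n => (resid ν n : ℂ)) n).re := fun n => by
      rw [Pi.mul_apply, ← mul_assoc, Complex.re_mul_ofReal]
    simp only [e]
    rw [← A.cx_re fun n => ξ * (intChar γ * fun n => (resid ν n : ℂ)) n, A.cx_smul, hξ,
      Complex.ofReal_re]
  set Θ : ℤ → C(Sig ι, Sig (ι × Fin k)) := fun m =>
    recolour (fun b => (m - b, b)) (fun a => (a, m - a))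
      (fun b t => d (if t then ξ * intChar γ (m - b) else 0))
      (fun a t => d (if t then intChar γ (-a) else 0))
  set χ : ι × Fin k → ι × Fin k → ℝ := fun x y => (v x.2 * v y.2).re
  have hχ : ∀ x y, |χ x y| ≤ 1 := fun x y => (Complex.abs_re_le_norm _).trans (by
    rw [norm_mul]
    exact mul_le_one₀ (hv _) (norm_nonneg _) (hv _))
  have hjc : Continuous fun z : Sig (ι × Fin k) =>
      (obs z - sigCell ν (sigMap Prod.fst z)) * χ (rowSym z) (colSym z) := by
    have h1 : Continuous fun z : Sig (ι × Fin k) => χ (rowSym z) (colSym z) :=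
      (continuous_of_discreteTopology
        (f := fun x : (ι × Fin k) × (ι × Fin k) => χ x.1 x.2)).comp
          (continuous_rowSym.prodMk continuous_colSym)
    have h2 := (continuous_sigCell ν).comp
      (sigMap (Prod.fst : ι × Fin k → ι)).continuous
    exact (obs.continuous.sub h2).mul h1
  obtain ⟨lam, hlam, hsys, herg, hmp, hle⟩ := (isState_mean hA h Θ fun m z => rfl).exists_ergodic
    sh_zero sh_add (fun u z => rfl) h hE ⟨_, hjc⟩
  refine ⟨k, lam, hlam, hsys, herg, hmp, ?_⟩
  have key2 : ∫ z, (obs z - sigCell ν (sigMap Prod.fst z)) * χ (rowSym z) (colSym z) ∂lam ≤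
      √(sigEnergy lam - sigEnergy ν) := by
    have hc : Continuous fun z : Sig (ι × Fin k) => χ (rowSym z) (colSym z) :=
      (continuous_of_discreteTopology
        (f := fun x : (ι × Fin k) × (ι × Fin k) => χ x.1 x.2)).comp
          (continuous_rowSym.prodMk continuous_colSym)
    have i1 : Integrable (fun z => obs z * χ (rowSym z) (colSym z)) lam :=
      continuousMap_integrable lam ⟨_, obs.continuous.mul hc⟩
    have i2 : Integrable (fun z => sigCell lam z * χ (rowSym z) (colSym z)) lam :=
      continuousMap_integrable lam ⟨_, (continuous_sigCell lam).mul hc⟩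
    have i3 : Integrable (fun z => sigCell ν (sigMap Prod.fst z) * χ (rowSym z) (colSym z)) lam :=
      continuousMap_integrable lam
        ⟨_, ((continuous_sigCell ν).comp (sigMap Prod.fst).continuous).mul hc⟩
    have e1 : ∫ z, obs z * χ (rowSym z) (colSym z) ∂lam =
        ∫ z, sigCell lam z * χ (rowSym z) (colSym z) ∂lam :=
      integral_mul_cell measurable_obs obs_mem measurableSet_rowSym measurableSet_colSym χ
    have e2 : ∫ z, (obs z - sigCell ν (sigMap Prod.fst z)) * χ (rowSym z) (colSym z) ∂lam =
        ∫ z, (sigCell lam z - sigCell ν (sigMap Prod.fst z)) * χ (rowSym z) (colSym z) ∂lam := by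
      simp only [sub_mul]
      rw [integral_sub i1 i3, integral_sub i2 i3, e1]
    rw [e2]
    exact (le_abs_self _).trans (abs_integral_sigCell_sub_mul_le ν hmp fun z => hχ _ _)
  have key3 : ∀ a b m z, (obs (sh (a, b) z) - sigCell ν (sh (a, b) z)) *
      obs (sh (m - a - b, 0) (sh (a, b) z)) * obs (sh (0, m - a - b) (sh (a, b) z)) *
        (ξ * intChar γ (m - a - b)).re - 2 * δ ≤
      (⟨_, hjc⟩ : C(Sig (ι × Fin k), ℝ)) (sh (a, b) (Θ m z)) := by
    intro a b m z
    have e1 : intChar γ (m - b) * intChar γ (-a) = intChar γ (m - a - b) := by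
      rw [← intChar_add]
      exact congrArg (intChar γ) (by ring)
    have h1 := mul_ite_mul_re_le (abs_obs_sub_sigCell ν (sh (a, b) z)) (z.1 (m - b, b))
      (z.1 (a, m - a)) (norm_intChar γ (-a)).le (hv _)
      (hd (if z.1 (m - b, b) then ξ * intChar γ (m - b) else 0) (by
        split_ifs
        · rw [norm_mul, hξ1, norm_intChar, one_mul]
        · simp))
      (hd (if z.1 (a, m - a) then intChar γ (-a) else 0) (by
        split_ifs
        · rw [norm_intChar]
        · simp))
    rw [mul_assoc ξ, e1] at h1
    have e2 : ((0 : ℤ × ℤ) + (m - a - b, 0)) + (a, b) = (m - b, b) := by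
      ext <;> simp
      all_goals ring
    have e3 : ((0 : ℤ × ℤ) + (0, m - a - b)) + (a, b) = (a, m - a) := by
      ext <;> simp
    have e4 : obs (sh (m - a - b, 0) (sh (a, b) z)) = if z.1 (m - b, b) then 1 else 0 := by
      rw [← e2]; rfl
    have e5 : obs (sh (0, m - a - b) (sh (a, b) z)) = if z.1 (a, m - a) then 1 else 0 := by
      rw [← e3]; rfl
    rw [e4, e5]
    refine h1.trans_eq ?_
    change _ = (obs (sh (a, b) z) - sigCell ν (sh (a, b) z)) *
      (v (d (if z.1 (m - (0 + b), 0 + b) then ξ * intChar γ (m - (0 + b)) else 0)) *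
        v (d (if z.1 (0 + a, m - (0 + a)) then intChar γ (-(0 + a)) else 0))).re
    simp only [zero_add]
  have key4 : ∀ a b m, (ξ * intChar γ (m - a - b)).re * resid ν (m - a - b) - 2 * δ ≤
      ∫ z, (⟨_, hjc⟩ : C(Sig (ι × Fin k), ℝ)) (sh (a, b) (Θ m z)) ∂ν := by
    intro a b m
    have hi' := (h.integrable_comp (a, b) (integrable_resid_integrand ν (m - a - b))).mul_const (ξ * intChar γ (m - a - b)).re
    refine le_trans (le_of_eq ?_) (integral_mono (hi'.sub (integrable_const (2 * δ)))
      (continuousMap_integrable ν ((⟨_, hjc⟩ : C(Sig (ι × Fin k), ℝ)).comp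
        ((sh (a, b)).comp (Θ m)))) fun z => key3 a b m z)
    rw [integral_sub' hi' (integrable_const (2 * δ)), integral_mul_const, integral_const,
      probReal_univ, one_smul, h.integral_comp (a, b) fun z => (obs z - sigCell ν z) *
        obs (sh (m - a - b, 0) z) * obs (sh (0, m - a - b) z), mul_comm]
    rfl
  have key5 : A (fun n => (ξ * intChar γ n).re * resid ν n) - 2 * δ ≤
      ∫ z, (obs z - sigCell ν (sigMap Prod.fst z)) * χ (rowSym z) (colSym z) ∂lam := by
    refine le_trans ?_ hle
    set j : C(Sig (ι × Fin k), ℝ) := ⟨_, hjc⟩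
    set ρ : ℤ → ℝ := fun n => (ξ * intChar γ n).re * resid ν n
    have hρ : ∀ n, |ρ n| ≤ 1 := fun n => by
      rw [abs_mul]
      refine mul_le_one₀ ((Complex.abs_re_le_norm _).trans ?_) (abs_nonneg _) (abs_resid ν n)
      rw [norm_mul, hξ1, norm_intChar, one_mul]
    have hJ : ∀ a b m, |∫ z, j (sh (a, b) (Θ m z)) ∂ν| ≤ ‖j‖ := fun a b m => by
      have := norm_integral_le_of_norm_le_const (μ := ν) (f := fun z => j (sh (a, b) (Θ m z)))
        (Eventually.of_forall fun z => j.norm_coe_le_norm _)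
      rwa [probReal_univ, mul_one] at this
    have hJ1 : ∀ a b, |A fun m => ∫ z, j (sh (a, b) (Θ m z)) ∂ν| ≤ ‖j‖ :=
      fun a b => A.abs_le (hJ a b)
    have hJ2 : ∀ a, |A fun b => A fun m => ∫ z, j (sh (a, b) (Θ m z)) ∂ν| ≤ ‖j‖ :=
      fun a => A.abs_le (hJ1 a)
    have h1 : ∀ a b, A ρ - 2 * δ ≤ A fun m => ∫ z, j (sh (a, b) (Θ m z)) ∂ν := fun a b => by
      have e : A ρ - 2 * δ = A fun m => ρ (m - a - b) + -(2 * δ) := by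
        rw [A.fun_add, A.const, ← hA ρ 1 hρ (-a - b), sub_eq_add_neg]
        simp only [sub_eq_add_neg, add_assoc]
      rw [e]
      refine A.mono (fun m => key4 a b m) (‖j‖ + 1 + 2 * δ) fun m => ?_
      have h2 := (abs_le.1 (hJ a b m)).2
      have h3 := (abs_le.1 (hρ (m - a - b))).1
      linarith
    have h2 : ∀ a, A ρ - 2 * δ ≤ A fun b => A fun m => ∫ z, j (sh (a, b) (Θ m z)) ∂ν :=
      fun a => by
        rw [← A.const (A ρ - 2 * δ)]
        exact A.mono (h1 a) (‖j‖ - (A ρ - 2 * δ)) fun b =>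
          sub_le_sub_right ((le_abs_self _).trans (hJ1 a b)) _
    rw [← A.const (A ρ - 2 * δ)]
    exact A.mono h2 (‖j‖ - (A ρ - 2 * δ)) fun a =>
      sub_le_sub_right ((le_abs_self _).trans (hJ2 a)) _
  linarith

end Symbolic

section Symbolic

variable {ι κ : Type} [TopologicalSpace ι] [DiscreteTopology ι] [Fintype ι] [DecidableEq ι]
  [MeasurableSpace ι] [BorelSpace ι] [TopologicalSpace κ] [DiscreteTopology κ] [Fintype κ]
  [DecidableEq κ] [MeasurableSpace κ] [BorelSpace κ] {ν : Measure (Sig ι)}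
  [IsProbabilityMeasure ν] {ν' : Measure (Sig κ)} [IsProbabilityMeasure ν'] {e : κ → ι}

theorem abs_resid_sub_resid_le (hπ : MeasurePreserving (sigMap e) ν' ν) (n : ℤ) :
    |resid ν n - resid ν' n| ≤ √(sigEnergy ν' - sigEnergy ν) := by
  have hc : Continuous fun z : Sig κ =>
      (obs z - sigCell ν (sigMap e z)) * obs (sh (n, 0) z) * obs (sh (0, n) z) :=
    (continuous_resid_integrand ν n).comp (sigMap e).continuous
  have e1 : resid ν n = ∫ z : Sig κ,
      (obs z - sigCell ν (sigMap e z)) * obs (sh (n, 0) z) * obs (sh (0, n) z) ∂ν' :=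
    (hπ.integral_comp_measurable (continuous_resid_integrand ν n).measurable).symm
  have e2 : resid ν n - resid ν' n = ∫ z : Sig κ, (sigCell ν' z - sigCell ν (sigMap e z)) *
      (obs (sh (n, 0) z) * obs (sh (0, n) z)) ∂ν' := by
    have i1 : Integrable (fun z : Sig κ => (obs z - sigCell ν (sigMap e z)) *
        obs (sh (n, 0) z) * obs (sh (0, n) z)) ν' := continuousMap_integrable ν' ⟨_, hc⟩
    rw [e1, resid, ← integral_sub i1 (integrable_resid_integrand ν' n)]
    refine integral_congr_ae (Eventually.of_forall fun z => ?_)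
    change (obs z - sigCell ν (sigMap e z)) * obs (sh (n, 0) z) * obs (sh (0, n) z) -
      (obs z - sigCell ν' z) * obs (sh (n, 0) z) * obs (sh (0, n) z) = _
    ring
  rw [e2]
  refine abs_integral_sigCell_sub_mul_le ν hπ fun z => ?_
  have h2 := obs_mem (sh (n, 0) z)
  have h3 := obs_mem (sh (0, n) z)
  rw [abs_mul, abs_of_nonneg h2.1, abs_of_nonneg h3.1]
  exact mul_le_one₀ h2.2 h3.1 h3.2

/-- The correlations of the colouring. -/
noncomputable def corr (ν : Measure (Sig ι)) (n : ℤ) : ℝ :=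
  ∫ z, obs z * obs (sh (n, 0) z) * obs (sh (0, n) z) ∂ν

omit [DecidableEq ι] [Fintype κ] [DecidableEq κ] [BorelSpace κ] [IsProbabilityMeasure ν]
  [IsProbabilityMeasure ν'] in
theorem corr_eq (hπ : MeasurePreserving (sigMap e) ν' ν) : corr ν' = corr ν := by
  funext n
  exact hπ.integral_comp_measurable
    (φ := fun z => obs z * obs (sh (n, 0) z) * obs (sh (0, n) z))
    (Continuous.measurable (by fun_prop))

omit [DecidableEq ι] [Fintype κ] [DecidableEq κ] [BorelSpace κ] [IsProbabilityMeasure ν]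
  [IsProbabilityMeasure ν'] in
theorem integral_obs_eq (hπ : MeasurePreserving (sigMap e) ν' ν) :
    ∫ z, obs z ∂ν' = ∫ z, obs z ∂ν :=
  hπ.integral_comp_measurable measurable_obs

theorem pow_four_integral_obs_le {A M : ZMean} (h : IsZZSystem ν fun u => sh u)
    (hE : IsZZErgodic ν fun u => sh u) (hA : A.Invariant) (hAM : IsBohr A M) :
    (∫ z, obs z ∂ν) ^ 4 ≤ M (corr ν) - M (resid ν) := by
  have h1 := pow_four_integral_le_mean h hE hA hAM measurable_obs obs_mem measurableSet_rowSym
    measurableSet_colSym rowSym_sh colSym_sh (F := cell ν obs rowSym colSym)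
    (cell_mem measurable_obs obs_mem measurableSet_rowSym measurableSet_colSym)
    (integral_mul_cell measurable_obs obs_mem measurableSet_rowSym measurableSet_colSym)
  refine h1.trans_eq ?_
  rw [← map_sub]
  congr 1
  funext n
  have hc : Continuous fun z : Sig ι => obs z * obs (sh (n, 0) z) * obs (sh (0, n) z) := by
    fun_prop
  have i1 : Integrable (fun z : Sig ι => obs z * obs (sh (n, 0) z) * obs (sh (0, n) z)) ν :=
    continuousMap_integrable ν ⟨_, hc⟩
  rw [Pi.sub_apply, corr, resid, ← integral_sub i1 (integrable_resid_integrand ν n)]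
  refine integral_congr_ae (Eventually.of_forall fun z => ?_)
  change sigCell ν z * obs (sh (n, 0) z) * obs (sh (0, n) z) =
    obs z * obs (sh (n, 0) z) * obs (sh (0, n) z) -
      (obs z - sigCell ν z) * obs (sh (n, 0) z) * obs (sh (0, n) z)
  ring

end Symbolic

/-- An ergodic shift invariant measure on a space of colourings. -/
structure SymbolicSystem where
  ι : Type
  [top : TopologicalSpace ι]
  [disc : DiscreteTopology ι]
  [fin : Fintype ι]
  [deq : DecidableEq ι]
  [meas : MeasurableSpace ι]
  [borel : BorelSpace ι]
  ν : Measure (Sig ι)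
  [prob : IsProbabilityMeasure ν]
  sys : IsZZSystem ν fun u => sh u
  erg : IsZZErgodic ν fun u => sh u

namespace SymbolicSystem

attribute [instance] top disc fin deq meas borel prob

/-- `O'` is obtained from `O` by refining the colouring of the rows and columns. -/
def Ext (O O' : SymbolicSystem) : Prop :=
  ∃ e : O'.ι → O.ι, MeasurePreserving (sigMap e) O'.ν O.ν

theorem Ext.refl (O : SymbolicSystem) : Ext O O :=
  ⟨id, MeasurePreserving.id _⟩

theorem Ext.trans {O O' O'' : SymbolicSystem} : Ext O O' → Ext O' O'' → Ext O O'' :=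
  fun ⟨e, he⟩ ⟨e', he'⟩ => ⟨e ∘ e', he.comp he'⟩

theorem exists_sated (O : SymbolicSystem) {η : ℝ} (hη : 0 < η) :
    ∃ O', Ext O O' ∧ ∀ O'', Ext O' O'' → sigEnergy O''.ν ≤ sigEnergy O'.ν + η := by
  set S : Set ℝ := {x | ∃ O', Ext O O' ∧ sigEnergy O'.ν = x}
  have hne : S.Nonempty := ⟨_, O, Ext.refl O, rfl⟩
  have hbdd : BddAbove S := ⟨1, by
    rintro _ ⟨O', -, rfl⟩
    exact (energy_mem measurable_obs obs_mem measurableSet_rowSym measurableSet_colSym).2⟩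
  obtain ⟨_, ⟨O', h1, rfl⟩, h2⟩ := exists_lt_of_lt_csSup hne (sub_lt_self (sSup S) hη)
  exact ⟨O', h1, fun O'' h3 => by linarith [le_csSup hbdd ⟨O'', h1.trans h3, rfl⟩]⟩

theorem norm_cx_resid_le {A : ZMean} (hA : A.Invariant) (O : SymbolicSystem) {η : ℝ}
    (hO : ∀ O', Ext O O' → sigEnergy O'.ν ≤ sigEnergy O.ν + η) (γ : Circle) :
    ‖A.cx (intChar γ * fun n => (resid O.ν n : ℂ))‖ ≤ √η := by
  refine le_of_forall_pos_le_add fun δ hδ => ?_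
  obtain ⟨k, lam, hlam, hs, he, hmp, hle⟩ := exists_extension hA O.sys O.erg γ (half_pos hδ)
  have h1 := hO ⟨O.ι × Fin k, lam, hs, he⟩ ⟨Prod.fst, hmp⟩
  have h2 : √(sigEnergy lam - sigEnergy O.ν) ≤ √η := Real.sqrt_le_sqrt (sub_le_iff_le_add'.2 h1)
  linarith

theorem exists_sated_seq (O : SymbolicSystem) {η : ℕ → ℝ} (hη : ∀ i, 0 < η i) :
    ∃ P : ℕ → SymbolicSystem, (∀ i, Ext O (P i)) ∧ (∀ i j, i ≤ j → Ext (P i) (P j)) ∧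
      ∀ i O', Ext (P i) O' → sigEnergy O'.ν ≤ sigEnergy (P i).ν + η i := by
  choose g hg1 hg2 using fun (x : {η : ℝ // 0 < η}) (O : SymbolicSystem) => O.exists_sated x.2
  set P : ℕ → SymbolicSystem := fun i => Nat.rec (g ⟨η 0, hη 0⟩ O)
    (fun i O' => g ⟨η (i + 1), hη (i + 1)⟩ O') i
  have hP : ∀ i j, i ≤ j → Ext (P i) (P j) := fun i j hij => by
    induction j, hij using Nat.le_induction with
    | base => exact Ext.refl _
    | succ j _ ih => exact ih.trans (hg1 _ _)
  refine ⟨P, fun i => (hg1 ⟨η 0, hη 0⟩ O).trans (hP 0 i (Nat.zero_le i)), hP, fun i => ?_⟩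
  cases i with
  | zero => exact hg2 _ _
  | succ i => exact hg2 _ _

theorem pow_four_integral_obs_le_mean_corr (O : SymbolicSystem) {A M : ZMean} (hA : A.Invariant)
    (hM : ∀ γ, M (fun n => ‖intChar γ n - 1‖) = 0)
    (hM' : ∀ (c : ℕ → ℤ → ℝ) (d : ℤ → ℝ) (C δ : ℝ),
      (∀ γ, Tendsto (fun i => A.cx (intChar γ * fun n => (c i n : ℂ))) atTop (𝓝 0)) →
      (∀ n, |d n| ≤ C) → (∀ᶠ i in atTop, ∀ n, |d n - c i n| ≤ δ) → |M d| ≤ δ) :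
    (∫ z, obs z ∂O.ν) ^ 4 ≤ M (corr O.ν) := by
  have hAM : IsBohr A M := ⟨hM, fun c C hC h => abs_nonpos_iff.1 (hM' (fun _ => c) c C 0
    (fun γ => by simp only [h γ, tendsto_const_nhds_iff]) hC (by simp))⟩
  obtain ⟨P, h1, h2, h3⟩ := O.exists_sated_seq (η := fun i => ((1 / 2 : ℝ) ^ i) ^ 2)
    fun i => by positivity
  have hs : ∀ i : ℕ, √(((1 / 2 : ℝ) ^ i) ^ 2) = (1 / 2) ^ i := fun i =>
    Real.sqrt_sq (by positivity)
  have hlim : Tendsto (fun i : ℕ => (1 / 2 : ℝ) ^ i) atTop (𝓝 0) :=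
    tendsto_pow_atTop_nhds_zero_of_lt_one (by norm_num) (by norm_num)
  have hR : ∀ j, |M (resid (P j).ν)| ≤ (1 / 2) ^ j := fun j => by
    refine hM' (fun i => resid (P i).ν) _ 1 _ (fun γ => ?_) (abs_resid _)
      (eventually_atTop.2 ⟨j, fun i hij n => ?_⟩)
    · refine squeeze_zero_norm (fun i => ?_) hlim
      rw [← hs i]
      exact norm_cx_resid_le hA (P i) (h3 i) γ
    · obtain ⟨e, he⟩ := h2 j i hij
      refine (abs_resid_sub_resid_le he n).trans ?_
      rw [← hs j]
      exact Real.sqrt_le_sqrt (sub_le_iff_le_add'.2 (h3 j _ (h2 j i hij)))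
  have hle : ∀ j : ℕ, (∫ z, obs z ∂O.ν) ^ 4 - (1 / 2) ^ j ≤ M (corr O.ν) := fun j => by
    obtain ⟨e, he⟩ := h1 j
    have h4 := pow_four_integral_obs_le (P j).sys (P j).erg hA hAM
    rw [integral_obs_eq he, corr_eq he] at h4
    linarith [(abs_le.1 (hR j)).1]
  have := hlim.const_sub ((∫ z, obs z ∂O.ν) ^ 4)
  rw [sub_zero] at this
  exact le_of_tendsto this (Eventually.of_forall hle)

end SymbolicSystem

section Coding

variable {X : Type*} [MeasurableSpace X] {μ : Measure X}

theorem measurePreserving_zpow {T : X ≃ᵐ X} (h : MeasurePreserving T μ μ) (n : ℤ) :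
    MeasurePreserving ⇑(T.toEquiv ^ n) μ μ := by
  induction n with
  | zero => exact MeasurePreserving.id μ
  | succ n ih =>
    rw [zpow_add_one, Equiv.Perm.coe_mul]
    exact ih.comp h
  | pred n ih =>
    rw [zpow_sub_one, Equiv.Perm.coe_mul]
    exact ih.comp (h.symm T)

/-- The joint action of two commuting transformations. -/
def jointPerm (T₁ T₂ : X ≃ᵐ X) (u : ℤ × ℤ) : Equiv.Perm X :=
  T₁.toEquiv ^ (-u.1) * T₂.toEquiv ^ (-u.2)

theorem jointPerm_add {T₁ T₂ : X ≃ᵐ X} (hcomm : ∀ x, T₁ (T₂ x) = T₂ (T₁ x)) (u v : ℤ × ℤ) :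
    jointPerm T₁ T₂ (u + v) = jointPerm T₁ T₂ u * jointPerm T₁ T₂ v := by
  have hc : Commute (T₁.toEquiv : Equiv.Perm X) T₂.toEquiv := Equiv.ext hcomm
  simp only [jointPerm, Prod.fst_add, Prod.snd_add, neg_add, zpow_add]
  have := (hc.zpow_zpow (-v.1) (-u.2)).eq
  rw [mul_assoc, mul_assoc, ← mul_assoc (T₁.toEquiv ^ (-v.1)), this, mul_assoc]

theorem measurePreserving_jointPerm {T₁ T₂ : X ≃ᵐ X} (h₁ : MeasurePreserving T₁ μ μ)
    (h₂ : MeasurePreserving T₂ μ μ) (u : ℤ × ℤ) :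
    MeasurePreserving (jointPerm T₁ T₂ u) μ μ :=
  (measurePreserving_zpow h₁ (-u.1)).comp (measurePreserving_zpow h₂ (-u.2))

open Classical in
/-- The colouring of the orbit of a point by its visits to `A`. -/
noncomputable def coding (T₁ T₂ : X ≃ᵐ X) (A : Set X) (x : X) : Sig Unit :=
  (fun u => decide (jointPerm T₁ T₂ u x ∈ A), fun _ => (), fun _ => ())

variable {T₁ T₂ : X ≃ᵐ X} {A : Set X}

theorem sh_coding (hcomm : ∀ x, T₁ (T₂ x) = T₂ (T₁ x)) (u : ℤ × ℤ) (x : X) :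
    sh u (coding T₁ T₂ A x) = coding T₁ T₂ A (jointPerm T₁ T₂ u x) := by
  refine Prod.ext (funext fun v => ?_) rfl
  have e : jointPerm T₁ T₂ (v + u) x = jointPerm T₁ T₂ v (jointPerm T₁ T₂ u x) := by
    rw [jointPerm_add hcomm, Equiv.Perm.mul_apply]
  exact congrArg (fun y => @decide (y ∈ A) (Classical.propDecidable _)) e

theorem measurable_coding (h₁ : MeasurePreserving T₁ μ μ) (h₂ : MeasurePreserving T₂ μ μ)
    (hA : MeasurableSet A) : Measurable (coding T₁ T₂ A) := by
  refine Measurable.prodMk (measurable_pi_lambda _ fun u => measurable_to_bool ?_)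
    measurable_const
  have e : (fun x => (coding T₁ T₂ A x).1 u) ⁻¹' {true} = jointPerm T₁ T₂ u ⁻¹' A := by
    ext x; simp [coding]
  exact e ▸ (measurePreserving_jointPerm h₁ h₂ u).measurable hA

theorem isZZSystem_coding (h₁ : MeasurePreserving T₁ μ μ) (h₂ : MeasurePreserving T₂ μ μ)
    (hcomm : ∀ x, T₁ (T₂ x) = T₂ (T₁ x)) (hA : MeasurableSet A) :
    IsZZSystem (μ.map (coding T₁ T₂ A)) fun u => sh u := by
  have hm := measurable_coding h₁ h₂ hA
  refine ⟨sh_zero, sh_add, fun u => ⟨(sh u).continuous.measurable, ?_⟩⟩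
  have hj := measurePreserving_jointPerm h₁ h₂ u
  rw [Measure.map_map (sh u).continuous.measurable hm]
  conv_rhs => rw [← hj.map_eq, Measure.map_map hm hj.measurable]
  congr 1
  exact funext fun x => sh_coding hcomm u x

theorem isZZErgodic_coding (h₁ : MeasurePreserving T₁ μ μ) (h₂ : MeasurePreserving T₂ μ μ)
    (hcomm : ∀ x, T₁ (T₂ x) = T₂ (T₁ x))
    (herg : ∀ s : Set X, MeasurableSet s → T₁ ⁻¹' s = s → T₂ ⁻¹' s = s → μ s = 0 ∨ μ s = 1)
    (hA : MeasurableSet A) :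
    IsZZErgodic (μ.map (coding T₁ T₂ A)) fun u => sh u := by
  intro s hs hinv
  have hm := measurable_coding h₁ h₂ hA
  have hinv' : ∀ u x, coding T₁ T₂ A (jointPerm T₁ T₂ u x) ∈ s ↔ coding T₁ T₂ A x ∈ s :=
    fun u x => by
      rw [← sh_coding hcomm]
      exact Set.ext_iff.1 (hinv u) _
  rw [Measure.map_apply hm hs]
  refine herg _ (hm hs) (Set.ext fun x => ?_) (Set.ext fun x => ?_)
  · have e : jointPerm T₁ T₂ (-1, 0) x = T₁ x := by simp [jointPerm]
    have := hinv' (-1, 0) x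
    rwa [e] at this
  · have e : jointPerm T₁ T₂ (0, -1) x = T₂ x := by simp [jointPerm]
    have := hinv' (0, -1) x
    rwa [e] at this

theorem obs_sh_coding (u : ℤ × ℤ) (x : X) : obs (sh u (coding T₁ T₂ A x)) =
    (jointPerm T₁ T₂ u ⁻¹' A).indicator 1 x := by
  classical
  change (if (coding T₁ T₂ A x).1 (0 + u) then (1 : ℝ) else 0) = _
  simp [coding, Set.indicator_apply]

theorem obs_coding (x : X) : obs (coding T₁ T₂ A x) = A.indicator 1 x := by
  have h := obs_sh_coding (T₁ := T₁) (T₂ := T₂) (A := A) 0 x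
  rw [sh_zero] at h
  exact h

theorem integral_obs_coding (h₁ : MeasurePreserving T₁ μ μ) (h₂ : MeasurePreserving T₂ μ μ)
    (hA : MeasurableSet A) :
    ∫ z, obs z ∂(μ.map (coding T₁ T₂ A)) = (μ A).toReal := by
  rw [integral_map (measurable_coding h₁ h₂ hA).aemeasurable measurable_obs.aestronglyMeasurable]
  simp only [obs_coding]
  exact integral_indicator_one hA

theorem corr_coding (h₁ : MeasurePreserving T₁ μ μ) (h₂ : MeasurePreserving T₂ μ μ)
    (hA : MeasurableSet A) (n : ℤ) :
    corr (μ.map (coding T₁ T₂ A)) n =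
      (μ (A ∩ ⇑(T₁.toEquiv ^ n) '' A ∩ ⇑(T₂.toEquiv ^ n) '' A)).toReal := by
  have e1 : ⇑(T₁.toEquiv ^ n) '' A = jointPerm T₁ T₂ (n, 0) ⁻¹' A := by
    rw [Equiv.image_eq_preimage_symm]
    simp [jointPerm]
  have e2 : ⇑(T₂.toEquiv ^ n) '' A = jointPerm T₁ T₂ (0, n) ⁻¹' A := by
    rw [Equiv.image_eq_preimage_symm]
    simp [jointPerm]
  have hc : Continuous fun z : Sig Unit => obs z * obs (sh (n, 0) z) * obs (sh (0, n) z) := by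
    fun_prop
  rw [corr, integral_map (measurable_coding h₁ h₂ hA).aemeasurable
    hc.measurable.aestronglyMeasurable, e1, e2]
  simp only [obs_coding, obs_sh_coding, ← Set.inter_indicator_mul]
  have hm : ∀ u, MeasurableSet (jointPerm T₁ T₂ u ⁻¹' A) := fun u =>
    (measurePreserving_jointPerm h₁ h₂ u).measurable hA
  have := integral_indicator_one (μ := μ) ((hA.inter (hm (n, 0))).inter (hm (0, n)))
  rw [Measure.real] at this
  rw [← this]
  refine integral_congr_ae (Eventually.of_forall fun x => ?_)
  by_cases q1 : x ∈ A <;> by_cases q2 : x ∈ jointPerm T₁ T₂ (n, 0) ⁻¹' A <;>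
    by_cases q3 : x ∈ jointPerm T₁ T₂ (0, n) ⁻¹' A <;> simp [q1, q2, q3]

end Coding

theorem exists_le_of_not_syndetic {E : Set ℤ} (hE : ¬ Syndetic E) (N : ℕ) :
    ∃ s : ℤ, ∀ k ∈ Finset.range (N + 1), s + (k : ℤ) ∉ E := by
  unfold Syndetic at hE
  push Not at hE
  obtain ⟨s, hs⟩ := hE (N + 1) (by positivity)
  refine ⟨s, fun k hk hkE => ?_⟩
  have h1 := hs _ hkE (by omega)
  have h2 := Finset.mem_range.1 hk
  omega

theorem multiple_recurrence_two_commuting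
    {X : Type*} [MeasurableSpace X] (μ : Measure X) [IsProbabilityMeasure μ]
    (T₁ T₂ : X ≃ᵐ X)
    (h₁ : MeasurePreserving T₁ μ μ) (h₂ : MeasurePreserving T₂ μ μ)
    (hcomm : ∀ x, T₁ (T₂ x) = T₂ (T₁ x))
    (herg : ∀ s : Set X, MeasurableSet s → T₁ ⁻¹' s = s → T₂ ⁻¹' s = s →
      μ s = 0 ∨ μ s = 1)
    (A : Set X) (hA : MeasurableSet A) (hA0 : 0 < μ A)
    (ε : ℝ) (hε : 0 < ε) :
    Syndetic {n : ℤ |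
      (μ (A ∩ ⇑(T₁.toEquiv ^ n) '' A ∩ ⇑(T₂.toEquiv ^ n) '' A)).toReal >
        (μ A).toReal ^ 4 - ε} := by
  by_contra hsyn
  choose s hs using exists_le_of_not_syndetic hsyn
  have : IsProbabilityMeasure (μ.map (coding T₁ T₂ A)) :=
    Measure.isProbabilityMeasure_map (measurable_coding h₁ h₂ hA).aemeasurable
  let O : SymbolicSystem := ⟨Unit, μ.map (coding T₁ T₂ A), isZZSystem_coding h₁ h₂ hcomm hA,
    isZZErgodic_coding h₁ h₂ hcomm herg hA⟩
  set β := (μ A).toReal ^ 4 - ε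
  set c := corr O.ν
  have hc : ∀ n, c n = (μ (A ∩ ⇑(T₁.toEquiv ^ n) '' A ∩ ⇑(T₂.toEquiv ^ n) '' A)).toReal :=
    corr_coding h₁ h₂ hA
  have hc1 : ∀ n, |c n| ≤ 1 := fun n => by
    rw [hc, abs_of_nonneg ENNReal.toReal_nonneg]
    exact ENNReal.toReal_le_of_le_ofReal zero_le_one (by simpa using prob_le_one)
  obtain ⟨L, hL, hLs⟩ := ZMean.exists_invariant s
  obtain ⟨M, hM1, hM2, hM3⟩ := hL.exists_bohr
  have h3 := O.pow_four_integral_obs_le_mean_corr hL hM1 hM2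
  rw [show ∫ z, obs z ∂O.ν = (μ A).toReal from integral_obs_coding h₁ h₂ hA] at h3
  have h4 : M c ≤ β := by
    refine hM3 c 1 β hc1 fun w D hw hwD => ?_
    have h5 : L (w * c + (-β) • w) ≤ 0 := by
      refine hLs _ (D * (1 + |β|)) 0 (fun n => ?_) fun N => ?_
      · rw [Pi.add_apply, Pi.mul_apply, Pi.smul_apply, smul_eq_mul, mul_comm (-β), ← mul_add,
          abs_mul, abs_of_nonneg (hw n)]
        refine mul_le_mul (hwD n) ((abs_add_le _ _).trans ?_) (abs_nonneg _)
          ((hw n).trans (hwD n))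
        rw [abs_neg]
        linarith [hc1 n]
      · rw [ZMean.avg_apply]
        refine mul_nonpos_of_nonneg_of_nonpos (by positivity)
          (Finset.sum_nonpos fun k hk => ?_)
        have h6 : c (s N + k) ≤ β := by
          rw [hc]
          exact not_lt.1 (hs N k hk)
        rw [Pi.add_apply, Pi.mul_apply, Pi.smul_apply, smul_eq_mul]
        nlinarith [hw (s N + k)]
    rw [map_add, map_smul, smul_eq_mul] at h5
    linarith
  linarith
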